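/- The ring of invariants K[X]^{SL_n(K)} is Cohen–Macaulay: for every prime ideal 𝔭 of K[X]^{SL_n(K)}, the localization of K[X]^{SL_n(K)} at 𝔭 is a Cohen–Macaulay local ring (its depth equals its Krull dimension). -/

import Mathlib

namespace SMB

/-- `geTup f g` : the strictly increasing tuple `f` is `≥` the strictly increasing tuple `g`
in the order on increasing tuples: the length of `f` is at most that of `g`, and `f` is
entrywise `≥` `g` (on the common range of indices). -/
def geTup {N s s' : ℕ} (f : Fin s → Fin N) (g : Fin s' → Fin N) : Prop :=
  ∃ h : s ≤ s', ∀ j : Fin s, g (Fin.castLE h j) ≤ f j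

/-- A strictly increasing `s`-tuple with values in `{1,…,N}` (encoded as `Fin N`). -/
structure IncTup (s N : ℕ) where
  f : Fin s → Fin N
  mono : StrictMono f

/-- A pair of strictly increasing tuples of a common length `s`: row indices in `{1,…,m}`
and column indices in `{1,…,q}`, indexing an `s × s` minor. -/
structure PairIx (m q : ℕ) where
  s : ℕ
  rows : Fin s → Fin m
  cols : Fin s → Fin q
  rmono : StrictMono rows
  cmono : StrictMono cols

/-- The partial order `(A,B) ⪰ (A',B')` on pairs of increasing tuples: `A ≥ A'` and `B ≥ B'`. -/
def PairIx.ge {m q : ℕ} (x y : PairIx m q) : Prop :=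
  geTup x.rows y.rows ∧ geTup x.cols y.cols

end SMB
namespace SMB

variable (K : Type) [Field K] (n m q : ℕ)

/-- The coordinate ring `K[X]` of `X = M_{m,n}(K) × M_{n,q}(K)`: the polynomial ring over `K`
in the entries of a generic `m×n` matrix `U` and a generic `n×q` matrix `W`. -/
abbrev KX := MvPolynomial ((Fin m × Fin n) ⊕ (Fin n × Fin q)) K

/-- The generic `m×n` matrix `U = (u_{ij})`. -/
noncomputable def Ugen : Matrix (Fin m) (Fin n) (KX K n m q) :=
  Matrix.of fun i j => MvPolynomial.X (Sum.inl (i, j))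

/-- The generic `n×q` matrix `W = (ξ_{kl})`. -/
noncomputable def Wgen : Matrix (Fin n) (Fin q) (KX K n m q) :=
  Matrix.of fun k l => MvPolynomial.X (Sum.inr (k, l))

/-- `φ_{ij}`, the `(i,j)` entry of the product matrix `UW`. -/
noncomputable def phi (i : Fin m) (j : Fin q) : KX K n m q :=
  (Ugen K n m q * Wgen K n m q) i j

/-- Evaluation of a polynomial in `K[X]` at a point `(U, W) ∈ X`. -/
noncomputable def evalX (U : Matrix (Fin m) (Fin n) K) (W : Matrix (Fin n) (Fin q) K) :
    KX K n m q →+* K :=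
  MvPolynomial.eval (Sum.elim (fun p => U p.1 p.2) (fun p => W p.1 p.2))

variable {K n m q}

/-- `f ∈ K[X]` is invariant under the diagonal action of `GL_n(K)`:
`f(UA, A⁻¹W) = f(U, W)` for all `A ∈ GL_n(K)` and all `(U,W) ∈ X`. -/
def IsGLInvariant (f : KX K n m q) : Prop :=
  ∀ (A : GL (Fin n) K) (U : Matrix (Fin m) (Fin n) K) (W : Matrix (Fin n) (Fin q) K),
    evalX K n m q (U * (A : Matrix (Fin n) (Fin n) K))
      (((A⁻¹ : GL (Fin n) K) : Matrix (Fin n) (Fin n) K) * W) f = evalX K n m q U W f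

/-- `f ∈ K[X]` is invariant under the diagonal action of `SL_n(K)`:
`f(UA, A⁻¹W) = f(U, W)` for all `A ∈ SL_n(K)` and all `(U,W) ∈ X`. -/
def IsSLInvariant (f : KX K n m q) : Prop :=
  ∀ (A : Matrix.SpecialLinearGroup (Fin n) K)
    (U : Matrix (Fin m) (Fin n) K) (W : Matrix (Fin n) (Fin q) K),
    evalX K n m q (U * (A : Matrix (Fin n) (Fin n) K))
      (((A⁻¹ : Matrix.SpecialLinearGroup (Fin n) K) : Matrix (Fin n) (Fin n) K) * W) f
      = evalX K n m q U W f

variable (K n m q)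

end SMB
namespace SMB

variable (K : Type) [Field K] (n m q : ℕ)

/-- The ring of invariants `K[X]^{SL_n(K)}`, as a subalgebra of `K[X]`. -/
noncomputable def slInvariants : Subalgebra K (KX K n m q) where
  carrier := {f | IsSLInvariant f}
  mul_mem' := by
    intro a b ha hb A U W
    rw [map_mul, map_mul, ha A U W, hb A U W]
  one_mem' := by intro A U W; rw [map_one, map_one]
  add_mem' := by
    intro a b ha hb A U W
    rw [map_add, map_add, ha A U W, hb A U W]
  zero_mem' := by intro A U W; rw [map_zero, map_zero]
  algebraMap_mem' := by
    intro c A U W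
    simp only [MvPolynomial.algebraMap_eq, evalX, MvPolynomial.eval_C]

end SMB

namespace SMB

/-- The depth of a local ring `R`: the supremum of the lengths of regular sequences all of
whose entries lie in the maximal ideal. -/
noncomputable def localDepth (R : Type) [CommRing R] [IsLocalRing R] : WithBot (WithTop ℕ) :=
  sSup {k : WithBot (WithTop ℕ) | ∃ rs : List R,
    k = (rs.length : ℕ) ∧
    (∀ x ∈ rs, x ∈ IsLocalRing.maximalIdeal R) ∧
    RingTheory.Sequence.IsRegular R rs}

end SMB

section MaxDepth

open IsLocalRing RingTheory.Sequence

/-- A local ring has a weakly regular sequence in its maximal ideal at least as long as its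
dimension. -/
def HasMaxDepth (R : Type*) [CommRing R] [IsLocalRing R] : Prop :=
  ∃ rs : List R, (∀ x ∈ rs, x ∈ maximalIdeal R) ∧ IsWeaklyRegular R rs ∧
    ringKrullDim R ≤ rs.length

theorem HasMaxDepth.of_flat {R S : Type*} [CommRing R] [IsLocalRing R] [CommRing S]
    [IsLocalRing S] [Algebra R S] [Module.Flat R S] [IsLocalHom (algebraMap R S)]
    (h : HasMaxDepth R) (hdim : ringKrullDim S ≤ ringKrullDim R) : HasMaxDepth S := by
  obtain ⟨rs, h1, h2, h3⟩ := h
  refine ⟨rs.map (algebraMap R S), ?_, h2.of_flat, by simpa using hdim.trans h3⟩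
  intro x hx
  obtain ⟨y, hy, rfl⟩ := List.mem_map.1 hx
  exact map_nonunit (algebraMap R S) y (h1 y hy)

theorem HasMaxDepth.of_ringEquiv {R S : Type*} [CommRing R] [IsLocalRing R] [CommRing S]
    [IsLocalRing S] (h : HasMaxDepth R) (e : R ≃+* S) : HasMaxDepth S := by
  algebraize [e.toRingHom]
  have : Module.Flat R S := (RingHom.Flat.of_bijective (f := e.toRingHom) e.bijective)
  have : IsLocalHom (algebraMap R S) := by
    change IsLocalHom e.toRingHom
    exact ⟨fun a ha => (isUnit_map_iff e a).1 ha⟩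
  exact h.of_flat (ringKrullDim_eq_of_ringEquiv e).ge

theorem isWeaklyRegular_polynomial_append {R : Type*} [CommRing R] {rs : List R}
    (h : IsWeaklyRegular R rs) {y : Polynomial R} (hy : y.Monic) :
    IsWeaklyRegular (Polynomial R) (rs.map Polynomial.C ++ [y]) := by
  rw [isWeaklyRegular_append_iff]
  refine ⟨h.of_flat, ?_⟩
  rw [isWeaklyRegular_singleton_iff]
  have hI : (Ideal.ofList (rs.map Polynomial.C) • ⊤ : Ideal (Polynomial R)) =
      (Ideal.ofList rs).map Polynomial.C := by
    rw [← Ideal.map_ofList]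
    simp
  intro a b hab
  induction a using Submodule.Quotient.induction_on with | _ a
  induction b using Submodule.Quotient.induction_on with | _ b
  simp only [← Submodule.Quotient.mk_smul] at hab
  rw [Submodule.Quotient.eq] at hab ⊢
  rw [hI, Ideal.mem_map_C_iff] at hab ⊢
  rw [← smul_sub, smul_eq_mul] at hab
  have key : (a - b).map (Ideal.Quotient.mk (Ideal.ofList rs)) = 0 := by
    have : (y * (a - b)).map (Ideal.Quotient.mk (Ideal.ofList rs)) = 0 := by
      ext k
      simp only [Polynomial.coeff_map, Polynomial.coeff_zero]
      exact Ideal.Quotient.eq_zero_iff_mem.2 (hab k)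
    rw [Polynomial.map_mul] at this
    exact ((hy.map _).mul_right_eq_zero_iff).1 this
  intro k
  rw [← Ideal.Quotient.eq_zero_iff_mem, ← Polynomial.coeff_map, key, Polynomial.coeff_zero]

theorem HasMaxDepth.localization_polynomial_of_comap_eq {R : Type*} [CommRing R] [IsLocalRing R]
    [IsNoetherianRing R] (h : HasMaxDepth R) (p : Ideal (Polynomial R)) [p.IsPrime]
    (hmax : p.comap Polynomial.C = maximalIdeal R) : HasMaxDepth (Localization.AtPrime p) := by
  obtain ⟨rs, h1, h2, h3⟩ := h
  have hle : (maximalIdeal R).map Polynomial.C ≤ p := by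
    simpa [← hmax] using Ideal.map_comap_le
  by_cases eq : p = (maximalIdeal R).map Polynomial.C
  · refine ⟨(rs.map (Polynomial.C)).map (algebraMap _ (Localization.AtPrime p)), ?_, ?_, ?_⟩
    · intro x hx
      simp only [List.map_map, List.mem_map] at hx
      obtain ⟨y, hy, rfl⟩ := hx
      rw [Function.comp, IsLocalization.AtPrime.to_map_mem_maximal_iff _ p]
      exact hle (Ideal.mem_map_of_mem _ (h1 y hy))
    · exact IsWeaklyRegular.of_isLocalization _ p.primeCompl
        (IsWeaklyRegular.of_flat (S := Polynomial R) h2)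
    · rw [IsLocalization.AtPrime.ringKrullDim_eq_height p]
      simp only [List.length_map]
      refine le_trans ?_ h3
      rw [← maximalIdeal_height_eq_ringKrullDim, ← Polynomial.height_map_C (maximalIdeal R), ← eq]
  · have : (p.comap Polynomial.C).IsMaximal := by simpa [hmax] using maximalIdeal.isMaximal R
    obtain ⟨y, hy, hpy⟩ := Polynomial.exists_monic_span_sup_map_eq R p this (by simpa [hmax])
    have hyp : y ∈ p := by
      rw [hpy]; exact Ideal.mem_sup_right (Ideal.mem_span_singleton_self y)
    refine ⟨(rs.map (Polynomial.C) ++ [y]).map (algebraMap _ (Localization.AtPrime p)), ?_, ?_, ?_⟩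
    · intro x hx
      obtain ⟨z, hz, rfl⟩ := List.mem_map.1 hx
      rw [IsLocalization.AtPrime.to_map_mem_maximal_iff _ p]
      rw [List.mem_append] at hz
      rcases hz with hz | hz
      · obtain ⟨w, hw, rfl⟩ := List.mem_map.1 hz
        exact hle (Ideal.mem_map_of_mem _ (h1 w hw))
      · simp only [List.mem_singleton] at hz
        rwa [hz]
    · exact IsWeaklyRegular.of_isLocalization _ p.primeCompl
        (isWeaklyRegular_polynomial_append h2 hy)
    · rw [IsLocalization.AtPrime.ringKrullDim_eq_height p]
      simp only [List.length_map, List.length_append, List.length_singleton]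
      have h4 : ((p.height : ℕ∞) : WithBot ℕ∞) ≤ ringKrullDim (Polynomial R) :=
        Ideal.height_le_ringKrullDim_of_ne_top (Ideal.IsPrime.ne_top ‹_›)
      rw [Polynomial.ringKrullDim_of_isNoetherianRing] at h4
      refine h4.trans ?_
      push_cast
      exact add_le_add_left h3 1

/-- All localizations at primes have maximal depth. -/
def LocallyMaxDepth (R : Type*) [CommRing R] : Prop :=
  ∀ (p : Ideal R) [p.IsPrime], HasMaxDepth (Localization.AtPrime p)

open Polynomial Ideal in
theorem LocallyMaxDepth.polynomial {R : Type*} [CommRing R] [IsNoetherianRing R]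
    (h : LocallyMaxDepth R) : LocallyMaxDepth (Polynomial R) := by
  intro p hp
  let q := p.comap C
  let S := (Localization.AtPrime q)[X]
  let pc := Submonoid.map Polynomial.C.toMonoidHom q.primeCompl
  let : Algebra R[X] S := algebra R (Localization.AtPrime q)
  have : IsLocalization pc S := Polynomial.isLocalization _ _
  let pS := p.map (algebraMap R[X] S)
  have disj : Disjoint (pc : Set R[X]) (p : Set R[X]) := by
    simpa [pc, q] using! Set.disjoint_image_left.mpr
      (Set.disjoint_compl_left_iff_subset.mpr (fun _ a ↦ a))
  have : pS.IsPrime := IsLocalization.isPrime_of_isPrime_disjoint pc _ _ ‹_› disj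
  have : IsLocalization.AtPrime (Localization.AtPrime pS) p := by
    convert IsLocalization.isLocalization_isLocalization_atPrime_isLocalization pc
      (Localization.AtPrime pS) pS
    exact (IsLocalization.under_map_of_isPrime_disjoint pc _ ‹_› disj).symm
  have hq := h q
  have eq : comap C pS = maximalIdeal (Localization.AtPrime q) := by
    rw [← IsLocalization.map_under q.primeCompl _ (comap C pS),
      ← IsLocalization.map_under q.primeCompl _ (maximalIdeal (Localization.AtPrime q))]
    simp only [comap_comap, S, pS]
    rw [← Polynomial.algebraMap_eq (R := Localization.AtPrime q),
      ← IsScalarTower.algebraMap_eq R (Localization.AtPrime q) (Localization.AtPrime q)[X],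
      IsScalarTower.algebraMap_eq R R[X] (Localization.AtPrime q)[X], ← comap_comap,
      ← Ideal.under_def R[X], IsLocalization.under_map_of_isPrime_disjoint pc _ ‹_› disj]
    simp [q, IsLocalization.AtPrime.under_maximalIdeal (Localization.AtPrime q) q]
  have : IsNoetherianRing (Localization.AtPrime q) :=
    IsLocalization.isNoetherianRing q.primeCompl _ inferInstance
  have := hq.localization_polynomial_of_comap_eq pS eq
  exact this.of_ringEquiv (IsLocalization.algEquiv p.primeCompl
    (Localization.AtPrime pS) (Localization.AtPrime p)).toRingEquiv

theorem LocallyMaxDepth.of_ringEquiv {R S : Type*} [CommRing R] [CommRing S]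
    (h : LocallyMaxDepth R) (e : R ≃+* S) : LocallyMaxDepth S := by
  intro p hp
  have := h (p.comap e)
  exact this.of_ringEquiv (Localization.localRingEquiv _ p e rfl)

theorem LocallyMaxDepth.of_field (K : Type*) [Field K] : LocallyMaxDepth K := by
  intro p hp
  refine ⟨[], by simp, by simp, ?_⟩
  rw [IsLocalization.AtPrime.ringKrullDim_eq_height p]
  have : p = ⊥ := (Ideal.eq_bot_or_top p).resolve_right hp.ne_top
  simp [this]

theorem locallyMaxDepth_mvPolynomial (K : Type*) [Field K] (d : ℕ) :
    LocallyMaxDepth (MvPolynomial (Fin d) K) := by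
  induction d with
  | zero =>
    exact (LocallyMaxDepth.of_field K).of_ringEquiv (MvPolynomial.isEmptyRingEquiv K (Fin 0)).symm
  | succ d ih =>
    exact ih.polynomial.of_ringEquiv (MvPolynomial.finSuccEquiv K d).symm.toRingEquiv

theorem Ideal.height_le_height_under_of_isIntegral {A B : Type*} [CommRing A] [CommRing B]
    [Algebra A B] [Algebra.IsIntegral A B] (P : Ideal B) [P.IsPrime] :
    P.height ≤ (P.under A).height := by
  have hs : StrictMono (PrimeSpectrum.comap (algebraMap A B)) := by
    intro I J hIJ
    exact Ideal.IsIntegral.comap_lt_comap hIJ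
  have := Order.height_le_height_apply_of_strictMono _ hs ⟨P, inferInstance⟩
  rwa [← PrimeSpectrum.height_eq_orderHeight, ← PrimeSpectrum.height_eq_orderHeight] at this

theorem LocallyMaxDepth.of_flat_of_isIntegral {A B : Type*} [CommRing A] [CommRing B]
    [Algebra A B] [Algebra.IsIntegral A B] [Module.Flat A B]
    (h : LocallyMaxDepth A) : LocallyMaxDepth B := by
  intro P hP
  have hA := h (P.under A)
  have hfl : (algebraMap A B).Flat := RingHom.flat_algebraMap_iff.2 inferInstance
  have := hfl.localRingHom P (P.under A) rfl
  algebraize [Localization.localRingHom (P.under A) P (algebraMap A B) rfl]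
  have : IsLocalHom (algebraMap (Localization.AtPrime (P.under A)) (Localization.AtPrime P)) :=
    inferInstanceAs (IsLocalHom (Localization.localRingHom (P.under A) P (algebraMap A B) rfl))
  refine hA.of_flat ?_
  rw [IsLocalization.AtPrime.ringKrullDim_eq_height P,
    IsLocalization.AtPrime.ringKrullDim_eq_height (P.under A)]
  exact WithBot.coe_le_coe.2 (Ideal.height_le_height_under_of_isIntegral P)

theorem HasMaxDepth.isLUB_length_isRegular {R : Type*} [CommRing R]
    [IsLocalRing R] [IsNoetherianRing R] (h : HasMaxDepth R) :
    IsLUB {k : WithBot (WithTop ℕ) | ∃ rs : List R, k = (rs.length : ℕ) ∧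
      (∀ x ∈ rs, x ∈ maximalIdeal R) ∧ IsRegular R rs} (ringKrullDim R) := by
  have hle : ∀ rs : List R, IsRegular R rs →
      (rs.length : WithBot (WithTop ℕ)) ≤ ringKrullDim R := by
    intro rs hrs
    rw [← ringKrullDim_add_length_eq_ringKrullDim_of_isRegular rs hrs]
    have : Nontrivial (R ⧸ Ideal.ofList rs) := by
      refine Ideal.Quotient.nontrivial_iff.2 fun h => hrs.top_ne_smul ?_
      rw [h]; simp
    exact le_add_of_nonneg_left ringKrullDim_nonneg_of_nontrivial
  constructor
  · rintro k ⟨rs, rfl, -, hrs⟩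
    exact hle rs hrs
  · intro k hk
    obtain ⟨rs, h1, h2, h3⟩ := h
    exact h3.trans (hk ⟨rs, rfl, h1, IsRegular.of_isWeaklyRegular_of_mem_maximalIdeal _ h1 h2⟩)

end MaxDepth

section Unitriangular

variable {K M ι : Type*} [Field K] [AddCommGroup M] [Module K M]

theorem span_range_eq_top_of_unitriangular {u v : ι → M} (κ : ι → ℕ)
    (hu : Submodule.span K (Set.range u) = ⊤)
    (h : ∀ i, v i - u i ∈ Submodule.span K (u '' {j | κ j < κ i})) :
    Submodule.span K (Set.range v) = ⊤ := by
  rw [eq_top_iff, ← hu, Submodule.span_le]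
  rintro _ ⟨i, rfl⟩
  induction hn : κ i using Nat.strong_induction_on generalizing i with
  | _ n ih =>
    have h1 : Submodule.span K (u '' {j | κ j < κ i}) ≤ Submodule.span K (Set.range v) := by
      rw [Submodule.span_le]
      rintro _ ⟨j, hj, rfl⟩
      exact ih (κ j) (hn ▸ hj) j rfl
    have h2 := Submodule.sub_mem _ (Submodule.subset_span (Set.mem_range_self i)) (h1 (h i))
    simpa using h2

theorem linearIndependent_of_unitriangular {u v : ι → M} (κ : ι → ℕ)
    (hu : LinearIndependent K u)
    (h : ∀ i, v i - u i ∈ Submodule.span K (u '' {j | κ j < κ i})) :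
    LinearIndependent K v := by
  classical
  rw [linearIndependent_iff']
  intro s g hg
  by_contra! hne
  obtain ⟨i, hi, hgi⟩ := hne
  obtain ⟨i0, hi0, hmax⟩ := Finset.exists_max_image (s.filter fun i => g i ≠ 0) κ
    ⟨i, by simp [hi, hgi]⟩
  simp only [Finset.mem_filter] at hi0 hmax
  have hmem : u i0 ∈ Submodule.span K (u '' {i0}ᶜ) := by
    have key : ∀ j ∈ s, g j • v j - g j • (if j = i0 then u i0 else 0) ∈
        Submodule.span K (u '' {i0}ᶜ) := by
      intro j hj
      by_cases h0 : g j = 0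
      · simp [h0]
      rw [← smul_sub]
      apply Submodule.smul_mem
      have h1 : v j - u j ∈ Submodule.span K (u '' {i0}ᶜ) := by
        refine Submodule.span_mono (Set.image_mono ?_) (h j)
        intro l hl
        simp only [Set.mem_ofPred_eq, Set.mem_compl_iff, Set.mem_singleton_iff] at hl ⊢
        rintro rfl
        exact absurd (hmax j ⟨hj, h0⟩) (by omega)
      split_ifs with hji
      · rwa [hji] at h1 ⊢
      · have := Submodule.add_mem _ h1
          (Submodule.subset_span (Set.mem_image_of_mem u (show j ∈ ({i0}ᶜ : Set ι) from hji)))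
        simpa using this
    have hsum := Submodule.sum_mem _ key
    rw [Finset.sum_sub_distrib, hg, zero_sub, Submodule.neg_mem_iff] at hsum
    simp only [smul_ite, smul_zero, Finset.sum_ite_eq', hi0.1, if_true] at hsum
    exact (Submodule.smul_mem_iff _ hi0.2).1 hsum
  exact hu.notMem_span_image (s := {i0}ᶜ) (by simp) hmem

end Unitriangular

section MvBasis

open MvPolynomial

variable {K R σ W : Type*} [Field K] [CommRing R] [Algebra K R] [Fintype W]

/-- If the products of monomials in `θ` with finitely many elements form a `K`-basis of `R`,
then `R` is free over the polynomial ring. -/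
theorem free_finite_of_monomial_basis (θ : MvPolynomial σ K →ₐ[K] R) (r : W → R)
    (hli : LinearIndependent K fun x : W × (σ →₀ ℕ) => θ (monomial x.2 1) * r x.1)
    (hsp : Submodule.span K (Set.range fun x : W × (σ →₀ ℕ) => θ (monomial x.2 1) * r x.1) = ⊤) :
    letI := θ.toRingHom.toAlgebra
    Module.Free (MvPolynomial σ K) R ∧ Module.Finite (MvPolynomial σ K) R := by
  classical
  let := θ.toRingHom.toAlgebra
  have hsm : ∀ (p : MvPolynomial σ K) (x : R), p • x = θ p * x := fun p x => rfl
  have hli' : LinearIndependent (MvPolynomial σ K) r := by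
    rw [Fintype.linearIndependent_iff]
    intro g hg w
    rw [linearIndependent_iff'] at hli
    ext c
    rw [coeff_zero]
    by_cases hc : c ∈ (g w).support
    swap
    · simpa using hc
    refine hli (Finset.univ ×ˢ (Finset.univ.biUnion fun w => (g w).support))
      (fun x => coeff x.2 (g x.1)) ?_ (w, c) (by
        simp only [Finset.mem_product, Finset.mem_univ, true_and, Finset.mem_biUnion]
        exact ⟨w, hc⟩)
    rw [Finset.sum_product, ← hg]
    refine Finset.sum_congr rfl fun w' _ => ?_
    rw [hsm]
    conv_rhs => rw [(g w').as_sum]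
    rw [map_sum, Finset.sum_mul]
    symm
    refine (Finset.sum_subset (Finset.subset_biUnion_of_mem (fun w => (g w).support)
      (Finset.mem_univ w')) ?_).trans ?_
    · intro c _ hc
      rw [notMem_support_iff.1 hc]; simp
    · refine Finset.sum_congr rfl fun c _ => ?_
      have : monomial c (coeff c (g w')) = coeff c (g w') • (monomial c 1 : MvPolynomial σ K) := by
        rw [smul_monomial, smul_eq_mul, mul_one]
      rw [this, map_smul, smul_mul_assoc]
  have hsp' : ⊤ ≤ Submodule.span (MvPolynomial σ K) (Set.range r) := by
    intro x _
    have hx : x ∈ Submodule.span K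
        (Set.range fun x : W × (σ →₀ ℕ) => θ (monomial x.2 1) * r x.1) := hsp ▸ trivial
    induction hx using Submodule.span_induction with
    | mem x h =>
      obtain ⟨y, rfl⟩ := h
      exact Submodule.smul_mem _ (monomial y.2 1) (Submodule.subset_span ⟨y.1, rfl⟩)
    | zero => exact Submodule.zero_mem _
    | add x y _ _ hx hy => exact Submodule.add_mem _ (hx trivial) (hy trivial)
    | smul a x _ hx =>
      have := Submodule.smul_mem _ (C a : MvPolynomial σ K) (hx trivial)
      rw [hsm, ← algebraMap_eq, AlgHom.commutes, ← Algebra.smul_def] at this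
      exact this
  let B := Module.Basis.mk hli' hsp'
  exact ⟨Module.Free.of_basis B, Module.Finite.of_basis B⟩

end MvBasis

section PPartition

/-- Monotonicity along the relation `E`. -/
def MonoOn {P : Type*} (E : P → P → Prop) (f : P → ℤ) : Prop := ∀ p q, E p q → f p ≤ f q

/-- The total variation of `f` over all pairs. -/
def pairVar {P : Type*} [Fintype P] (f : P → ℤ) : ℤ := ∑ p, ∑ q, |f p - f q|

/-- The integer-valued indicator function of a finite set. -/
def indic {P : Type*} [DecidableEq P] (H : Finset P) (p : P) : ℤ := if p ∈ H then 1 else 0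

theorem pairVar_nonneg {P : Type*} [Fintype P] (f : P → ℤ) : 0 ≤ pairVar f :=
  Finset.sum_nonneg fun _ _ => Finset.sum_nonneg fun _ _ => abs_nonneg _

theorem pairVar_indic {P : Type*} [Fintype P] [DecidableEq P] (H : Finset P) :
    pairVar (indic H) = 2 * H.card * (Fintype.card P - H.card) := by
  have h1 : ∀ p q, |indic H p - indic H q| =
      indic H p + indic H q - 2 * (indic H p * indic H q) := by
    intro p q
    unfold indic
    split_ifs <;> simp
  have h2 : ∑ p, indic H p = H.card := by
    simp [indic]
  simp only [pairVar, h1, Finset.sum_sub_distrib, Finset.sum_add_distrib, ← Finset.mul_sum, h2,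
    Finset.sum_const, ← Finset.sum_mul, Finset.card_univ, nsmul_eq_mul]
  ring

variable {d : ℕ}

/-- Scaled and perturbed values of `f`; ties are broken by the index. -/
def tieBreak (f : Fin (d + 1) → ℤ) (p : Fin (d + 1)) : ℤ := (2 * (d + 1) ^ 3 + 1) * f p + p.val

/-- The filtration key of `f`. -/
def ppKey (f : Fin (d + 1) → ℤ) : ℤ := pairVar (tieBreak f)

theorem abs_ppKey_sub_le (f : Fin (d + 1) → ℤ) :
    |ppKey f - (2 * (d + 1) ^ 3 + 1) * pairVar f| ≤ ((d : ℤ) + 1) ^ 3 := by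
  have hL : (0 : ℤ) < 2 * (d + 1) ^ 3 + 1 := by positivity
  unfold ppKey pairVar
  rw [Finset.mul_sum, ← Finset.sum_sub_distrib]
  simp only [Finset.mul_sum, ← Finset.sum_sub_distrib]
  have key : ∀ p q : Fin (d + 1), |(|tieBreak f p - tieBreak f q| -
      (2 * (d + 1) ^ 3 + 1) * |f p - f q|)| ≤ (d + 1 : ℤ) := by
    intro p q
    have e : tieBreak f p - tieBreak f q =
        (2 * (d + 1) ^ 3 + 1) * (f p - f q) + ((p.val : ℤ) - q.val) := by unfold tieBreak; ring
    have e2 : (2 * ((d : ℤ) + 1) ^ 3 + 1) * |f p - f q| =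
        |(2 * (d + 1) ^ 3 + 1) * (f p - f q)| := by
      rw [abs_mul, abs_of_pos hL]
    rw [e, e2]
    refine (abs_abs_sub_abs_le _ _).trans ?_
    rw [add_sub_cancel_left, abs_le]
    have := p.isLt; have := q.isLt
    constructor <;> omega
  calc _ ≤ ∑ p : Fin (d + 1), ∑ q : Fin (d + 1), (d + 1 : ℤ) := by
        refine (Finset.abs_sum_le_sum_abs _ _).trans (Finset.sum_le_sum fun p _ => ?_)
        exact (Finset.abs_sum_le_sum_abs _ _).trans (Finset.sum_le_sum fun q _ => key p q)
    _ = _ := by simp; ring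

theorem ppKey_lt_of_pairVar_lt {f g : Fin (d + 1) → ℤ} (h : pairVar f < pairVar g) :
    ppKey f < ppKey g := by
  have h1 := abs_le.1 (abs_ppKey_sub_le f)
  have h2 := abs_le.1 (abs_ppKey_sub_le g)
  have hL : (0 : ℤ) < 2 * (d + 1) ^ 3 + 1 := by positivity
  nlinarith

theorem tieBreak_add_indic (f : Fin (d + 1) → ℤ) (H : Finset (Fin (d + 1))) (p : Fin (d + 1)) :
    tieBreak (f + indic H) p = tieBreak f p + (2 * (d + 1) ^ 3 + 1) * indic H p := by
  simp [tieBreak]; ring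

/-- The increase of the key under adding the indicator of a set of the given cardinality. -/
def keyStep (d i : ℕ) : ℤ := (2 * (d + 1) ^ 3 + 1) * (2 * i * ((d + 1 : ℕ) - i))

theorem ppKey_add_indic_le (f : Fin (d + 1) → ℤ) (H : Finset (Fin (d + 1))) :
    ppKey (f + indic H) ≤ ppKey f + keyStep d H.card := by
  have hL : (0 : ℤ) < 2 * (d + 1) ^ 3 + 1 := by positivity
  have := pairVar_indic H
  rw [Fintype.card_fin] at this
  rw [keyStep, ← this]
  simp only [ppKey, pairVar, Finset.mul_sum, ← Finset.sum_add_distrib, tieBreak_add_indic]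
  refine Finset.sum_le_sum fun p _ => Finset.sum_le_sum fun q _ => ?_
  rw [← abs_of_pos hL, ← abs_mul, abs_of_pos hL]
  refine le_trans (le_of_eq ?_) (abs_add_le _ _)
  congr 1; ring

theorem ppKey_add_indic_lt {f : Fin (d + 1) → ℤ} {H : Finset (Fin (d + 1))} {p q : Fin (d + 1)}
    (hp : p ∈ H) (hq : q ∉ H) (h : tieBreak f p < tieBreak f q) :
    ppKey (f + indic H) < ppKey f + keyStep d H.card := by
  have hL : (0 : ℤ) < 2 * (d + 1) ^ 3 + 1 := by positivity
  have := pairVar_indic H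
  rw [Fintype.card_fin] at this
  rw [keyStep, ← this]
  simp only [ppKey, pairVar, Finset.mul_sum, ← Finset.sum_add_distrib, tieBreak_add_indic]
  have key : ∀ p q : Fin (d + 1), |tieBreak f p + (2 * (d + 1) ^ 3 + 1) * indic H p -
      (tieBreak f q + (2 * (d + 1) ^ 3 + 1) * indic H q)| ≤
      |tieBreak f p - tieBreak f q| + (2 * (d + 1) ^ 3 + 1) * |indic H p - indic H q| := by
    intro p q
    rw [← abs_of_pos hL, ← abs_mul, abs_of_pos hL]
    refine le_trans (le_of_eq ?_) (abs_add_le _ _)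
    congr 1; ring
  refine Finset.sum_lt_sum (fun p _ => Finset.sum_le_sum fun q _ => key p q)
    ⟨p, Finset.mem_univ _, Finset.sum_lt_sum (fun q _ => key p q) ⟨q, Finset.mem_univ _, ?_⟩⟩
  have e1 : indic H p = 1 := by simp [indic, hp]
  have e2 : indic H q = 0 := by simp [indic, hq]
  rw [e1, e2, abs_of_neg (show tieBreak f p - tieBreak f q < 0 by omega)]
  simp only [mul_one, mul_zero, add_zero, sub_zero, abs_one]
  rw [abs_lt]
  constructor <;> linarith

theorem ppKey_add_indic_eq {f : Fin (d + 1) → ℤ} {H : Finset (Fin (d + 1))}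
    (h : ∀ p ∈ H, ∀ q ∉ H, tieBreak f q ≤ tieBreak f p) :
    ppKey (f + indic H) = ppKey f + keyStep d H.card := by
  have hL : (0 : ℤ) < 2 * (d + 1) ^ 3 + 1 := by positivity
  have := pairVar_indic H
  rw [Fintype.card_fin] at this
  rw [keyStep, ← this]
  simp only [ppKey, pairVar, Finset.mul_sum, ← Finset.sum_add_distrib, tieBreak_add_indic]
  refine Finset.sum_congr rfl fun p _ => Finset.sum_congr rfl fun q _ => ?_
  unfold indic
  by_cases hp : p ∈ H <;> by_cases hq : q ∈ H
  · simp [hp, hq]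
  · have := h p hp q hq
    simp only [hp, hq, if_true, if_false, sub_zero, abs_one, mul_one, mul_zero, add_zero]
    rw [abs_of_nonneg (by linarith), abs_of_nonneg (by linarith)]
    ring
  · have := h q hq p hp
    simp only [hp, hq, if_true, if_false, zero_sub, abs_neg, abs_one, mul_one, mul_zero, add_zero]
    rw [abs_of_nonpos (by linarith), abs_of_nonpos (by linarith)]
    ring
  · simp [hp, hq]

/-- The set of the largest values `w j`, `j > i`. -/
def topSet (w : Equiv.Perm (Fin (d + 1))) (i : Fin d) : Finset (Fin (d + 1)) :=
  Finset.univ.filter fun p => i.castSucc < w.symm p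

theorem card_topSet (w : Equiv.Perm (Fin (d + 1))) (i : Fin d) : (topSet w i).card = d - i := by
  have : topSet w i = (Finset.Ioi i.castSucc).map w.toEmbedding := by
    ext p
    simp [topSet, Finset.mem_map_equiv]
  rw [this, Finset.card_map, Fin.card_Ioi]
  simp

/-- The integer function with sorting permutation `w` and prescribed consecutive differences. -/
def sortedFun (w : Equiv.Perm (Fin (d + 1))) (c : Fin d →₀ ℕ) (p : Fin (d + 1)) : ℤ :=
  ∑ i : Fin d, if i.castSucc < w.symm p then (c i : ℤ) + if w i.succ < w i.castSucc then 1 else 0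
    else 0

theorem sortedFun_add_single (w : Equiv.Perm (Fin (d + 1))) (c : Fin d →₀ ℕ) (i : Fin d) :
    sortedFun w (c + Finsupp.single i 1) = sortedFun w c + indic (topSet w i) := by
  ext p
  simp only [sortedFun, Pi.add_apply, indic, topSet, Finset.mem_filter, Finset.mem_univ, true_and,
    Finsupp.add_apply, Finsupp.single_apply]
  have : (if i.castSucc < w.symm p then (1 : ℤ) else 0) =
      ∑ x : Fin d, if i = x then (if x.castSucc < w.symm p then (1 : ℤ) else 0) else 0 := by simp
  rw [this, ← Finset.sum_add_distrib]
  refine Finset.sum_congr rfl fun x _ => ?_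
  split_ifs <;> push_cast <;> ring

theorem sortedFun_succ (w : Equiv.Perm (Fin (d + 1))) (c : Fin d →₀ ℕ) (i : Fin d) :
    sortedFun w c (w i.succ) = sortedFun w c (w i.castSucc) +
      (c i + if w i.succ < w i.castSucc then 1 else 0) := by
  simp only [sortedFun, Equiv.symm_apply_apply, Fin.castSucc_lt_succ_iff,
    Fin.castSucc_lt_castSucc_iff]
  have : ((c i : ℤ) + if w i.succ < w i.castSucc then 1 else 0) =
      ∑ x : Fin d, if i = x then ((c x : ℤ) + if w x.succ < w x.castSucc then 1 else 0) else 0 := by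
    simp
  rw [this, ← Finset.sum_add_distrib]
  refine Finset.sum_congr rfl fun x _ => ?_
  rcases lt_trichotomy x i with h | rfl | h
  · simp [h, h.le, h.ne']
  · simp
  · simp [h.not_ge, h.ne, h.not_gt]

theorem sortedFun_zero (w : Equiv.Perm (Fin (d + 1))) (c : Fin d →₀ ℕ) :
    sortedFun w c (w 0) = 0 := by
  simp [sortedFun]

theorem strictMono_tieBreak_sortedFun (w : Equiv.Perm (Fin (d + 1))) (c : Fin d →₀ ℕ) :
    StrictMono (tieBreak (sortedFun w c) ∘ w) := by
  rw [Fin.strictMono_iff_lt_succ]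
  intro i
  simp only [Function.comp, tieBreak, sortedFun_succ]
  have h1 := (w i.succ).isLt
  have h2 := (w i.castSucc).isLt
  have hd : (d : ℤ) + 1 ≤ (d + 1) ^ 3 := by nlinarith [sq_nonneg (d : ℤ), Int.natCast_nonneg d]
  split_ifs with h
  · nlinarith [Int.natCast_nonneg (c i)]
  · have : w i.castSucc < w i.succ := lt_of_le_of_ne (not_lt.1 h) (by simp [Fin.ext_iff])
    have : (w i.castSucc).val < (w i.succ).val := this
    have : 0 ≤ (2 * ((d : ℤ) + 1) ^ 3 + 1) * c i := by positivity
    linarith [show ((w i.castSucc).val : ℤ) < (w i.succ).val by exact_mod_cast ‹_›]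

theorem tieBreak_injective (f : Fin (d + 1) → ℤ) : Function.Injective (tieBreak f) := by
  intro p q h
  have h1 := p.isLt
  have h2 := q.isLt
  have hd : (d : ℤ) + 1 ≤ (d + 1) ^ 3 := by nlinarith [sq_nonneg (d : ℤ), Int.natCast_nonneg d]
  simp only [tieBreak] at h
  have : f p = f q := by
    rcases lt_trichotomy (f p) (f q) with h' | h' | h'
    · nlinarith
    · exact h'
    · nlinarith
  rw [this] at h
  ext
  omega

theorem exists_strictMono_tieBreak (f : Fin (d + 1) → ℤ) :
    ∃ w : Equiv.Perm (Fin (d + 1)), StrictMono (tieBreak f ∘ w) :=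
  ⟨Tuple.sort (tieBreak f), (Tuple.monotone_sort _).strictMono_of_injective
    ((tieBreak_injective f).comp (Equiv.injective _))⟩

theorem perm_eq_of_strictMono {g : Fin (d + 1) → ℤ} (hg : Function.Injective g)
    {w w' : Equiv.Perm (Fin (d + 1))} (h : StrictMono (g ∘ w)) (h' : StrictMono (g ∘ w')) :
    w = w' := by
  have : g ∘ w = g ∘ w' := by
    rw [← h.range_inj h']
    simp [Set.range_comp]
  ext i
  exact congrArg _ (hg (congrFun this i))

variable {E : Fin (d + 1) → Fin (d + 1) → Prop}

theorem MonoOn.tieBreak_lt (hE : ∀ p q, E p q → p < q) {f : Fin (d + 1) → ℤ} (hf : MonoOn E f)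
    {p q : Fin (d + 1)} (h : E p q) : tieBreak f p < tieBreak f q := by
  have h1 := hf p q h
  have h2 : p.val < q.val := hE p q h
  have : (0 : ℤ) ≤ 2 * (d + 1) ^ 3 + 1 := by positivity
  have := mul_le_mul_of_nonneg_left h1 this
  unfold tieBreak
  omega

theorem MonoOn.symm_lt (hE : ∀ p q, E p q → p < q) {f : Fin (d + 1) → ℤ} (hf : MonoOn E f)
    {w : Equiv.Perm (Fin (d + 1))} (hw : StrictMono (tieBreak f ∘ w))
    {p q : Fin (d + 1)} (h : E p q) : w.symm p < w.symm q := by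
  rw [← hw.lt_iff_lt]
  simpa using hf.tieBreak_lt hE h

theorem MonoOn.add {P : Type*} {E : P → P → Prop} {f g : P → ℤ} (hf : MonoOn E f)
    (hg : MonoOn E g) : MonoOn E (f + g) := fun p q h => add_le_add (hf p q h) (hg p q h)

theorem monoOn_sortedFun {w : Equiv.Perm (Fin (d + 1))}
    (hw : ∀ p q, E p q → w.symm p < w.symm q) (c : Fin d →₀ ℕ) : MonoOn E (sortedFun w c) := by
  intro p q h
  refine Finset.sum_le_sum fun i _ => ?_
  by_cases h1 : i.castSucc < w.symm p
  · rw [if_pos h1, if_pos (h1.trans (hw p q h))]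
  · rw [if_neg h1]
    split_ifs <;> positivity

theorem monoOn_indic_topSet {w : Equiv.Perm (Fin (d + 1))}
    (hw : ∀ p q, E p q → w.symm p < w.symm q) (i : Fin d) : MonoOn E (indic (topSet w i)) := by
  intro p q h
  have := hw p q h
  simp only [indic, topSet, Finset.mem_filter, Finset.mem_univ, true_and]
  split_ifs with h1 h2
  · exact le_rfl
  · exact absurd (h1.trans this) h2
  · exact zero_le_one
  · exact le_rfl

theorem exists_eq_sortedFun (f : Fin (d + 1) → ℤ) {w : Equiv.Perm (Fin (d + 1))}
    (hw : StrictMono (tieBreak f ∘ w)) :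
    ∃ c : Fin d →₀ ℕ, ∀ p, f p = sortedFun w c p + f (w 0) := by
  have hd : (d : ℤ) + 1 ≤ (d + 1) ^ 3 := by nlinarith [sq_nonneg (d : ℤ), Int.natCast_nonneg d]
  have key : ∀ i : Fin d, f (w i.castSucc) + (if w i.succ < w i.castSucc then 1 else 0) ≤
      f (w i.succ) := by
    intro i
    have h := hw (show i.castSucc < i.succ from Fin.castSucc_lt_succ)
    have h1 := (w i.succ).isLt
    have h2 := (w i.castSucc).isLt
    simp only [Function.comp, tieBreak] at h
    split_ifs with hlt
    · have hlt' : (w i.succ).val < (w i.castSucc).val := hlt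
      by_contra! hcon
      have : f (w i.succ) ≤ f (w i.castSucc) := by omega
      nlinarith
    · by_contra! hcon
      have : f (w i.succ) + 1 ≤ f (w i.castSucc) := by omega
      nlinarith
  refine ⟨Finsupp.equivFunOnFinite.symm fun i => (f (w i.succ) - f (w i.castSucc) -
    (if w i.succ < w i.castSucc then 1 else 0)).toNat, fun p => ?_⟩
  obtain ⟨j, rfl⟩ := w.surjective p
  induction j using Fin.induction with
  | zero => simp [sortedFun_zero]
  | succ i ih =>
    rw [sortedFun_succ]
    simp only [Finsupp.equivFunOnFinite_symm_apply_apply]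
    rw [Int.toNat_of_nonneg (by have := key i; omega)]
    linarith

theorem tieBreak_add_const (f : Fin (d + 1) → ℤ) (a : ℤ) (p : Fin (d + 1)) :
    tieBreak (fun p => f p + a) p = tieBreak f p + (2 * (d + 1) ^ 3 + 1) * a := by
  simp [tieBreak]; ring

theorem sortedFun_injective {w w' : Equiv.Perm (Fin (d + 1))} {c c' : Fin d →₀ ℕ} {a : ℤ}
    (h : sortedFun w c = fun p => sortedFun w' c' p + a) : w = w' ∧ c = c' := by
  have hw : w = w' := by
    refine perm_eq_of_strictMono (tieBreak_injective _) (strictMono_tieBreak_sortedFun w c) ?_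
    rw [h]
    intro i j hij
    have := strictMono_tieBreak_sortedFun w' c' hij
    simp only [Function.comp, tieBreak_add_const] at this ⊢
    linarith
  subst hw
  refine ⟨rfl, ?_⟩
  ext i
  have h1 := sortedFun_succ w c i
  have h2 := sortedFun_succ w c' i
  have h3 : _ = _ + a := congrFun h (w i.succ)
  have h4 : _ = _ + a := congrFun h (w i.castSucc)
  omega

theorem exists_tieBreak_lt_of_ne_topSet {f : Fin (d + 1) → ℤ} {w : Equiv.Perm (Fin (d + 1))}
    (hw : StrictMono (tieBreak f ∘ w)) {i : Fin d} {H : Finset (Fin (d + 1))}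
    (hc : H.card = d - i) (hne : H ≠ topSet w i) :
    ∃ p ∈ H, ∃ q ∉ H, tieBreak f p < tieBreak f q := by
  by_contra! hcon
  apply hne
  by_cases hs : H ⊆ topSet w i
  · exact Finset.eq_of_subset_of_card_le hs (by rw [hc, card_topSet])
  · symm
    refine Finset.eq_of_subset_of_card_le ?_ (by rw [hc, card_topSet])
    obtain ⟨p, hp, hpT⟩ := Finset.not_subset.1 hs
    intro t ht
    by_contra htH
    have h1 := hcon p hp t htH
    have h2 : w.symm t ≤ w.symm p := by
      rw [← hw.le_iff_le]; simpa using h1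
    simp only [topSet, Finset.mem_filter, Finset.mem_univ, true_and] at ht hpT
    exact hpT (lt_of_lt_of_le ht h2)

section Main

open MvPolynomial

variable {K R : Type*} [Field K] [CommRing R] [Algebra K R]

/-- The span of the basis elements of key less than `k`. -/
def keySpan (K : Type*) [Field K] {R : Type*} [CommRing R] [Algebra K R]
    (E : Fin (d + 1) → Fin (d + 1) → Prop) (b : (Fin (d + 1) → ℤ) → R) (k : ℤ) : Submodule K R :=
  Submodule.span K (b '' {f | MonoOn E f ∧ ppKey f < k})

open Classical in
/-- The sum of all indicator elements of sets of fixed cardinality. -/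
noncomputable def levelSum (E : Fin (d + 1) → Fin (d + 1) → Prop) (b : (Fin (d + 1) → ℤ) → R)
    (i : Fin d) : R :=
  ∑ H : Finset (Fin (d + 1)) with MonoOn E (indic H) ∧ H.card = d - i, b (indic H)

theorem keySpan_mono (b : (Fin (d + 1) → ℤ) → R) {k k' : ℤ} (h : k ≤ k') :
    keySpan K E b k ≤ keySpan K E b k' :=
  Submodule.span_mono (Set.image_mono fun _ hf => ⟨hf.1, hf.2.trans_le h⟩)

theorem mem_keySpan (b : (Fin (d + 1) → ℤ) → R) {k : ℤ} {f : Fin (d + 1) → ℤ} (h : MonoOn E f)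
    (hk : ppKey f < k) : b f ∈ keySpan K E b k :=
  Submodule.subset_span ⟨f, ⟨h, hk⟩, rfl⟩

variable (hE : ∀ p q, E p q → p < q) {b : (Fin (d + 1) → ℤ) → R}
  (hmul : ∀ H f, MonoOn E (indic H) → MonoOn E f → b (indic H) * b f - b (f + indic H) ∈
    Submodule.span K (b '' {f' | MonoOn E f' ∧ pairVar f' < pairVar (f + indic H)}))

include hE hmul in
theorem levelSum_mul_sub_mem {f : Fin (d + 1) → ℤ} (hf : MonoOn E f)
    {w : Equiv.Perm (Fin (d + 1))} (hw : StrictMono (tieBreak f ∘ w)) (i : Fin d) :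
    levelSum E b i * b f - b (f + indic (topSet w i)) ∈
      keySpan K E b (ppKey f + keyStep d (d - i)) := by
  classical
  have hmul' : ∀ H f, MonoOn E (indic H) → MonoOn E f → b (indic H) * b f - b (f + indic H) ∈
      keySpan K E b (ppKey f + keyStep d H.card) := by
    intro H f hH hf
    refine Submodule.span_mono (Set.image_mono ?_) (hmul H f hH hf)
    rintro g ⟨hg, hlt⟩
    exact ⟨hg, (ppKey_lt_of_pairVar_lt hlt).trans_le (ppKey_add_indic_le f H)⟩
  have hT : MonoOn E (indic (topSet w i)) :=
    monoOn_indic_topSet (fun p q h => hf.symm_lt hE hw h) i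
  rw [levelSum, ← Finset.add_sum_erase _ _ (a := topSet w i)
    (by simp [hT, card_topSet]), add_mul, add_sub_right_comm]
  refine Submodule.add_mem _ ?_ ?_
  · have := hmul' _ f hT hf
    rwa [card_topSet] at this
  · rw [Finset.sum_mul]
    refine Submodule.sum_mem _ fun H hH => ?_
    simp only [Finset.mem_erase, Finset.mem_filter, Finset.mem_univ, true_and] at hH
    obtain ⟨hne, hHm, hc⟩ := hH
    have h1 := hmul' H f hHm hf
    obtain ⟨p, hp, q, hq, hlt⟩ := exists_tieBreak_lt_of_ne_topSet hw hc hne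
    have h2 := mem_keySpan (K := K) b (hf.add hHm) (ppKey_add_indic_lt hp hq hlt)
    rw [← hc]
    simpa using Submodule.add_mem _ h1 h2

theorem ppKey_add_indic_topSet {f : Fin (d + 1) → ℤ}
    {w : Equiv.Perm (Fin (d + 1))} (hw : StrictMono (tieBreak f ∘ w)) (i : Fin d) :
    ppKey (f + indic (topSet w i)) = ppKey f + keyStep d (d - i) := by
  rw [ppKey_add_indic_eq, card_topSet]
  intro p hp q hq
  simp only [topSet, Finset.mem_filter, Finset.mem_univ, true_and] at hp hq
  have : w.symm q ≤ w.symm p := (not_lt.1 hq).trans hp.le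
  simpa using hw.monotone this

include hE hmul in
theorem levelSum_mul_mem_keySpan (i : Fin d) {k : ℤ} {x : R} (hx : x ∈ keySpan K E b k) :
    levelSum E b i * x ∈ keySpan K E b (k + keyStep d (d - i)) := by
  induction hx using Submodule.span_induction with
  | mem x h =>
    obtain ⟨f, ⟨hf, hk⟩, rfl⟩ := h
    obtain ⟨w, hw⟩ := exists_strictMono_tieBreak f
    have h1 := keySpan_mono (E := E) (K := K) b (show ppKey f + keyStep d (d - i) ≤
      k + keyStep d (d - i) by omega) (levelSum_mul_sub_mem hE hmul hf hw i)
    have hT : MonoOn E (indic (topSet w i)) :=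
      monoOn_indic_topSet (fun p q h => hf.symm_lt hE hw h) i
    have h2 := mem_keySpan (K := K) b (hf.add hT) (k := k + keyStep d (d - i))
      (by rw [ppKey_add_indic_topSet hw]; omega)
    simpa using Submodule.add_mem _ h1 h2
  | zero => simp
  | add x y _ _ hx hy => rw [mul_add]; exact Submodule.add_mem _ hx hy
  | smul a x _ hx => rw [mul_smul_comm]; exact Submodule.smul_mem _ _ hx

include hE hmul in
theorem monomial_mul_sub_mem {w : Equiv.Perm (Fin (d + 1))}
    (hw : ∀ p q, E p q → w.symm p < w.symm q) (c : Fin d →₀ ℕ) :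
    aeval (levelSum E b) (monomial c (1 : K)) * b (sortedFun w 0) - b (sortedFun w c) ∈
      keySpan K E b (ppKey (sortedFun w c)) := by
  induction hn : c.degree generalizing c with
  | zero =>
    rw [Finsupp.degree_eq_zero_iff] at hn
    simp [hn]
  | succ n ih =>
    obtain ⟨i, hi⟩ : ∃ i, c i ≠ 0 := by
      by_contra! h0
      rw [show c = 0 from Finsupp.ext h0] at hn
      simp at hn
    obtain ⟨c, rfl⟩ : ∃ c', c = c' + Finsupp.single i 1 :=
      ⟨c - Finsupp.single i 1,
        (tsub_add_cancel_of_le (by simpa using Nat.one_le_iff_ne_zero.2 hi)).symm⟩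
    have hdeg : c.degree = n := by simpa using hn
    have hst := strictMono_tieBreak_sortedFun w c
    have h1 := levelSum_mul_mem_keySpan hE hmul i (ih c hdeg)
    have h2 := levelSum_mul_sub_mem (K := K) hE hmul (monoOn_sortedFun hw c) hst i
    have h3 := Submodule.add_mem _ h1 h2
    rw [sortedFun_add_single, ppKey_add_indic_topSet hst]
    convert h3 using 1
    rw [show (monomial (c + Finsupp.single i 1) (1 : K)) = monomial c 1 * X i by
      rw [X, monomial_mul, one_mul], map_mul, aeval_X]
    ring

/-- A ring with a basis indexed by monotone integer functions modulo constants, with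
multiplication dominated by addition of functions, is finite free over a polynomial ring. -/
theorem exists_free_finite_of_monoOn_basis
    (hE : ∀ p q, E p q → p < q) {b : (Fin (d + 1) → ℤ) → R}
    (hb : ∀ f a, b (fun p => f p + a) = b f)
    (hspan : Submodule.span K (b '' {f | MonoOn E f}) = ⊤)
    (hli : ∀ (ι : Type) (s : ι → Fin (d + 1) → ℤ), (∀ i, MonoOn E (s i)) →
      (∀ i j a, (s i = fun p => s j p + a) → i = j) → LinearIndependent K fun i => b (s i))
    (hmul : ∀ H f, MonoOn E (indic H) → MonoOn E f → b (indic H) * b f - b (f + indic H) ∈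
      Submodule.span K (b '' {f' | MonoOn E f' ∧ pairVar f' < pairVar (f + indic H)})) :
    ∃ θ : MvPolynomial (Fin d) K →ₐ[K] R, letI := θ.toRingHom.toAlgebra
      Module.Free (MvPolynomial (Fin d) K) R ∧ Module.Finite (MvPolynomial (Fin d) K) R := by
  classical
  let W := {w : Equiv.Perm (Fin (d + 1)) // ∀ p q, E p q → w.symm p < w.symm q}
  let u : W × (Fin d →₀ ℕ) → R := fun x => b (sortedFun x.1.1 x.2)
  have hsurj : ∀ f, MonoOn E f → ∃ x : W × (Fin d →₀ ℕ),
      b f = u x ∧ ∃ a, f = fun p => sortedFun x.1.1 x.2 p + a := by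
    intro f hf
    obtain ⟨w, hw⟩ := exists_strictMono_tieBreak f
    obtain ⟨c, hc⟩ := exists_eq_sortedFun f hw
    refine ⟨(⟨w, fun p q h => hf.symm_lt hE hw h⟩, c), ?_, f (w 0), funext hc⟩
    exact (congrArg b (funext hc)).trans (hb _ _)
  let κ : W × (Fin d →₀ ℕ) → ℕ := fun x => (ppKey (sortedFun x.1.1 x.2)).toNat
  have key : ∀ x : W × (Fin d →₀ ℕ), aeval (levelSum E b) (monomial x.2 (1 : K)) *
      b (sortedFun x.1.1 0) - u x ∈ Submodule.span K (u '' {y | κ y < κ x}) := by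
    rintro ⟨w, c⟩
    refine Submodule.span_mono ?_ (monomial_mul_sub_mem hE hmul w.2 c)
    rintro _ ⟨f, ⟨hf, hk⟩, rfl⟩
    obtain ⟨y, hy, a, hya⟩ := hsurj f hf
    refine ⟨y, ?_, hy.symm⟩
    have : ppKey f = ppKey (sortedFun y.1.1 y.2) := by
      rw [hya]
      simp [ppKey, pairVar, tieBreak_add_const]
    rw [this] at hk
    have h0 : 0 ≤ ppKey (sortedFun y.1.1 y.2) := pairVar_nonneg _
    simp only [κ, Set.mem_ofPred_eq]
    omega
  refine ⟨aeval (levelSum E b), free_finite_of_monomial_basis (W := W) _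
    (fun w => b (sortedFun w.1 0)) ?_ ?_⟩
  · refine linearIndependent_of_unitriangular κ (u := u) ?_ key
    refine hli _ _ (fun x => monoOn_sortedFun x.1.2 x.2) ?_
    rintro ⟨w, c⟩ ⟨w', c'⟩ a h
    obtain ⟨h1, h2⟩ := sortedFun_injective h
    exact Prod.ext (Subtype.ext h1) h2
  · refine span_range_eq_top_of_unitriangular κ (u := u) ?_ key
    rw [eq_top_iff, ← hspan]
    refine Submodule.span_mono ?_
    rintro _ ⟨f, hf, rfl⟩
    obtain ⟨y, hy, -⟩ := hsurj f hf
    exact ⟨y, hy.symm⟩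

/-- Transport of `exists_free_finite_of_monoOn_basis` to a finite relation with a strictly
increasing height function. -/
theorem exists_free_finite_of_height {P : Type} [Fintype P] [Nonempty P] [DecidableEq P]
    {E : P → P → Prop} (ht : P → ℤ)
    (hE : ∀ p q, E p q → ht p < ht q) {b : (P → ℤ) → R}
    (hb : ∀ f a, b (fun p => f p + a) = b f)
    (hspan : Submodule.span K (b '' {f | MonoOn E f}) = ⊤)
    (hli : ∀ (ι : Type) (s : ι → P → ℤ), (∀ i, MonoOn E (s i)) →
      (∀ i j a, (s i = fun p => s j p + a) → i = j) → LinearIndependent K fun i => b (s i))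
    (hmul : ∀ H f, MonoOn E (indic H) → MonoOn E f → b (indic H) * b f - b (f + indic H) ∈
      Submodule.span K (b '' {f' | MonoOn E f' ∧ pairVar f' < pairVar (f + indic H)})) :
    ∃ (d : ℕ) (θ : MvPolynomial (Fin d) K →ₐ[K] R), letI := θ.toRingHom.toAlgebra
      Module.Free (MvPolynomial (Fin d) K) R ∧ Module.Finite (MvPolynomial (Fin d) K) R := by
  obtain ⟨d, hd⟩ : ∃ d, Fintype.card P = d + 1 := ⟨_, (Nat.succ_pred Fintype.card_ne_zero).symm⟩
  let e0 : P ≃ Fin (d + 1) := Fintype.equivFinOfCardEq hd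
  let e : Fin (d + 1) ≃ P := (Tuple.sort (ht ∘ e0.symm)).trans e0.symm
  have he : Monotone (ht ∘ e) := Tuple.monotone_sort (ht ∘ e0.symm)
  have hMono : ∀ f : Fin (d + 1) → ℤ, MonoOn (fun p q => E (e p) (e q)) f ↔
      MonoOn E (f ∘ e.symm) := by
    intro f
    constructor
    · intro h p q hpq
      exact h _ _ (by simpa using hpq)
    · intro h p q hpq
      simpa using h _ _ hpq
  have hvar : ∀ f : Fin (d + 1) → ℤ, pairVar (f ∘ e.symm) = pairVar f := by
    intro f
    simp only [pairVar, Function.comp]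
    rw [← e.sum_comp]
    refine Finset.sum_congr rfl fun p _ => ?_
    rw [← e.sum_comp]
    simp
  have hind : ∀ H : Finset (Fin (d + 1)), indic H ∘ e.symm = indic (H.map e.toEmbedding) := by
    intro H
    ext p
    simp [indic, Finset.mem_map_equiv]
  have himg : ∀ S : (P → ℤ) → Prop, (fun f : Fin (d + 1) → ℤ => b (f ∘ e.symm)) ''
      {f | S (f ∘ e.symm)} = b '' {f | S f} := by
    intro S
    ext x
    constructor
    · rintro ⟨f, hf, rfl⟩
      exact ⟨_, hf, rfl⟩
    · rintro ⟨f, hf, rfl⟩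
      have : (f ∘ e) ∘ e.symm = f := by ext; simp
      exact ⟨f ∘ e, by simpa only [Set.mem_ofPred_eq, this] using hf, by simp only [this]⟩
  refine ⟨d, exists_free_finite_of_monoOn_basis (E := fun p q => E (e p) (e q))
    (b := fun f => b (f ∘ e.symm)) ?_ ?_ ?_ ?_ ?_⟩
  · intro p q hpq
    by_contra! h
    exact absurd (hE _ _ hpq) (not_lt.2 (he h))
  · exact fun f a => hb (f ∘ e.symm) a
  · simp only [hMono]
    rw [himg (MonoOn E), hspan]
  · intro ι s hs hinj
    refine hli ι (fun i => s i ∘ e.symm) (fun i => (hMono _).1 (hs i)) fun i j a h => ?_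
    refine hinj i j a (funext fun p => ?_)
    simpa using congrFun h (e p)
  · intro H f hH hf
    have := hmul (H.map e.toEmbedding) (f ∘ e.symm) (by rw [← hind]; exact (hMono _).1 hH)
      ((hMono _).1 hf)
    simp only [hMono, ← hvar]
    rw [himg fun f' => MonoOn E f' ∧ pairVar f' < pairVar ((f + indic H) ∘ e.symm)]
    rw [hind, Pi.add_comp, hind]
    exact this

end Main

end PPartition

section Ballot

open Polynomial

variable (K : Type*) [Field K]

/-- The substitution translating all variables by a common new variable. -/
noncomputable def translateVars (k : ℕ) :
    MvPolynomial (Fin k) K →ₐ[K] (MvPolynomial (Fin k) K)[X] :=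
  MvPolynomial.aeval fun b => C (MvPolynomial.X b) + X

variable {K}

theorem eval_zero_translateVars {k : ℕ} (E : MvPolynomial (Fin k) K) :
    (translateVars K k E).eval 0 = E := by
  have : ((Polynomial.aeval (R := MvPolynomial (Fin k) K) 0).restrictScalars K).comp
      (translateVars K k) = AlgHom.id K _ := by
    ext i; simp [translateVars]
  exact congr($this E)

theorem translateVars_ne_zero {k : ℕ} {E : MvPolynomial (Fin k) K} (h : E ≠ 0) :
    translateVars K k E ≠ 0 := fun h0 => h (by simpa [h0] using (eval_zero_translateVars E).symm)

/-- `translateVars` in one more variable, seen through `MvPolynomial.finSuccEquiv`. -/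
noncomputable def translateVarsSucc (k : ℕ) :
    (MvPolynomial (Fin k) K)[X] →+* (MvPolynomial (Fin k) K)[X][X] :=
  eval₂RingHom (R := MvPolynomial (Fin k) K) (S := (MvPolynomial (Fin k) K)[X][X])
    ((mapRingHom (C : MvPolynomial (Fin k) K →+* (MvPolynomial (Fin k) K)[X])).comp
      (translateVars K k).toRingHom) (X + C X)

theorem map_translateVars_succ {k : ℕ} (E : MvPolynomial (Fin (k + 1)) K) :
    (translateVars K (k + 1) E).map (MvPolynomial.finSuccEquiv K k :
        MvPolynomial (Fin (k + 1)) K →+* (MvPolynomial (Fin k) K)[X]) =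
      translateVarsSucc k (MvPolynomial.finSuccEquiv K k E) := by
  have : (mapRingHom (MvPolynomial.finSuccEquiv K k :
      MvPolynomial (Fin (k + 1)) K →+* (MvPolynomial (Fin k) K)[X])).comp
      (translateVars K (k + 1)).toRingHom =
      (translateVarsSucc k).comp (MvPolynomial.finSuccEquiv K k :
        MvPolynomial (Fin (k + 1)) K →+* (MvPolynomial (Fin k) K)[X]) := by
    apply MvPolynomial.ringHom_ext
    · intro r
      simp only [RingHom.comp_apply, AlgHom.toRingHom_eq_coe, RingHom.coe_coe,
        ← MvPolynomial.algebraMap_eq, AlgHom.commutes, translateVarsSucc]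
      simp [Polynomial.algebraMap_apply, MvPolynomial.algebraMap_eq,
        MvPolynomial.finSuccEquiv_apply]
    · intro i
      refine Fin.cases ?_ (fun i => ?_) i
      · simp [translateVars, translateVarsSucc, MvPolynomial.finSuccEquiv_apply, add_comm]
      · simp [translateVars, translateVarsSucc, MvPolynomial.finSuccEquiv_apply]
  exact congr($this E)

theorem natDegree_coeff_translateVarsSucc_le {k r : ℕ} {F : (MvPolynomial (Fin k) K)[X]}
    (hF : F.natDegree ≤ r) (s : ℕ) : ((translateVarsSucc k F).coeff s).natDegree ≤ r := by
  rw [translateVarsSucc, coe_eval₂RingHom, eval₂_eq_sum_range, finsetSum_coeff]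
  refine natDegree_sum_le_of_forall_le _ _ fun i hi => ?_
  rw [coeff_mul]
  refine natDegree_sum_le_of_forall_le _ _ fun ⟨a, b⟩ _ => ?_
  simp only [RingHom.comp_apply, coe_mapRingHom, coeff_map]
  refine (natDegree_C_mul_le _ _).trans ?_
  rw [coeff_X_add_C_pow, ← C_eq_natCast]
  refine (natDegree_mul_C_le _ _).trans ((natDegree_X_pow_le _).trans ?_)
  simp only [Finset.mem_range] at hi
  omega

/-- The substitution `Y = -t`. -/
noncomputable def evalNeg (A : Type*) [CommRing A] : A[X][X] →+* A[X] :=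
  eval₂RingHom (eval₂RingHom C (-X)) X

theorem evalNeg_translateVarsSucc {k : ℕ} (F : (MvPolynomial (Fin k) K)[X]) :
    evalNeg _ (translateVarsSucc k F) = translateVars K k (F.coeff 0) := by
  have h : (evalNeg _).comp (translateVarsSucc (K := K) k) =
      (translateVars K k).toRingHom.comp constantCoeff := by
    apply Polynomial.ringHom_ext'
    · have : (evalNeg (MvPolynomial (Fin k) K)).comp
          (mapRingHom (C : MvPolynomial (Fin k) K →+* _)) = RingHom.id _ := by
        ext <;> simp [evalNeg]
      rw [RingHom.comp_assoc, translateVarsSucc, eval₂RingHom_comp_C, ← RingHom.comp_assoc, this,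
        RingHom.id_comp, RingHom.comp_assoc]
      ext <;> simp
    · simp [translateVarsSucc, evalNeg]
  exact congr($h F)

theorem natDegree_evalNeg_le {A : Type*} [CommRing A] {p r : ℕ} {G : A[X][X]}
    (hp : G.natDegree ≤ p) (hr : ∀ s, (G.coeff s).natDegree ≤ r) :
    (evalNeg A G).natDegree ≤ p + r := by
  rw [evalNeg, coe_eval₂RingHom, eval₂_eq_sum_range]
  refine natDegree_sum_le_of_forall_le _ _ fun s hs => ?_
  simp only [Finset.mem_range] at hs
  refine natDegree_mul_le.trans ?_
  have h1 : ((eval₂RingHom C (-X : A[X])) (G.coeff s)).natDegree ≤ r := by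
    rw [coe_eval₂RingHom, eval₂_eq_sum_range]
    refine natDegree_sum_le_of_forall_le _ _ fun i hi => ?_
    refine (natDegree_C_mul_le _ _).trans ?_
    rw [neg_pow, ← C_1, ← C_neg, ← C_pow]
    refine (natDegree_C_mul_le _ _).trans ((natDegree_X_pow_le _).trans ?_)
    simp only [Finset.mem_range] at hi
    have := hr s
    omega
  have h2 := natDegree_X_pow_le (R := A) s
  omega

theorem lexMin_partialSums_le {k : ℕ} {D : ℕ} {E : MvPolynomial (Fin k) K} (hE : E ≠ 0)
    (hD : (translateVars K k E).natDegree ≤ D) (d : Fin k → ℕ) (hd : ∀ b, E.degreeOf b ≤ d b)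
    {J : Fin k →₀ ℕ} (hJ : J ∈ E.support)
    (hmin : ∀ J' ∈ E.support, ∀ a, (∀ b < a, J' b = J b) → J a ≤ J' a) (a : Fin k) :
    ∑ b ∈ Finset.Iic a, J b + ∑ b ∈ Finset.Iio a, J b ≤ D + ∑ b ∈ Finset.Iio a, d b := by
  induction k generalizing D with
  | zero => exact a.elim0
  | succ k ih =>
    set Φ := MvPolynomial.finSuccEquiv K k
    have hmem : ∀ j, ∀ J' : Fin k →₀ ℕ, J' ∈ ((Φ E).coeff j).support ↔ J'.cons j ∈ E.support :=
      fun j J' => MvPolynomial.mem_support_coeff_finSuccEquiv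
    have hdvd : X ^ J 0 ∣ Φ E := by
      rw [X_pow_dvd_iff]
      intro j hj
      by_contra hne
      obtain ⟨J', hJ'⟩ := MvPolynomial.support_nonempty.2 hne
      have := hmin _ ((hmem _ _).1 hJ') 0 (by simp)
      simp at this; omega
    obtain ⟨F, hF⟩ := hdvd
    have hF0 : F.coeff 0 = (Φ E).coeff (J 0) := by
      rw [hF]; simp [coeff_X_pow_mul']
    have hΦE : Φ E ≠ 0 := by simpa using hE
    have hFne : F ≠ 0 := by rintro rfl; simp at hF; exact hE hF
    have hdegF : F.natDegree + J 0 ≤ d 0 := by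
      have h1 : (Φ E).natDegree = E.degreeOf 0 := MvPolynomial.natDegree_finSuccEquiv E
      rw [hF, natDegree_X_pow_mul _ hFne] at h1
      exact h1.trans_le (hd 0)
    have hL : (translateVarsSucc k (Φ E)).natDegree ≤ D := by
      rw [← map_translateVars_succ]; exact natDegree_map_le.trans hD
    have hLne : translateVarsSucc k (Φ E) ≠ 0 := by
      rw [← map_translateVars_succ, Ne, Polynomial.map_eq_zero_iff Φ.injective]
      exact translateVars_ne_zero hE
    have hfac : translateVarsSucc k (Φ E) = (X + C X) ^ J 0 * translateVarsSucc k F := by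
      rw [hF, map_mul, map_pow]; simp [translateVarsSucc]
    have hGne : translateVarsSucc k F ≠ 0 := by
      intro h; rw [hfac, h, mul_zero] at hLne; exact hLne rfl
    rw [hfac, ((monic_X_add_C _).pow _).natDegree_mul' hGne, natDegree_pow_X_add_C] at hL
    have htail : (translateVars K k (F.coeff 0)).natDegree ≤ (D - J 0) + (d 0 - J 0) := by
      rw [← evalNeg_translateVarsSucc]
      exact natDegree_evalNeg_le (by omega) (natDegree_coeff_translateVarsSucc_le (by omega))
    have hJmem : J.tail ∈ (F.coeff 0).support := by
      rw [hF0, hmem, Finsupp.cons_tail]; exact hJ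
    refine Fin.cases ?_ (fun a => ?_) a
    · have : Finset.Iic (0 : Fin (k+1)) = {0} := by ext; simp
      have h2 : Finset.Iio (0 : Fin (k+1)) = ∅ := by ext; simp
      simp [this, h2]; omega
    · have := ih (MvPolynomial.support_nonempty.1 ⟨_, hJmem⟩) htail (fun b => d b.succ)
        (fun b => by
          rw [hF0]; exact (MvPolynomial.degreeOf_coeff_finSuccEquiv E b _).trans (hd _)) hJmem
        (by
          intro J' hJ' c hc
          rw [hF0, hmem] at hJ'
          have := hmin _ hJ' c.succ (by
            intro b hb
            induction b using Fin.cases with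
            | zero => simp
            | succ b => simpa [Finsupp.tail_apply] using hc b (by simpa using hb))
          simpa [Finsupp.tail_apply] using this) a
      have e1 : ∀ g : Fin (k+1) → ℕ, ∑ b ∈ Finset.Iic a.succ, g b =
          g 0 + ∑ b ∈ Finset.Iic a, g b.succ := by
        intro g
        have : Finset.Iic a.succ = insert 0 ((Finset.Iic a).map (Fin.succEmb k)) := by
          ext x; induction x using Fin.cases <;> simp
        rw [this, Finset.sum_insert (by simp), Finset.sum_map]; rfl
      have e2 : ∀ g : Fin (k+1) → ℕ, ∑ b ∈ Finset.Iio a.succ, g b =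
          g 0 + ∑ b ∈ Finset.Iio a, g b.succ := by
        intro g
        have : Finset.Iio a.succ = insert 0 ((Finset.Iio a).map (Fin.succEmb k)) := by
          ext x; induction x using Fin.cases <;> simp
        rw [this, Finset.sum_insert (by simp), Finset.sum_map]; rfl
      simp only [Finsupp.tail_apply] at this
      rw [e1, e2, e2]
      omega

end Ballot

section Leading

open MvPolynomial

/-- A relation on exponent vectors compatible with addition and cancellative on equalities. -/
structure IsDominance {σ : Type*} (r : (σ →₀ ℕ) → (σ →₀ ℕ) → Prop) : Prop where
  zero : r 0 0
  add : ∀ {e e' p p'}, r e p → r e' p' → r (e + e') (p + p')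
  cancel : ∀ {e e' p p'}, r e p → r e' p' → e + e' = p + p' → e = p

/-- `g` has the monomial `p` with coefficient one, and all its monomials are dominated by `p`. -/
def Led {σ A : Type*} [CommSemiring A] (r : (σ →₀ ℕ) → (σ →₀ ℕ) → Prop) (p : σ →₀ ℕ)
    (g : MvPolynomial σ A) : Prop :=
  coeff p g = 1 ∧ ∀ e, coeff e g ≠ 0 → r e p

variable {σ A : Type*} [CommSemiring A] {r : (σ →₀ ℕ) → (σ →₀ ℕ) → Prop}

theorem Led.one (hr : IsDominance r) : Led r 0 (1 : MvPolynomial σ A) := by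
  classical
  refine ⟨by simp, fun e he => ?_⟩
  rw [coeff_one] at he
  have : 0 = e := by by_contra h; simp [h] at he
  exact this ▸ hr.zero

theorem Led.mul (hr : IsDominance r) {p p' : σ →₀ ℕ} {g g' : MvPolynomial σ A} (h : Led r p g)
    (h' : Led r p' g') : Led r (p + p') (g * g') := by
  classical
  constructor
  · rw [coeff_mul, Finset.sum_eq_single (p, p')]
    · simp [h.1, h'.1]
    · rintro ⟨x, y⟩ hxy hne
      by_contra hc
      have hx := h.2 x (left_ne_zero_of_mul hc)
      have hy := h'.2 y (right_ne_zero_of_mul hc)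
      rw [Finset.HasAntidiagonal.mem_antidiagonal] at hxy
      have h1 : x = p := hr.cancel hx hy hxy
      subst h1
      exact hne (by simpa using hxy)
    · simp
  · intro e he
    rw [coeff_mul] at he
    obtain ⟨⟨x, y⟩, hxy, hc⟩ := Finset.exists_ne_zero_of_sum_ne_zero he
    rw [Finset.HasAntidiagonal.mem_antidiagonal] at hxy
    rw [← hxy]
    exact hr.add (h.2 x (left_ne_zero_of_mul hc)) (h'.2 y (right_ne_zero_of_mul hc))

theorem Led.pow (hr : IsDominance r) {p : σ →₀ ℕ} {g : MvPolynomial σ A} (h : Led r p g) (k : ℕ) :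
    Led r (k • p) (g ^ k) := by
  induction k with
  | zero => simpa using Led.one hr
  | succ k ih => rw [pow_succ, succ_nsmul]; exact ih.mul hr h

theorem Led.prod (hr : IsDominance r) {ι : Type*} (s : Finset ι) {p : ι → σ →₀ ℕ}
    {g : ι → MvPolynomial σ A} (h : ∀ i ∈ s, Led r (p i) (g i)) :
    Led r (∑ i ∈ s, p i) (∏ i ∈ s, g i) := by
  classical
  induction s using Finset.induction_on with
  | empty => simpa using Led.one hr
  | insert a s ha ih =>
    rw [Finset.sum_insert ha, Finset.prod_insert ha]
    exact (h a (by simp)).mul hr (ih fun i hi => h i (by simp [hi]))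

/-- If a substitution replaces each variable by a polynomial led by it, each monomial is replaced
by a polynomial led by it. -/
theorem Led.substitution (hr : IsDominance r) {φ : σ → MvPolynomial σ A}
    (h : ∀ v, Led r (Finsupp.single v 1) (φ v)) (e : σ →₀ ℕ) :
    Led r e (aeval φ (monomial e (1 : A))) := by
  rw [aeval_monomial, map_one, one_mul, Finsupp.prod]
  have := Led.prod hr e.support (fun v _ => (h v).pow hr (e v))
  convert this
  conv_lhs => rw [← Finsupp.sum_single e, Finsupp.sum]
  simp

end Leading

section RowOperations

open MvPolynomial SMB

variable {K : Type} [Field K] {n m q : ℕ}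

/-- The substitution `u_{b,c₁} ↦ u_{b,c₁} + t u_{b,c₀}`, `w_{c₀,b} ↦ w_{c₀,b} - t w_{c₁,b}`. -/
noncomputable def elemSubst (c₀ c₁ : Fin n) (t : K) : KX K n m q →ₐ[K] KX K n m q :=
  aeval (Sum.elim
    (fun p => if p.2 = c₁ then X (Sum.inl p) + C t * X (Sum.inl (p.1, c₀)) else X (Sum.inl p))
    (fun p => if p.1 = c₀ then X (Sum.inr p) - C t * X (Sum.inr (c₁, p.2)) else X (Sum.inr p)))

/-- The substitution `w_{c₀,b} ↦ w_{c₀,b} - t w_{c₁,b}` with coefficients in a ring. -/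
noncomputable def rowSubst {A : Type*} [CommRing A] (c₀ c₁ : Fin n) (t : A) :
    MvPolynomial ((Fin m × Fin n) ⊕ (Fin n × Fin q)) A →ₐ[A]
      MvPolynomial ((Fin m × Fin n) ⊕ (Fin n × Fin q)) A :=
  aeval (Sum.elim (fun p => X (Sum.inl p))
    (fun p => if p.1 = c₀ then X (Sum.inr p) - C t * X (Sum.inr (c₁, p.2)) else X (Sum.inr p)))

/-- Replace `u_{b,c₁}` by `y_b u_{b,c₀}`. -/
noncomputable def foldSubst (c₀ c₁ : Fin n) : KX K n m q →ₐ[K]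
    MvPolynomial ((Fin m × Fin n) ⊕ (Fin n × Fin q)) (MvPolynomial (Fin m) K) :=
  aeval (Sum.elim
    (fun p => if p.2 = c₁ then C (X p.1) * X (Sum.inl (p.1, c₀)) else X (Sum.inl p))
    (fun p => X (Sum.inr p)))

/-- Exponents after merging column `c₁` into column `c₀`. -/
noncomputable def foldExp (c₀ c₁ : Fin n) (e : (Fin m × Fin n) ⊕ (Fin n × Fin q) →₀ ℕ) :
    (Fin m × Fin n) ⊕ (Fin n × Fin q) →₀ ℕ :=
  Finsupp.equivFunOnFinite.symm (Sum.elim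
    (fun p => if p.2 = c₁ then 0 else
      if p.2 = c₀ then e (Sum.inl (p.1, c₀)) + e (Sum.inl (p.1, c₁)) else e (Sum.inl p))
    (fun p => e (Sum.inr p)))

/-- The exponents in column `c₁`. -/
noncomputable def colExp (c₁ : Fin n) (e : (Fin m × Fin n) ⊕ (Fin n × Fin q) →₀ ℕ) : Fin m →₀ ℕ :=
  Finsupp.equivFunOnFinite.symm fun b => e (Sum.inl (b, c₁))

theorem foldSubst_monomial {c₀ c₁ : Fin n} (hc : c₀ ≠ c₁)
    (e : (Fin m × Fin n) ⊕ (Fin n × Fin q) →₀ ℕ) (c : K) :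
    foldSubst c₀ c₁ (monomial e c) = monomial (foldExp c₀ c₁ e) (monomial (colExp c₁ e) c) := by
  induction e using Finsupp.induction_linear generalizing c with
  | zero =>
    have h1 : foldExp (m := m) (q := q) c₀ c₁ 0 = 0 := by
      ext (p | p) <;> simp [foldExp]
    have h2 : colExp (m := m) (q := q) c₁ 0 = 0 := by ext; simp [colExp]
    rw [h1, h2, ← C_apply, ← algebraMap_eq, AlgHom.commutes, ← C_apply, ← C_apply]
    rfl
  | add e e' ih ih' =>
    have h1 : foldExp c₀ c₁ (e + e') = foldExp c₀ c₁ e + foldExp c₀ c₁ e' := by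
      ext (p | p)
      · simp only [foldExp, Finsupp.equivFunOnFinite_symm_apply_apply, Finsupp.add_apply,
          Sum.elim_inl]
        split_ifs <;> omega
      · simp [foldExp]
    have h2 : colExp c₁ (e + e') = colExp c₁ e + colExp c₁ e' := by ext; simp [colExp]
    rw [h1, h2, ← mul_one c, ← monomial_mul, map_mul, ih, ih', monomial_mul, monomial_mul]
  | single v k =>
    have h0 : (monomial (Finsupp.single v k) c : KX K n m q) = C c * X v ^ k := by
      rw [C_mul_X_pow_eq_monomial]
    rw [h0, map_mul, map_pow, ← algebraMap_eq, AlgHom.commutes]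
    rcases v with ⟨b, l⟩ | p
    · by_cases hl : l = c₁
      · subst hl
        have h1 : foldExp (m := m) (q := q) c₀ l (Finsupp.single (Sum.inl (b, l)) k) =
            Finsupp.single (Sum.inl (b, c₀)) k := by
          ext (⟨b', l'⟩ | p)
          · simp only [foldExp, Finsupp.equivFunOnFinite_symm_apply_apply, Sum.elim_inl,
              Finsupp.single_apply, Sum.inl.injEq, Prod.mk.injEq]
            grind
          · simp [foldExp]
        have h2 : colExp (m := m) (q := q) l (Finsupp.single (Sum.inl (b, l)) k) =
            Finsupp.single b k := by
          ext; simp [colExp, Finsupp.single_apply]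
        rw [h1, h2]
        simp only [foldSubst, aeval_X, Sum.elim_inl, if_true]
        rw [mul_pow, ← C_pow, ← C_mul_X_pow_eq_monomial, ← C_mul_X_pow_eq_monomial, C_mul,
          mul_assoc]
        rfl
      · have h1 : foldExp (m := m) (q := q) c₀ c₁ (Finsupp.single (Sum.inl (b, l)) k) =
            Finsupp.single (Sum.inl (b, l)) k := by
          ext (⟨b', l'⟩ | p)
          · simp only [foldExp, Finsupp.equivFunOnFinite_symm_apply_apply, Sum.elim_inl,
              Finsupp.single_apply, Sum.inl.injEq, Prod.mk.injEq]
            grind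
          · simp [foldExp]
        have h2 : colExp (m := m) (q := q) c₁ (Finsupp.single (Sum.inl (b, l)) k) = 0 := by
          ext; simp [colExp, hl]
        rw [h1, h2]
        simp only [foldSubst, aeval_X, Sum.elim_inl, if_neg hl]
        rw [← C_mul_X_pow_eq_monomial]
        rfl
    · have h1 : foldExp (m := m) (q := q) c₀ c₁ (Finsupp.single (Sum.inr p) k) =
          Finsupp.single (Sum.inr p) k := by
        ext (p' | p') <;> simp [foldExp, Finsupp.single_apply]
      have h2 : colExp (m := m) (q := q) c₁ (Finsupp.single (Sum.inr p) k) = 0 := by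
        ext; simp [colExp]
      rw [h1, h2]
      simp only [foldSubst, aeval_X, Sum.elim_inr]
      rw [← C_mul_X_pow_eq_monomial]
      rfl

theorem foldSubst_elemSubst {c₀ c₁ : Fin n} (hc : c₀ ≠ c₁) (t : K) (f : KX K n m q) :
    foldSubst c₀ c₁ (elemSubst c₀ c₁ t f) =
      rowSubst c₀ c₁ (C t) (map (aeval fun b => X b + C t :
        MvPolynomial (Fin m) K →ₐ[K] MvPolynomial (Fin m) K).toRingHom (foldSubst c₀ c₁ f)) := by
  have hC : ∀ a : K, algebraMap K (MvPolynomial ((Fin m × Fin n) ⊕ (Fin n × Fin q))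
    (MvPolynomial (Fin m) K)) a = C (C a) := fun _ => rfl
  suffices h : ((foldSubst c₀ c₁).comp (elemSubst c₀ c₁ t)).toRingHom =
      ((rowSubst c₀ c₁ (C t)).toRingHom.comp (map (aeval fun b => X b + C t :
        MvPolynomial (Fin m) K →ₐ[K] MvPolynomial (Fin m) K).toRingHom)).comp
        (foldSubst (K := K) (n := n) (m := m) (q := q) c₀ c₁).toRingHom from congr($h f)
  apply MvPolynomial.ringHom_ext
  · intro a
    simp only [AlgHom.toRingHom_eq_coe, RingHom.comp_apply, RingHom.coe_coe, AlgHom.comp_apply]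
    rw [← algebraMap_eq, AlgHom.commutes, AlgHom.commutes, hC, map_C]
    simp [rowSubst, algebraMap_eq]
  · intro v
    simp only [AlgHom.toRingHom_eq_coe, RingHom.comp_apply, RingHom.coe_coe, AlgHom.comp_apply]
    rcases v with ⟨b, l⟩ | ⟨k, b⟩
    · by_cases hl : l = c₁
      · subst hl
        simp [foldSubst, elemSubst, rowSubst, hc, hC, add_mul, algebraMap_eq]
      · simp [foldSubst, elemSubst, rowSubst, hl]
    · by_cases hk : k = c₀
      · subst hk
        simp [foldSubst, elemSubst, rowSubst, hC]
      · simp [foldSubst, elemSubst, rowSubst, hk]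

theorem coeff_eq_of_led {σ A : Type*} [CommRing A] {r : (σ →₀ ℕ) → (σ →₀ ℕ) → Prop}
    {φ : MvPolynomial σ A →ₐ[A] MvPolynomial σ A} (h : ∀ e, Led r e (φ (monomial e 1)))
    {G : MvPolynomial σ A} {p : σ →₀ ℕ} (hG : ∀ e ∈ G.support, r p e → e = p) :
    coeff p (φ G) = coeff p G := by
  classical
  conv_lhs => rw [G.as_sum, map_sum, coeff_sum]
  have key : ∀ e ∈ G.support, coeff p (φ (monomial e (coeff e G))) =
      if e = p then coeff p G else 0 := by
    intro e he
    have h1 : (monomial e (coeff e G) : MvPolynomial σ A) = coeff e G • monomial e 1 := by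
      rw [smul_monomial, smul_eq_mul, mul_one]
    rw [h1, map_smul, coeff_smul]
    split_ifs with hep
    · subst hep; rw [(h e).1, smul_eq_mul, mul_one]
    · by_contra hne
      exact hep (hG e he ((h e).2 p (right_ne_zero_of_mul hne)))
  rw [Finset.sum_congr rfl key, Finset.sum_ite_eq']
  split_ifs with hp
  · rfl
  · exact (notMem_support_iff.1 hp).symm

/-- Moving exponents from row `c₀` down to row `c₁` of `W`. -/
def rowRel (c₀ c₁ : Fin n) (e p : (Fin m × Fin n) ⊕ (Fin n × Fin q) →₀ ℕ) : Prop :=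
  (∀ x, e (Sum.inl x) = p (Sum.inl x)) ∧
  (∀ k b, k ≠ c₀ → k ≠ c₁ → e (Sum.inr (k, b)) = p (Sum.inr (k, b))) ∧
  ∀ b, e (Sum.inr (c₀, b)) + e (Sum.inr (c₁, b)) = p (Sum.inr (c₀, b)) + p (Sum.inr (c₁, b)) ∧
    e (Sum.inr (c₀, b)) ≤ p (Sum.inr (c₀, b))

theorem rowRel_isDominance (c₀ c₁ : Fin n) :
    IsDominance (rowRel (m := m) (q := q) c₀ c₁) where
  zero := by simp [rowRel]
  add := by
    rintro e e' p p' ⟨h1, h2, h3⟩ ⟨h1', h2', h3'⟩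
    refine ⟨fun x => by simp [h1, h1'], fun k b h h' => by simp [h2 k b h h', h2' k b h h'],
      fun b => ?_⟩
    have := h3 b; have := h3' b
    simp only [Finsupp.add_apply]
    omega
  cancel := by
    rintro e e' p p' ⟨h1, h2, h3⟩ ⟨h1', h2', h3'⟩ h
    ext (x | ⟨k, b⟩)
    · exact h1 x
    · have := h3 b; have := h3' b
      have g0 := DFunLike.congr_fun h (Sum.inr (c₀, b))
      simp only [Finsupp.add_apply] at g0
      by_cases hk : k = c₀
      · subst hk; omega
      by_cases hk' : k = c₁
      · subst hk'; omega
      exact h2 k b hk hk'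

theorem rowSubst_led {A : Type*} [CommRing A] {c₀ c₁ : Fin n} (hc : c₀ ≠ c₁) (t : A)
    (e : (Fin m × Fin n) ⊕ (Fin n × Fin q) →₀ ℕ) :
    Led (rowRel c₀ c₁) e (rowSubst c₀ c₁ t (monomial e 1)) := by
  classical
  refine Led.substitution (rowRel_isDominance c₀ c₁) (fun v => ?_) e
  have hX : ∀ v, Led (rowRel c₀ c₁) (Finsupp.single v 1)
      (X v : MvPolynomial ((Fin m × Fin n) ⊕ (Fin n × Fin q)) A) := by
    intro v
    refine ⟨by simp, fun e he => ?_⟩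
    rw [coeff_X] at he
    have : Finsupp.single v 1 = e := by by_contra h; simp [h] at he
    subst this
    exact ⟨by simp, by simp, by simp⟩
  rcases v with x | ⟨k, b⟩
  · exact hX _
  · by_cases hk : k = c₀
    · subst hk
      simp only [Sum.elim_inr, if_true]
      constructor
      · rw [coeff_sub, coeff_C_mul, coeff_X, coeff_X, if_pos rfl, if_neg, mul_zero, sub_zero]
        intro h
        rw [Finsupp.single_left_inj one_ne_zero] at h
        simp only [Sum.inr.injEq, Prod.mk.injEq] at h
        exact hc h.1.symm
      · intro e he
        by_cases h1 : coeff e (X (Sum.inr (k, b)) :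
            MvPolynomial ((Fin m × Fin n) ⊕ (Fin n × Fin q)) A) = 0
        · rw [coeff_sub, h1, zero_sub, coeff_C_mul, coeff_X] at he
          have : Finsupp.single (Sum.inr (c₁, b)) 1 = e := by by_contra h; simp [h] at he
          subst this
          refine ⟨by simp, fun k' b' h h' => ?_, fun b' => ?_⟩
          · simp [h.symm, h'.symm]
          · simp [Finsupp.single_apply, hc, hc.symm]
        · exact (hX _).2 e h1
    · simp only [Sum.elim_inr, if_neg hk]
      exact hX _

theorem coeff_colExp_coeff_foldExp {c₀ c₁ : Fin n} (hc : c₀ ≠ c₁) (f : KX K n m q)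
    (e : (Fin m × Fin n) ⊕ (Fin n × Fin q) →₀ ℕ) :
    coeff (colExp c₁ e) (coeff (foldExp c₀ c₁ e) (foldSubst c₀ c₁ f)) = coeff e f := by
  classical
  induction f using MvPolynomial.induction_on' with
  | monomial e' c =>
    rw [foldSubst_monomial hc, coeff_monomial, coeff_monomial]
    by_cases h : e' = e
    · simp [h]
    · rw [if_neg h]
      split_ifs with h1
      · rw [coeff_monomial, if_neg]
        intro h2
        apply h
        ext (⟨b, l⟩ | p)
        · have g1 := DFunLike.congr_fun h1 (Sum.inl (b, l))
          have g2 := DFunLike.congr_fun h2 b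
          have g3 := DFunLike.congr_fun h1 (Sum.inl (b, c₀))
          simp only [foldExp, colExp, Finsupp.equivFunOnFinite_symm_apply_apply,
            Sum.elim_inl, hc, if_false, if_true] at g1 g2 g3
          by_cases hl : l = c₁
          · subst hl; exact g2
          by_cases hl0 : l = c₀
          · subst hl0; omega
          simpa [hl, hl0] using g1
        · simpa [foldExp] using DFunLike.congr_fun h1 (Sum.inr p)
      · simp
  | add f g hf hg => rw [map_add, coeff_add, coeff_add, coeff_add, hf, hg]

theorem exists_of_coeff_foldSubst_ne_zero {c₀ c₁ : Fin n} (hc : c₀ ≠ c₁) (f : KX K n m q)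
    {p : (Fin m × Fin n) ⊕ (Fin n × Fin q) →₀ ℕ} {J : Fin m →₀ ℕ}
    (h : coeff J (coeff p (foldSubst c₀ c₁ f)) ≠ 0) :
    ∃ e ∈ f.support, foldExp c₀ c₁ e = p ∧ colExp c₁ e = J := by
  classical
  rw [f.as_sum, map_sum, coeff_sum, coeff_sum] at h
  obtain ⟨e, he, hne⟩ := Finset.exists_ne_zero_of_sum_ne_zero h
  refine ⟨e, he, ?_⟩
  rw [foldSubst_monomial hc, coeff_monomial] at hne
  split_ifs at hne with h1
  · rw [coeff_monomial] at hne
    split_ifs at hne with h2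
    · exact ⟨h1, h2⟩
    · exact absurd rfl hne
  · simp at hne

theorem column_ballot [Infinite K] {c₀ c₁ : Fin n} (hc : c₀ ≠ c₁) {f : KX K n m q}
    (hf : ∀ t, elemSubst c₀ c₁ t f = f)
    {e : (Fin m × Fin n) ⊕ (Fin n × Fin q) →₀ ℕ} (he : e ∈ f.support)
    (hrow : ∀ e₁ ∈ f.support,
      (∀ k b, k ≠ c₀ → k ≠ c₁ → e₁ (Sum.inr (k, b)) = e (Sum.inr (k, b))) →
      (∀ b, e₁ (Sum.inr (c₀, b)) + e₁ (Sum.inr (c₁, b)) =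
        e (Sum.inr (c₀, b)) + e (Sum.inr (c₁, b))) →
      (∀ a k, k ≠ c₀ → k ≠ c₁ → e₁ (Sum.inl (a, k)) = e (Sum.inl (a, k))) →
      (∀ a, e₁ (Sum.inl (a, c₀)) + e₁ (Sum.inl (a, c₁)) =
        e (Sum.inl (a, c₀)) + e (Sum.inl (a, c₁))) →
      ∑ b, e₁ (Sum.inr (c₀, b)) ≤ ∑ b, e (Sum.inr (c₀, b)))
    (hcol : ∀ e₁ ∈ f.support, (∀ x, e₁ (Sum.inr x) = e (Sum.inr x)) →
      (∀ a k, k ≠ c₀ → k ≠ c₁ → e₁ (Sum.inl (a, k)) = e (Sum.inl (a, k))) →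
      (∀ a, e₁ (Sum.inl (a, c₀)) + e₁ (Sum.inl (a, c₁)) =
        e (Sum.inl (a, c₀)) + e (Sum.inl (a, c₁))) →
      ∀ a, (∀ b < a, e₁ (Sum.inl (b, c₀)) = e (Sum.inl (b, c₀))) →
        e₁ (Sum.inl (a, c₀)) ≤ e (Sum.inl (a, c₀)))
    (a : Fin m) :
    ∑ b ∈ Finset.Iic a, e (Sum.inl (b, c₁)) ≤ ∑ b ∈ Finset.Iio a, e (Sum.inl (b, c₀)) := by
  classical
  set p := foldExp c₀ c₁ e with hp
  set E := coeff p (foldSubst c₀ c₁ f) with hE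
  have fold_inl : ∀ e₁, foldExp c₀ c₁ e₁ = p →
      (∀ a k, k ≠ c₀ → k ≠ c₁ → e₁ (Sum.inl (a, k)) = e (Sum.inl (a, k))) ∧
      (∀ a, e₁ (Sum.inl (a, c₀)) + e₁ (Sum.inl (a, c₁)) =
        e (Sum.inl (a, c₀)) + e (Sum.inl (a, c₁))) ∧ ∀ x, e₁ (Sum.inr x) = e (Sum.inr x) := by
    intro e₁ h
    refine ⟨fun a k h0 h1 => ?_, fun a => ?_, fun x => ?_⟩
    · simpa [hp, foldExp, h0, h1] using DFunLike.congr_fun h (Sum.inl (a, k))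
    · simpa [hp, foldExp, hc] using DFunLike.congr_fun h (Sum.inl (a, c₀))
    · simpa [hp, foldExp] using DFunLike.congr_fun h (Sum.inr x)
  have htrans : ∀ t : K, (aeval fun b => X b + C t :
      MvPolynomial (Fin m) K →ₐ[K] MvPolynomial (Fin m) K) E = E := by
    intro t
    have h1 := foldSubst_elemSubst hc t f
    rw [hf t] at h1
    have h2 := congr(coeff p $h1)
    rw [coeff_eq_of_led (rowSubst_led hc (C t)), coeff_map] at h2
    · exact h2.symm
    · intro e' he' hr
      have hne : coeff e' (foldSubst c₀ c₁ f) ≠ 0 := by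
        intro h0
        rw [mem_support_iff, coeff_map, h0, map_zero] at he'
        exact he' rfl
      obtain ⟨J, hJ⟩ := MvPolynomial.exists_coeff_ne_zero hne
      obtain ⟨e₁, he₁, h₁, -⟩ := exists_of_coeff_foldSubst_ne_zero hc f hJ
      obtain ⟨r1, r2, r3⟩ := hr
      have w : ∀ x, e₁ (Sum.inr x) = e' (Sum.inr x) := fun x => by simp [← h₁, foldExp]
      have w' : ∀ x, e (Sum.inr x) = p (Sum.inr x) := fun x => by simp [hp, foldExp]
      have hle := hrow e₁ he₁
        (fun k b h0 h1 => by rw [w, w', r2 k b h0 h1])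
        (fun b => by rw [w, w, w', w', (r3 b).1])
        (fun a k h0 h1 => by
          simpa [hp, ← h₁, foldExp, h0, h1] using (r1 (a, k)).symm)
        (fun a => by simpa [hp, ← h₁, foldExp, hc] using (r1 (a, c₀)).symm)
      have heq : ∀ b, p (Sum.inr (c₀, b)) = e' (Sum.inr (c₀, b)) := by
        have hle' : ∑ b, e' (Sum.inr (c₀, b)) ≤ ∑ b, p (Sum.inr (c₀, b)) := by
          simpa only [w, w'] using hle
        have := (Finset.sum_eq_sum_iff_of_le (fun b _ => (r3 b).2)).1
          (le_antisymm (Finset.sum_le_sum fun b _ => (r3 b).2) hle')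
        exact fun b => this b (Finset.mem_univ b)
      ext (x | ⟨k, b⟩)
      · exact (r1 x).symm
      · by_cases h0 : k = c₀
        · subst h0; exact (heq b).symm
        by_cases h1 : k = c₁
        · subst h1; have := heq b; have := (r3 b).1; omega
        exact (r2 k b h0 h1).symm
  have hconst : translateVars K m E = Polynomial.C E := by
    apply Polynomial.eq_of_infinite_eval_eq
    refine Set.Infinite.mono ?_ (Set.infinite_range_of_injective (C_injective (Fin m) K))
    rintro _ ⟨t, rfl⟩
    rw [Set.mem_ofPred_eq, Polynomial.eval_C]
    conv_rhs => rw [← htrans t]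
    have : ((Polynomial.aeval (R := MvPolynomial (Fin m) K) (C t)).restrictScalars K).comp
        (translateVars K m) = aeval fun b => X b + C t := by
      ext i; simp [translateVars]
    exact congr($this E)
  have hmem : colExp c₁ e ∈ E.support := by
    rw [mem_support_iff, hE, hp, coeff_colExp_coeff_foldExp hc]
    exact mem_support_iff.1 he
  have hsupp : ∀ J' ∈ E.support, ∃ e₁ ∈ f.support, foldExp c₀ c₁ e₁ = p ∧ colExp c₁ e₁ = J' :=
    fun J' hJ' => exists_of_coeff_foldSubst_ne_zero hc f (mem_support_iff.1 hJ')
  have := lexMin_partialSums_le (D := 0) (support_nonempty.1 ⟨_, hmem⟩) (by rw [hconst]; simp)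
    (fun b => e (Sum.inl (b, c₀)) + e (Sum.inl (b, c₁)))
    (fun b => by
      rw [degreeOf_le_iff]
      intro J' hJ'
      obtain ⟨e₁, -, h₁, rfl⟩ := hsupp J' hJ'
      rw [← (fold_inl e₁ h₁).2.1 b]
      simp [colExp]) hmem
    (fun J' hJ' a ha => by
      obtain ⟨e₁, he₁, h₁, rfl⟩ := hsupp J' hJ'
      obtain ⟨k1, k2, k3⟩ := fold_inl e₁ h₁
      have := hcol e₁ he₁ k3 k1 k2 a (fun b hb => by
        have := ha b hb
        have := k2 b
        simp only [colExp, Finsupp.equivFunOnFinite_symm_apply_apply] at *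
        omega)
      have := k2 a
      simp only [colExp, Finsupp.equivFunOnFinite_symm_apply_apply]
      omega) a
  simp only [colExp, Finsupp.equivFunOnFinite_symm_apply_apply, Finset.sum_add_distrib] at this
  omega

end RowOperations

section Tableau

variable {n N m q : ℕ}

/-- Partial row sums of a matrix of naturals. -/
def rowSum (x : Fin n → Fin N → ℕ) (i : Fin n) (k : ℕ) : ℕ :=
  ∑ a : Fin N, if a.val < k then x i a else 0

/-- The sum of the upper left `l × k` corner. -/
def cornerSum (x : Fin n → Fin N → ℕ) (k l : ℕ) : ℕ :=
  ∑ i : Fin n, if i.val < l then rowSum x i k else 0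

theorem rowSum_succ (x : Fin n → Fin N → ℕ) (i : Fin n) (a : Fin N) :
    rowSum x i (a + 1) = rowSum x i a + x i a := by
  have : x i a = ∑ b : Fin N, if b = a then x i b else 0 := by simp
  rw [rowSum, rowSum, this, ← Finset.sum_add_distrib]
  refine Finset.sum_congr rfl fun b _ => ?_
  simp only [Fin.ext_iff]
  split_ifs <;> omega

theorem cornerSum_succ (x : Fin n → Fin N → ℕ) (k : ℕ) (i : Fin n) :
    cornerSum x k (i + 1) = cornerSum x k i + rowSum x i k := by
  have : rowSum x i k = ∑ b : Fin n, if b = i then rowSum x b k else 0 := by simp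
  rw [cornerSum, cornerSum, this, ← Finset.sum_add_distrib]
  refine Finset.sum_congr rfl fun b _ => ?_
  simp only [Fin.ext_iff]
  split_ifs <;> omega

theorem rowSum_add (x y : Fin n → Fin N → ℕ) (i : Fin n) (k : ℕ) :
    rowSum (x + y) i k = rowSum x i k + rowSum y i k := by
  rw [rowSum, rowSum, rowSum, ← Finset.sum_add_distrib]
  exact Finset.sum_congr rfl fun b _ => by split_ifs <;> simp

theorem cornerSum_add (x y : Fin n → Fin N → ℕ) (k l : ℕ) :
    cornerSum (x + y) k l = cornerSum x k l + cornerSum y k l := by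
  rw [cornerSum, cornerSum, cornerSum, ← Finset.sum_add_distrib]
  exact Finset.sum_congr rfl fun b _ => by split_ifs <;> simp [rowSum_add]

theorem rowSum_zero_right (x : Fin n → Fin N → ℕ) (i : Fin n) : rowSum x i 0 = 0 := by
  simp [rowSum]

theorem rowSum_eq_sum (x : Fin n → Fin N → ℕ) (i : Fin n) : rowSum x i N = ∑ a, x i a := by
  simp [rowSum]

theorem rowSum_Iic (x : Fin n → Fin N → ℕ) (i : Fin n) (a : Fin N) :
    rowSum x i (a + 1) = ∑ b ∈ Finset.Iic a, x i b := by
  rw [rowSum, ← Finset.sum_filter]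
  congr 1
  ext b
  simp only [Finset.mem_filter, Finset.mem_univ, true_and, Finset.mem_Iic, Fin.le_def]
  omega

theorem rowSum_Iio (x : Fin n → Fin N → ℕ) (i : Fin n) (a : Fin N) :
    rowSum x i a = ∑ b ∈ Finset.Iio a, x i b := by
  rw [rowSum, ← Finset.sum_filter]
  congr 1
  ext b; simp

theorem eq_of_rowSum_eq {x y : Fin n → Fin N → ℕ} (h : ∀ i, ∀ k ≤ N, rowSum x i k = rowSum y i k) :
    x = y := by
  ext i a
  have h1 := rowSum_succ x i a
  have h2 := rowSum_succ y i a
  rw [h i _ (by omega), h i _ (by omega)] at h1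
  omega

/-- Dominance of matrices: corner sums decrease, column sums agree. -/
def MatDom (x y : Fin n → Fin N → ℕ) : Prop :=
  ∀ k, cornerSum x k n = cornerSum y k n ∧ ∀ l, cornerSum x k l ≤ cornerSum y k l

theorem eq_of_cornerSum_eq {x y : Fin n → Fin N → ℕ}
    (h : ∀ k l, cornerSum x k l = cornerSum y k l) :
    x = y := by
  refine eq_of_rowSum_eq fun i k _ => ?_
  have h1 := cornerSum_succ x k i
  have h2 := cornerSum_succ y k i
  rw [h, h] at h1
  omega

theorem MatDom.add {x y x' y' : Fin n → Fin N → ℕ} (h : MatDom x y) (h' : MatDom x' y') :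
    MatDom (x + x') (y + y') := by
  intro k
  simp only [cornerSum_add]
  exact ⟨by rw [(h k).1, (h' k).1], fun l => add_le_add ((h k).2 l) ((h' k).2 l)⟩

theorem MatDom.cancel {x y x' y' : Fin n → Fin N → ℕ} (h : MatDom x y) (h' : MatDom x' y')
    (he : x + x' = y + y') : x = y := by
  refine eq_of_cornerSum_eq fun k l => ?_
  have h1 := cornerSum_add x x' k l
  rw [he, cornerSum_add] at h1
  have := (h k).2 l
  have := (h' k).2 l
  omega

/-- The semistandardness condition in terms of partial row sums. -/
def IsSemistandard (x : Fin n → Fin N → ℕ) : Prop :=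
  ∀ i i' : Fin n, i'.val = i.val + 1 → ∀ k < N, rowSum x i' (k + 1) ≤ rowSum x i k

/-- The exponents of the variables `u_{a,i}`, transposed. -/
def uMat (e : (Fin m × Fin n) ⊕ (Fin n × Fin q) →₀ ℕ) : Fin n → Fin m → ℕ :=
  fun i a => e (Sum.inl (a, i))

/-- The exponents of the variables `w_{i,b}`. -/
def wMat (e : (Fin m × Fin n) ⊕ (Fin n × Fin q) →₀ ℕ) : Fin n → Fin q → ℕ :=
  fun i b => e (Sum.inr (i, b))

theorem exp_ext {e p : (Fin m × Fin n) ⊕ (Fin n × Fin q) →₀ ℕ} (hu : uMat e = uMat p)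
    (hw : wMat e = wMat p) : e = p := by
  ext (⟨a, i⟩ | ⟨i, b⟩)
  · exact congr_fun₂ hu i a
  · exact congr_fun₂ hw i b

/-- The dominance order on monomials. -/
def ExpDom (e p : (Fin m × Fin n) ⊕ (Fin n × Fin q) →₀ ℕ) : Prop :=
  MatDom (uMat e) (uMat p) ∧ MatDom (wMat e) (wMat p)

theorem ExpDom.refl (e : (Fin m × Fin n) ⊕ (Fin n × Fin q) →₀ ℕ) : ExpDom e e :=
  ⟨fun _ => ⟨rfl, fun _ => le_rfl⟩, fun _ => ⟨rfl, fun _ => le_rfl⟩⟩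

theorem ExpDom.trans {e p r : (Fin m × Fin n) ⊕ (Fin n × Fin q) →₀ ℕ} (h : ExpDom e p)
    (h' : ExpDom p r) : ExpDom e r :=
  ⟨fun k => ⟨(h.1 k).1.trans (h'.1 k).1, fun l => ((h.1 k).2 l).trans ((h'.1 k).2 l)⟩,
   fun k => ⟨(h.2 k).1.trans (h'.2 k).1, fun l => ((h.2 k).2 l).trans ((h'.2 k).2 l)⟩⟩

theorem expDom_isDominance : IsDominance (ExpDom (n := n) (m := m) (q := q)) where
  zero := ExpDom.refl 0
  add h h' := ⟨h.1.add h'.1, h.2.add h'.2⟩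
  cancel h h' he := exp_ext
    (h.1.cancel h'.1 (by ext i a; exact DFunLike.congr_fun he (Sum.inl (a, i))))
    (h.2.cancel h'.2 (by ext i a; exact DFunLike.congr_fun he (Sum.inr (i, a))))

/-- The leading exponents of invariants. -/
structure IsStandardExp (e : (Fin m × Fin n) ⊕ (Fin n × Fin q) →₀ ℕ) : Prop where
  left : IsSemistandard (uMat e)
  right : IsSemistandard (wMat e)
  torus : ∀ i i', rowSum (uMat e) i m + rowSum (wMat e) i' q =
    rowSum (uMat e) i' m + rowSum (wMat e) i q

/-- The positions of the monomial key. -/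
abbrev KeyIndex (n m q : ℕ) := Fin n ⊕ₗ ((Fin n ×ₗ Fin m) ⊕ₗ (Fin n ×ₗ Fin q))

/-- A monomial order on exponents. -/
def expKey (e : (Fin m × Fin n) ⊕ (Fin n × Fin q) →₀ ℕ) : Lex (KeyIndex n m q → ℕ) :=
  toLex fun v => Sum.elim (fun i => rowSum (uMat e) i m)
    (fun v => Sum.elim (fun x => uMat e (ofLex x).1 (ofLex x).2)
      (fun x => wMat e (ofLex x).1 (ofLex x).2) (ofLex v)) (ofLex v)

theorem apply_le_of_lex_le {ι : Type*} [LinearOrder ι] [WellFoundedLT ι] {x y : Lex (ι → ℕ)}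
    (h : x ≤ y) {i : ι} (hi : ∀ j < i, ofLex x j = ofLex y j) : ofLex x i ≤ ofLex y i := by
  by_contra! hlt
  exact absurd h (not_le_of_gt ⟨i, fun j hj => (hi j hj).symm, hlt⟩)

theorem expKey_injective : Function.Injective (expKey (n := n) (m := m) (q := q)) := by
  intro e p h
  refine exp_ext ?_ ?_
  · ext i a
    exact congr_fun (congrArg ofLex h) (Sum.inrₗ (Sum.inlₗ (toLex (i, a))))
  · ext i a
    exact congr_fun (congrArg ofLex h) (Sum.inrₗ (Sum.inrₗ (toLex (i, a))))

theorem corner_entry_le {x y : Fin n → Fin N → ℕ} (h : MatDom x y) {i : Fin n} {a : Fin N}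
    (hi : ∀ j b, toLex (j, b) < toLex (i, a) → x j b = y j b) : x i a ≤ y i a := by
  by_contra! hlt
  have h1 := (h (a + 1)).2 (i + 1)
  rw [cornerSum_succ, cornerSum_succ, rowSum_succ, rowSum_succ] at h1
  have h2 : cornerSum x (a + 1) i = cornerSum y (a + 1) i := by
    refine Finset.sum_congr rfl fun j _ => ?_
    split_ifs with hj
    · refine Finset.sum_congr rfl fun b _ => ?_
      rw [hi j b (by rw [Prod.Lex.toLex_lt_toLex]; exact Or.inl hj)]
    · rfl
  have h3 : rowSum x i a = rowSum y i a := by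
    refine Finset.sum_congr rfl fun b _ => ?_
    split_ifs with hj
    · rw [hi i b (by rw [Prod.Lex.toLex_lt_toLex]; exact Or.inr ⟨rfl, hj⟩)]
    · rfl
  omega

theorem expKey_le_of_expDom {e p : (Fin m × Fin n) ⊕ (Fin n × Fin q) →₀ ℕ} (h : ExpDom e p) :
    expKey e ≤ expKey p := by
  by_contra! hlt
  obtain ⟨v, hv, hlt⟩ := hlt
  revert hv hlt
  induction v using Sum.rec with
  | inl i =>
    intro hv hlt
    have h1 := (h.1 m).2 (i + 1)
    rw [cornerSum_succ, cornerSum_succ] at h1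
    have h2 : cornerSum (uMat e) m i = cornerSum (uMat p) m i := by
      refine Finset.sum_congr rfl fun j _ => ?_
      split_ifs with hj
      · exact (hv (Sum.inlₗ j) (Sum.Lex.inl_lt_inl_iff.2 hj)).symm
      · rfl
    have h3 : rowSum (uMat p) i m < rowSum (uMat e) i m := hlt
    omega
  | inr v =>
    induction v using Sum.rec with
    | inl x =>
      intro hv hlt
      refine absurd hlt (not_lt_of_ge (corner_entry_le h.1 fun j b hjb => ?_))
      exact (hv (Sum.inrₗ (Sum.inlₗ (toLex (j, b))))
        (Sum.Lex.inr_lt_inr_iff.2 (Sum.Lex.inl_lt_inl_iff.2 hjb))).symm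
    | inr x =>
      intro hv hlt
      refine absurd hlt (not_lt_of_ge (corner_entry_le h.2 fun j b hjb => ?_))
      exact (hv (Sum.inrₗ (Sum.inrₗ (toLex (j, b))))
        (Sum.Lex.inr_lt_inr_iff.2 (Sum.Lex.inr_lt_inr_iff.2 hjb))).symm

end Tableau

section LeadingExponents

open MvPolynomial SMB

variable {K : Type} [Field K] {n m q : ℕ}

theorem SMB.IsSLInvariant.evalX_mul {f : KX K n m q} (hf : IsSLInvariant f)
    {A B : Matrix (Fin n) (Fin n) K} (hA : A.det = 1) (hAB : A * B = 1)
    (U : Matrix (Fin m) (Fin n) K) (W : Matrix (Fin n) (Fin q) K) :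
    evalX K n m q (U * A) (B * W) f = evalX K n m q U W f := by
  have hB : B.det = 1 := by
    have := congr(Matrix.det $hAB)
    rwa [Matrix.det_mul, hA, one_mul, Matrix.det_one] at this
  let A' : Matrix.SpecialLinearGroup (Fin n) K := ⟨A, hA⟩
  let B' : Matrix.SpecialLinearGroup (Fin n) K := ⟨B, hB⟩
  have h1 : A'⁻¹ = B' := inv_eq_of_mul_eq_one_right (Subtype.ext hAB)
  have := hf A' U W
  rwa [h1] at this

theorem ext_evalX [Infinite K] {f g : KX K n m q} (h : ∀ U W, evalX K n m q U W f =
    evalX K n m q U W g) : f = g := by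
  refine MvPolynomial.funext fun x => ?_
  have := h (Matrix.of fun a i => x (Sum.inl (a, i))) (Matrix.of fun i b => x (Sum.inr (i, b)))
  have hx : Sum.elim (fun p : Fin m × Fin n => x (Sum.inl (p.1, p.2)))
      (fun p : Fin n × Fin q => x (Sum.inr (p.1, p.2))) = x := by
    ext (p | p) <;> rfl
  simpa only [evalX, Matrix.of_apply, hx] using this

theorem SMB.IsSLInvariant.elemSubst_eq [Infinite K] {f : KX K n m q} (hf : IsSLInvariant f)
    {c₀ c₁ : Fin n} (hc : c₀ ≠ c₁) (t : K) : elemSubst c₀ c₁ t f = f := by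
  refine ext_evalX fun U W => ?_
  rw [← hf.evalX_mul (A := Matrix.transvection c₀ c₁ t) (B := Matrix.transvection c₀ c₁ (-t))
    (Matrix.det_transvection_of_ne _ _ hc _)
    (by rw [Matrix.transvection_mul_transvection_same _ _ hc]; simp)]
  rw [elemSubst, evalX, evalX, ← coe_aeval_eq_eval, ← coe_aeval_eq_eval]
  simp only [RingHom.coe_coe]
  rw [← AlgHom.comp_apply, comp_aeval]
  congr 2
  ext (⟨a, l⟩ | ⟨k, b⟩)
  · simp only [Sum.elim_inl]
    split_ifs with h
    · subst h; simp [mul_comm]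
    · simp [h]
  · simp only [Sum.elim_inr]
    split_ifs with h
    · subst h; simp [sub_eq_add_neg]
    · simp [h]

theorem SMB.IsSLInvariant.torus [Infinite K] {f : KX K n m q} (hf : IsSLInvariant f)
    {e : (Fin m × Fin n) ⊕ (Fin n × Fin q) →₀ ℕ} (he : e ∈ f.support) (i i' : Fin n) :
    rowSum (uMat e) i m + rowSum (wMat e) i' q = rowSum (uMat e) i' m + rowSum (wMat e) i q := by
  classical
  by_cases hi : i = i'
  · subst hi; rfl
  have key : ∀ c : K, c ≠ 0 → c ^ (rowSum (uMat e) i m + rowSum (wMat e) i' q) =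
      c ^ (rowSum (uMat e) i' m + rowSum (wMat e) i q) := by
    intro c hc0
    set d : Fin n → K := fun l => (if l = i then c else 1) * (if l = i' then c⁻¹ else 1) with hd
    set d' : Fin n → K := fun l => (if l = i then c⁻¹ else 1) * (if l = i' then c else 1) with hd'
    have hdd : ∀ l, d l * d' l = 1 := by
      intro l
      simp only [hd, hd']
      split_ifs <;> simp [hc0]
    set s : (Fin m × Fin n) ⊕ (Fin n × Fin q) → K := Sum.elim (fun p => d p.2) (fun p => d' p.1)
      with hs
    have h1 : aeval (fun v => C (s v) * X v) f = f := by
      refine ext_evalX fun U W => ?_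
      rw [← hf.evalX_mul (A := Matrix.diagonal d) (B := Matrix.diagonal d')
        (by
          rw [Matrix.det_diagonal, Finset.prod_mul_distrib, Finset.prod_ite_eq',
            Finset.prod_ite_eq']
          simp [hc0])
        (by rw [Matrix.diagonal_mul_diagonal]; simp [hdd])]
      rw [evalX, evalX, ← coe_aeval_eq_eval, ← coe_aeval_eq_eval]
      simp only [RingHom.coe_coe]
      rw [← AlgHom.comp_apply, comp_aeval]
      congr 2
      ext (⟨a, l⟩ | ⟨k, b⟩)
      · simp [hs, mul_comm]
      · simp [hs]
    have h2 : coeff e (aeval (fun v => C (s v) * X v) f) =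
        coeff e f * ∏ v, s v ^ e v := by
      have hmon : ∀ (p : (Fin m × Fin n) ⊕ (Fin n × Fin q) →₀ ℕ) (a : K),
          aeval (fun v => (C (s v) * X v : KX K n m q)) (monomial p a) =
          monomial p (a * ∏ v, s v ^ p v) := by
        intro p a
        rw [aeval_monomial, Finsupp.prod_fintype _ _ (by simp)]
        simp only [mul_pow, Finset.prod_mul_distrib]
        rw [monomial_eq, Finsupp.prod_fintype _ _ (by simp)]
        simp [algebraMap_eq, mul_assoc]
      conv_lhs => rw [f.as_sum, map_sum, coeff_sum]
      simp only [hmon, coeff_monomial]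
      rw [Finset.sum_ite_eq', if_pos he]
    rw [h1] at h2
    have h3 : ∏ v, s v ^ e v = 1 := by
      have := mem_support_iff.1 he
      exact (mul_left_cancel₀ this (by rw [mul_one]; exact h2)).symm
    have h4 : ∏ v, s v ^ e v = (∏ l, d l ^ rowSum (uMat e) l m) *
        ∏ l, d' l ^ rowSum (wMat e) l q := by
      rw [Fintype.prod_sum_type, Fintype.prod_prod_type_right, Fintype.prod_prod_type]
      congr 1
      · refine Finset.prod_congr rfl fun l _ => ?_
        rw [rowSum_eq_sum, ← Finset.prod_pow_eq_pow_sum]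
        rfl
      · refine Finset.prod_congr rfl fun l _ => ?_
        rw [rowSum_eq_sum, ← Finset.prod_pow_eq_pow_sum]
        rfl
    rw [h3] at h4
    simp only [hd, hd', mul_pow, Finset.prod_mul_distrib, ite_pow, one_pow,
      Finset.prod_ite_eq', Finset.mem_univ, if_true, inv_pow] at h4
    rw [pow_add, pow_add]
    have a1 := pow_ne_zero (rowSum (uMat e) i' m) hc0
    have a2 := pow_ne_zero (rowSum (wMat e) i q) hc0
    field_simp at h4
    linear_combination -h4
  have hpoly : (Polynomial.X ^ (rowSum (uMat e) i m + rowSum (wMat e) i' q) : Polynomial K) =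
      Polynomial.X ^ (rowSum (uMat e) i' m + rowSum (wMat e) i q) := by
    apply Polynomial.eq_of_infinite_eval_eq
    refine Set.Infinite.mono (s := {0}ᶜ) ?_ (Set.finite_singleton (0 : K)).infinite_compl
    intro c hc
    simpa using key c hc
  simpa using congr(Polynomial.natDegree $hpoly)

/-- Transposing both matrices and exchanging them. -/
noncomputable def swapVars : KX K n m q →ₐ[K] KX K n q m :=
  rename (Sum.elim (fun p => Sum.inr p.swap) (fun p => Sum.inl p.swap))

theorem swapVars_injective_vars : Function.Injective
    (Sum.elim (fun p => Sum.inr p.swap) (fun p => Sum.inl p.swap) :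
      (Fin m × Fin n) ⊕ (Fin n × Fin q) → (Fin q × Fin n) ⊕ (Fin n × Fin m)) := by
  rintro (x | x) (y | y) h <;> simp_all [Prod.ext_iff]

theorem SMB.IsSLInvariant.swap {f : KX K n m q} (hf : IsSLInvariant f) :
    IsSLInvariant (swapVars f) := by
  have hev : ∀ U W, evalX K n q m U W (swapVars f) = evalX K n m q 
      W.transpose U.transpose f := by
    intro U W
    rw [swapVars, evalX, evalX, eval_rename]
    congr 2
    ext (x | x) <;> rfl
  intro A U W
  rw [hev, hev, Matrix.transpose_mul, Matrix.transpose_mul]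
  refine hf.evalX_mul ?_ ?_ _ _
  · rw [Matrix.det_transpose, Matrix.SpecialLinearGroup.det_coe]
  · rw [← Matrix.transpose_mul, ← Matrix.SpecialLinearGroup.coe_mul, mul_inv_cancel]
    simp

theorem SMB.IsSLInvariant.isStandardExp_of_max [Infinite K] {f : KX K n m q} (hf : IsSLInvariant f)
    {e : (Fin m × Fin n) ⊕ (Fin n × Fin q) →₀ ℕ} (he : e ∈ f.support)
    (hmax : ∀ e₁ ∈ f.support, expKey e₁ ≤ expKey e) : IsStandardExp e := by
  classical
  refine ⟨?_, ?_, hf.torus he⟩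
  · intro i i' hi k hk
    have hne : i ≠ i' := by rintro rfl; omega
    have := column_ballot hne (fun t => hf.elemSubst_eq hne t) he ?_ ?_ ⟨k, hk⟩
    · exact (rowSum_Iic (uMat e) i' ⟨k, hk⟩).trans_le
          (this.trans_eq (rowSum_Iio (uMat e) i ⟨k, hk⟩).symm)
    · intro e₁ he₁ h1 h2 h3 h4
      have hl : rowSum (uMat e₁) i m ≤ rowSum (uMat e) i m :=
        apply_le_of_lex_le (hmax e₁ he₁) (i := Sum.inlₗ i) (by
          intro v
          induction v using Sum.rec with
          | inl j =>
            intro hj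
            have hj : j < i := Sum.Lex.inl_lt_inl_iff.1 hj
            have hji' : j ≠ i' := by
              rintro rfl
              rw [Fin.lt_def] at hj; omega
            show rowSum (uMat e₁) j m = rowSum (uMat e) j m
            rw [rowSum_eq_sum, rowSum_eq_sum]
            exact Finset.sum_congr rfl fun a _ => h3 a j hj.ne hji'
          | inr v => intro hj; exact absurd hj Sum.Lex.not_inr_lt_inl)
      have t1 := hf.torus he i i'
      have t2 := hf.torus he₁ i i'
      have s1 : rowSum (uMat e₁) i m + rowSum (uMat e₁) i' m =
          rowSum (uMat e) i m + rowSum (uMat e) i' m := by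
        simp only [rowSum_eq_sum, ← Finset.sum_add_distrib]
        exact Finset.sum_congr rfl fun a _ => h4 a
      have s2 : rowSum (wMat e₁) i q + rowSum (wMat e₁) i' q =
          rowSum (wMat e) i q + rowSum (wMat e) i' q := by
        simp only [rowSum_eq_sum, ← Finset.sum_add_distrib]
        exact Finset.sum_congr rfl fun a _ => h2 a
      have : rowSum (wMat e₁) i q ≤ rowSum (wMat e) i q := by omega
      rw [rowSum_eq_sum, rowSum_eq_sum] at this; exact this
    · intro e₁ he₁ h2 h3 h4 a ha
      have t1 := hf.torus he i i'
      have t2 := hf.torus he₁ i i'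
      have s1 : rowSum (uMat e₁) i m + rowSum (uMat e₁) i' m =
          rowSum (uMat e) i m + rowSum (uMat e) i' m := by
        simp only [rowSum_eq_sum, ← Finset.sum_add_distrib]
        exact Finset.sum_congr rfl fun a _ => h4 a
      have s2 : wMat e₁ = wMat e := by ext i b; exact h2 (i, b)
      rw [s2] at t2
      refine apply_le_of_lex_le (hmax e₁ he₁) (i := Sum.inrₗ (Sum.inlₗ (toLex (i, a)))) ?_
      intro v
      induction v using Sum.rec with
      | inl j =>
        intro _
        show rowSum (uMat e₁) j m = rowSum (uMat e) j m
        by_cases hj : j = i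
        · subst hj; omega
        by_cases hj' : j = i'
        · subst hj'; omega
        rw [rowSum_eq_sum, rowSum_eq_sum]
        exact Finset.sum_congr rfl fun a _ => h3 a j hj hj'
      | inr v =>
        induction v using Sum.rec with
        | inl x =>
          intro hx
          have hx := Sum.Lex.inl_lt_inl_iff.1 (Sum.Lex.inr_lt_inr_iff.1 hx)
          rw [Prod.Lex.lt_iff] at hx
          show e₁ (Sum.inl ((ofLex x).2, (ofLex x).1)) = e (Sum.inl ((ofLex x).2, (ofLex x).1))
          rcases hx with hx | ⟨hx, hx'⟩
          · have hx : (ofLex x).1 < i := hx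
            refine h3 _ _ hx.ne ?_
            intro h; rw [h, Fin.lt_def] at hx; omega
          · have hx : (ofLex x).1 = i := hx
            rw [hx]; exact ha _ hx'
        | inr x =>
          intro hx
          exact absurd (Sum.Lex.inr_lt_inr_iff.1 hx) Sum.Lex.not_inr_lt_inl
  · intro i i' hi k hk
    have hne : i ≠ i' := by rintro rfl; omega
    set sw : (Fin m × Fin n) ⊕ (Fin n × Fin q) → (Fin q × Fin n) ⊕ (Fin n × Fin m) :=
      Sum.elim (fun p => Sum.inr p.swap) (fun p => Sum.inl p.swap) with hsw
    have hinl : ∀ (e₁ : (Fin m × Fin n) ⊕ (Fin n × Fin q) →₀ ℕ) b j,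
        e₁.mapDomain sw (Sum.inl (b, j)) = e₁ (Sum.inr (j, b)) := fun e₁ b j =>
      Finsupp.mapDomain_apply swapVars_injective_vars e₁ (Sum.inr (j, b))
    have hinr : ∀ (e₁ : (Fin m × Fin n) ⊕ (Fin n × Fin q) →₀ ℕ) a j,
        e₁.mapDomain sw (Sum.inr (j, a)) = e₁ (Sum.inl (a, j)) := fun e₁ a j =>
      Finsupp.mapDomain_apply swapVars_injective_vars e₁ (Sum.inl (a, j))
    have hsupp : (swapVars f).support = f.support.image (Finsupp.mapDomain sw) :=
      support_rename_of_injective swapVars_injective_vars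
    have := column_ballot (e := e.mapDomain sw) hne (fun t => hf.swap.elemSubst_eq hne t)
      (by rw [hsupp]; exact Finset.mem_image_of_mem _ he) ?_ ?_ ⟨k, hk⟩
    · simp only [hinl] at this
      exact (rowSum_Iic (wMat e) i' ⟨k, hk⟩).trans_le
        (this.trans_eq (rowSum_Iio (wMat e) i ⟨k, hk⟩).symm)
    · intro e₁ he₁ h1 h2 h3 h4
      rw [hsupp, Finset.mem_image] at he₁
      obtain ⟨e₁, he₁, rfl⟩ := he₁
      simp only [hinr, hinl] at h1 h2 h3 h4 ⊢
      have hl : rowSum (uMat e₁) i m ≤ rowSum (uMat e) i m :=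
        apply_le_of_lex_le (hmax e₁ he₁) (i := Sum.inlₗ i) (by
          intro v
          induction v using Sum.rec with
          | inl j =>
            intro hj
            have hj : j < i := Sum.Lex.inl_lt_inl_iff.1 hj
            have hji' : j ≠ i' := by
              rintro rfl
              rw [Fin.lt_def] at hj; omega
            show rowSum (uMat e₁) j m = rowSum (uMat e) j m
            rw [rowSum_eq_sum, rowSum_eq_sum]
            exact Finset.sum_congr rfl fun a _ => h1 j a hj.ne hji'
          | inr v => intro hj; exact absurd hj Sum.Lex.not_inr_lt_inl)
      rw [rowSum_eq_sum, rowSum_eq_sum] at hl; exact hl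
    · intro e₁ he₁ h2 h3 h4 a ha
      rw [hsupp, Finset.mem_image] at he₁
      obtain ⟨e₁, he₁, rfl⟩ := he₁
      have h2 : ∀ a j, e₁ (Sum.inl (a, j)) = e (Sum.inl (a, j)) := fun a j => by
        rw [← hinr, ← hinr, h2]
      simp only [hinl] at h3 h4 ha ⊢
      have s2 : uMat e₁ = uMat e := by ext i a; exact h2 a i
      refine apply_le_of_lex_le (hmax e₁ he₁) (i := Sum.inrₗ (Sum.inrₗ (toLex (i, a)))) ?_
      intro v
      induction v using Sum.rec with
      | inl j =>
        intro _
        show rowSum (uMat e₁) j m = rowSum (uMat e) j m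
        rw [s2]
      | inr v =>
        induction v using Sum.rec with
        | inl x => intro _; exact h2 _ _
        | inr x =>
          intro hx
          have hx := Sum.Lex.inr_lt_inr_iff.1 (Sum.Lex.inr_lt_inr_iff.1 hx)
          rw [Prod.Lex.lt_iff] at hx
          show e₁ (Sum.inr ((ofLex x).1, (ofLex x).2)) = e (Sum.inr ((ofLex x).1, (ofLex x).2))
          rcases hx with hx | ⟨hx, hx'⟩
          · have hx : (ofLex x).1 < i := hx
            refine h3 _ _ hx.ne ?_
            intro h; rw [h, Fin.lt_def] at hx; omega
          · have hx : (ofLex x).1 = i := hx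
            rw [hx]; exact ha _ hx'

end LeadingExponents

section TableauCells

open MvPolynomial SMB

theorem Led.sum_monomial {σ A ι : Type*} [CommSemiring A] {r : (σ →₀ ℕ) → (σ →₀ ℕ) → Prop}
    (s : Finset ι) (c : ι → A) (E : ι → σ →₀ ℕ) {x₀ : ι} (hx₀ : x₀ ∈ s) (hc : c x₀ = 1)
    (hinj : ∀ x ∈ s, E x = E x₀ → x = x₀) (hr : ∀ x ∈ s, r (E x) (E x₀)) :
    Led r (E x₀) (∑ x ∈ s, monomial (E x) (c x)) := by
  classical
  constructor
  · rw [coeff_sum, Finset.sum_eq_single x₀]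
    · simp [hc]
    · intro x hx hne
      rw [coeff_monomial, if_neg fun h => hne (hinj x hx h)]
    · exact fun h => absurd hx₀ h
  · intro e he
    rw [coeff_sum] at he
    obtain ⟨x, hx, hxe⟩ := Finset.exists_ne_zero_of_sum_ne_zero he
    rw [coeff_monomial] at hxe
    have : E x = e := by by_contra h; simp [h] at hxe
    exact this ▸ hr x hx

variable {n N m q s : ℕ}

/-- The number of indices mapped to a given cell. -/
def cellCount (τ : Fin s → Fin n) (C : Fin s → Fin N) (i : Fin n) (a : Fin N) : ℕ :=
  ∑ j, if τ j = i ∧ C j = a then 1 else 0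

theorem cornerSum_cellCount (τ : Fin s → Fin n) (C : Fin s → Fin N) (k l : ℕ) :
    cornerSum (cellCount τ C) k l =
      (Finset.univ.filter fun j => (τ j).val < l ∧ (C j).val < k).card := by
  rw [Finset.card_filter]
  have h1 : ∀ i, rowSum (cellCount τ C) i k = ∑ j, if τ j = i ∧ (C j).val < k then 1 else 0 := by
    intro i
    simp only [rowSum, cellCount]
    have : ∀ a : Fin N, (if a.val < k then ∑ j, (if τ j = i ∧ C j = a then 1 else 0) else 0) =
        ∑ j, if C j = a then (if τ j = i ∧ (C j).val < k then 1 else 0) else 0 := by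
      intro a
      split_ifs with ha
      · refine Finset.sum_congr rfl fun j _ => ?_
        by_cases hj : C j = a <;> simp [hj, ha]
      · refine (Finset.sum_eq_zero fun j _ => ?_).symm
        by_cases hj : C j = a <;> simp [hj, ha]
    rw [Finset.sum_congr rfl fun a _ => this a, Finset.sum_comm]
    simp
  simp only [cornerSum, h1]
  have : ∀ i : Fin n, (if i.val < l then ∑ j, (if τ j = i ∧ (C j).val < k then 1 else 0) else 0) =
      ∑ j, if τ j = i then (if (τ j).val < l ∧ (C j).val < k then 1 else 0) else 0 := by
    intro i
    split_ifs with ha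
    · refine Finset.sum_congr rfl fun j _ => ?_
      by_cases hj : τ j = i <;> simp [hj, ha]
    · refine (Finset.sum_eq_zero fun j _ => ?_).symm
      by_cases hj : τ j = i <;> simp [hj, ha]
  rw [Finset.sum_congr rfl fun a _ => this a, Finset.sum_comm]
  simp

theorem matDom_cellCount (hs : s ≤ n) {A : Fin s → Fin N} (hA : StrictMono A)
    {τ : Fin s → Fin n} (hτ : Function.Injective τ) (σ : Equiv.Perm (Fin s)) :
    MatDom (cellCount τ (A ∘ σ)) (cellCount (Fin.castLE hs) A) := by
  have hperm : ∀ k : ℕ, (Finset.univ.filter fun j => ((A ∘ σ) j).val < k).card =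
      (Finset.univ.filter fun j => (A j).val < k).card := by
    intro k
    refine Finset.card_bij (fun j _ => σ j) ?_ (fun _ _ _ _ h => σ.injective h) ?_
    · intro j hj; simpa using hj
    · intro j hj; exact ⟨σ.symm j, by simpa using hj, by simp⟩
  intro k
  simp only [cornerSum_cellCount]
  constructor
  · simpa [fun j : Fin s => j.2.trans_le hs] using hperm k
  · intro l
    by_cases h : ∀ j : Fin s, j.val < l → (A j).val < k
    · have h1 : (Finset.univ.filter fun j : Fin s => (Fin.castLE hs j).val < l ∧ (A j).val < k) =
          Finset.univ.filter fun j : Fin s => j.val < l := by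
        ext j; simpa using h j
      rw [h1]
      have h2 : (Finset.univ.filter fun j : Fin s => j.val < l).card = min s l :=
        Fin.card_filter_val_lt
      rw [h2, le_min_iff]
      constructor
      · exact (Finset.card_le_univ _).trans_eq (Fintype.card_fin s)
      · refine (Finset.card_le_card_of_injOn (t := Finset.range l)
            (fun j => (τ j).val) ?_ ?_).trans_eq
          (Finset.card_range l)
        · intro j hj; simp at hj ⊢; exact hj.1
        · intro j _ j' _ h; exact hτ (Fin.ext h)
    · push Not at h
      obtain ⟨j₀, h1, h2⟩ := h
      have h3 : (Finset.univ.filter fun j : Fin s => (Fin.castLE hs j).val < l ∧ (A j).val < k) =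
          Finset.univ.filter fun j : Fin s => (A j).val < k := by
        ext j
        simp only [Finset.mem_filter, Finset.mem_univ, true_and, Fin.val_castLE,
            and_iff_right_iff_imp]
        intro hj
        have : A j < A j₀ := Fin.lt_def.2 (by omega)
        have := Fin.lt_def.1 (hA.lt_iff_lt.1 this)
        omega
      rw [h3, ← hperm]
      exact Finset.card_le_card fun j => by simp

theorem eq_of_cellCount_eq {A : Fin s → Fin N} (hA : Function.Injective A) {τ ι : Fin s → Fin n}
    {σ : Fin s → Fin s} (h : cellCount τ (A ∘ σ) = cellCount ι A) (j : Fin s) : τ j = ι (σ j) := by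
  have h1 : cellCount ι A (τ j) (A (σ j)) ≠ 0 := by
    rw [← h, cellCount]
    intro h0
    have := (Finset.sum_eq_zero_iff.1 h0) j (Finset.mem_univ _)
    simp at this
  obtain ⟨j', -, hj'⟩ := Finset.exists_ne_zero_of_sum_ne_zero h1
  have h2 : ι j' = τ j ∧ A j' = A (σ j) := by by_contra h; simp [h] at hj'
  rw [← h2.1, hA h2.2]

theorem exists_initial_of_succ_le {f : Fin n → ℕ} (h1 : ∀ i, f i ≤ 1)
    (h : ∀ i i' : Fin n, i'.val = i.val + 1 → f i' ≤ f i) :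
    ∃ s, s ≤ n ∧ ∀ i : Fin n, f i = if i.val < s then 1 else 0 := by
  classical
  have hanti : ∀ d (i i' : Fin n), i'.val = i.val + d → f i' ≤ f i := by
    intro d
    induction d with
    | zero => intro i i' hi; exact (congrArg f (Fin.ext hi)).le
    | succ d ih =>
      intro i i' hi
      exact (h ⟨i + d, by omega⟩ i' (by simp only; omega)).trans (ih i _ rfl)
  by_cases hz : ∃ i : ℕ, ∃ hi : i < n, f ⟨i, hi⟩ = 0
  · refine ⟨Nat.find hz, (Nat.find_spec hz).1.le, fun i => ?_⟩
    split_ifs with hi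
    · have := Nat.find_min hz hi
      push Not at this
      have := this i.2
      have := h1 i
      simp only [Fin.eta] at *; omega
    · obtain ⟨h2, h3⟩ := Nat.find_spec hz
      have := hanti (i - Nat.find hz) ⟨Nat.find hz, h2⟩ i (by simp only; omega)
      omega
  · push Not at hz
    refine ⟨n, le_rfl, fun i => ?_⟩
    rw [if_pos i.2]
    have := hz i i.2
    have := h1 i
    simp only [Fin.eta] at *; omega

theorem rowSum_mono (x : Fin n → Fin N → ℕ) (i : Fin n) : Monotone (rowSum x i) := by
  intro k k' h
  refine Finset.sum_le_sum fun a _ => ?_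
  split_ifs <;> omega

theorem IsSemistandard.exists_cellCount {x : Fin n → Fin N → ℕ} (hx : IsSemistandard x)
    (h1 : ∀ i, rowSum x i N ≤ 1) : ∃ (s : ℕ) (hs : s ≤ n) (A : Fin s → Fin N), StrictMono A ∧
      x = cellCount (Fin.castLE hs) A ∧ ∀ i, rowSum x i N = if i.val < s then 1 else 0 := by
  classical
  obtain ⟨s, hs, h⟩ := exists_initial_of_succ_le h1 (fun i i' hi => by
    rcases N with _ | N
    · simp [rowSum]
    · exact (hx i i' hi N (by omega)).trans (rowSum_mono x i (by omega)))
  have hex : ∀ j : Fin s, ∃ a, ∀ b, x (Fin.castLE hs j) b = if b = a then 1 else 0 := by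
    intro j
    have hsum := h (Fin.castLE hs j)
    rw [if_pos (by simp), rowSum_eq_sum] at hsum
    obtain ⟨a, -, ha⟩ := Finset.exists_ne_zero_of_sum_ne_zero (hsum.trans_ne one_ne_zero)
    refine ⟨a, fun b => ?_⟩
    rw [← Finset.add_sum_erase _ _ (Finset.mem_univ a)] at hsum
    split_ifs with hb
    · subst hb; omega
    · have h0 : ∑ b ∈ Finset.univ.erase a, x (Fin.castLE hs j) b = 0 := by omega
      exact Finset.sum_eq_zero_iff.1 h0 b (by simp [hb])
  choose A hA using hex
  have hrow : ∀ j k, rowSum x (Fin.castLE hs j) k = if (A j).val < k then 1 else 0 := by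
    intro j k
    simp only [rowSum, hA]
    rw [Finset.sum_eq_single (A j)]
    · simp
    · intro b _ hb; simp [hb]
    · simp
  refine ⟨s, hs, A, ?_, ?_, h⟩
  · rcases s with _ | s
    · exact fun i => i.elim0
    · refine Fin.strictMono_iff_lt_succ.2 fun j => ?_
      have := hx (Fin.castLE hs j.castSucc) (Fin.castLE hs j.succ) (by simp)
        (A j.succ) (A j.succ).2
      rw [hrow, hrow, if_pos (by omega)] at this
      rw [Fin.lt_def]
      by_contra hc
      rw [if_neg hc] at this
      omega
  · ext i a
    rw [cellCount]
    by_cases hi : i.val < s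
    · have : i = Fin.castLE hs ⟨i, hi⟩ := rfl
      rw [this, hA, Finset.sum_eq_single (⟨i, hi⟩ : Fin s)]
      · simp [eq_comm]
      · intro j _ hj
        rw [if_neg]
        rintro ⟨h2, -⟩
        exact hj (Fin.ext congr(Fin.val $h2))
      · simp
    · have h0 := h i
      rw [if_neg hi, rowSum_eq_sum] at h0
      rw [Finset.sum_eq_zero_iff.1 h0 a (Finset.mem_univ _)]
      refine (Finset.sum_eq_zero fun j _ => ?_).symm
      rw [if_neg]
      rintro ⟨rfl, -⟩
      simp at hi

end TableauCells

section Minors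

open MvPolynomial SMB

variable {K : Type} [Field K] {n m q s t : ℕ}

/-- The exponent of a product of entries of the two generic matrices. -/
noncomputable def cellExp (C : Fin s → Fin m) (τ : Fin s → Fin n) (τ' : Fin t → Fin n)
    (B : Fin t → Fin q) : (Fin m × Fin n) ⊕ (Fin n × Fin q) →₀ ℕ :=
  ∑ j, Finsupp.single (Sum.inl (C j, τ j)) 1 + ∑ j, Finsupp.single (Sum.inr (τ' j, B j)) 1

theorem uMat_cellExp (C : Fin s → Fin m) (τ : Fin s → Fin n) (τ' : Fin t → Fin n)
    (B : Fin t → Fin q) : uMat (cellExp C τ τ' B) = cellCount τ C := by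
  classical
  ext i a
  simp [uMat, cellExp, cellCount, Finsupp.single_apply, and_comm]

theorem wMat_cellExp (C : Fin s → Fin m) (τ : Fin s → Fin n) (τ' : Fin t → Fin n)
    (B : Fin t → Fin q) : wMat (cellExp C τ τ' B) = cellCount τ' B := by
  classical
  ext i a
  simp [wMat, cellExp, cellCount, Finsupp.single_apply]

theorem monomial_cellExp (C : Fin s → Fin m) (τ : Fin s → Fin n) (τ' : Fin t → Fin n)
    (B : Fin t → Fin q) (c : K) : monomial (cellExp C τ τ' B) c =
      MvPolynomial.C c * ((∏ j, Ugen K n m q (C j) (τ j)) * ∏ j, Wgen K n m q (τ' j) (B j)) := by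
  rw [← mul_one c, ← C_mul_monomial, mul_one, cellExp, ← one_mul (1 : K),
    ← monomial_mul, monomial_sum_one,
    monomial_sum_one]
  rfl

theorem led_det_mul (hs : s ≤ n) {A : Fin s → Fin m} {B : Fin s → Fin q} (hA : StrictMono A)
    (hB : StrictMono B) : Led ExpDom (cellExp A (Fin.castLE hs) (Fin.castLE hs) B)
      ((Ugen K n m q * Wgen K n m q).submatrix A B).det := by
  classical
  have hdet : ((Ugen K n m q * Wgen K n m q).submatrix A B).det =
      ∑ x ∈ (Finset.univ : Finset (Equiv.Perm (Fin s))) ×ˢ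
        (Finset.univ.filter fun τ : Fin s → Fin n => Function.Injective τ),
        monomial (cellExp (A ∘ x.1) x.2 x.2 B) (((Equiv.Perm.sign x.1 : ℤˣ) : ℤ) : K) := by
    rw [Matrix.det_apply', Finset.sum_product_right, Finset.sum_filter]
    simp only [Matrix.submatrix_apply, Matrix.mul_apply, Finset.prod_univ_sum,
      Fintype.piFinset_univ, Finset.mul_sum]
    rw [Finset.sum_comm]
    refine Finset.sum_congr rfl fun τ _ => ?_
    have h1 : ∑ σ : Equiv.Perm (Fin s), (((Equiv.Perm.sign σ : ℤˣ) : ℤ) : KX K n m q) *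
        ∏ j, (Ugen K n m q (A (σ j)) (τ j) * Wgen K n m q (τ j) (B j)) =
        ((Ugen K n m q).submatrix A τ).det * ∏ j, Wgen K n m q (τ j) (B j) := by
      rw [Matrix.det_apply', Finset.sum_mul]
      refine Finset.sum_congr rfl fun σ _ => ?_
      rw [Finset.prod_mul_distrib, mul_assoc]
      rfl
    split_ifs with hτ
    · refine Finset.sum_congr rfl fun σ _ => ?_
      rw [monomial_cellExp, Finset.prod_mul_distrib]
      simp
    · rw [h1]
      have : ∃ i j, τ i = τ j ∧ i ≠ j := by
        rw [Function.Injective] at hτ; push Not at hτ; exact hτ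
      obtain ⟨i, j, hij, hne⟩ := this
      rw [Matrix.det_zero_of_column_eq hne (fun k => by simp [hij]), zero_mul]
  rw [hdet]
  have key := Led.sum_monomial (r := ExpDom (n := n) (m := m) (q := q)) (A := K)
    ((Finset.univ : Finset (Equiv.Perm (Fin s))) ×ˢ
        (Finset.univ.filter fun τ : Fin s → Fin n => Function.Injective τ))
    (fun x => (((Equiv.Perm.sign x.1 : ℤˣ) : ℤ) : K))
    (fun x => cellExp (A ∘ x.1) x.2 x.2 B) (x₀ := (1, Fin.castLE hs))
    (by simpa using Fin.castLE_injective hs) (by simp) ?_ ?_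
  · simpa using key
  · rintro ⟨σ, τ⟩ hx h
    have hu := congrArg uMat h
    have hw := congrArg wMat h
    simp only [uMat_cellExp, wMat_cellExp, Equiv.Perm.coe_one, Function.comp_id] at hu hw
    have h1 : τ = Fin.castLE hs := funext fun j => eq_of_cellCount_eq (σ := id) hB.injective hw j
    subst h1
    have h2 : σ = 1 := by
      ext j
      have := eq_of_cellCount_eq hA.injective hu j
      exact (congr(Fin.val $this)).symm
    rw [h2]
  · rintro ⟨σ, τ⟩ hx
    have hτ : Function.Injective τ := by simpa using hx
    constructor
    · simp only [uMat_cellExp, Equiv.Perm.coe_one, Function.comp_id]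
      exact matDom_cellCount hs hA hτ σ
    · simp only [wMat_cellExp]
      exact matDom_cellCount hs hB hτ 1

theorem led_det_left {A : Fin n → Fin m} (hA : StrictMono A) (B : Fin 0 → Fin q) :
    Led ExpDom (cellExp A id Fin.elim0 B) ((Ugen K n m q).submatrix A id).det := by
  classical
  have hdet : ((Ugen K n m q).submatrix A id).det = ∑ σ : Equiv.Perm (Fin n),
      monomial (cellExp (A ∘ σ) id Fin.elim0 B) (((Equiv.Perm.sign σ : ℤˣ) : ℤ) : K) := by
    rw [Matrix.det_apply']
    refine Finset.sum_congr rfl fun σ _ => ?_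
    rw [monomial_cellExp]
    simp
  rw [hdet]
  have key := Led.sum_monomial (r := ExpDom (n := n) (m := m) (q := q)) (A := K) Finset.univ
    (fun σ : Equiv.Perm (Fin n) => (((Equiv.Perm.sign σ : ℤˣ) : ℤ) : K))
    (fun σ => cellExp (A ∘ σ) id Fin.elim0 B) (x₀ := 1) (by simp) (by simp) ?_ ?_
  · simpa using key
  · intro σ _ h
    have hu := congrArg uMat h
    simp only [uMat_cellExp, Equiv.Perm.coe_one, Function.comp_id] at hu
    ext j
    exact (congr(Fin.val $(eq_of_cellCount_eq hA.injective hu j))).symm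
  · intro σ _
    constructor
    · simp only [uMat_cellExp, Equiv.Perm.coe_one, Function.comp_id]
      exact matDom_cellCount le_rfl hA Function.injective_id σ
    · simp only [wMat_cellExp]
      exact fun _ => ⟨rfl, fun _ => le_rfl⟩

theorem led_det_right (A : Fin 0 → Fin m) {B : Fin n → Fin q} (hB : StrictMono B) :
    Led ExpDom (cellExp A Fin.elim0 id B) ((Wgen K n m q).submatrix id B).det := by
  classical
  have hdet : ((Wgen K n m q).submatrix id B).det = ∑ σ : Equiv.Perm (Fin n),
      monomial (cellExp A Fin.elim0 σ B) (((Equiv.Perm.sign σ : ℤˣ) : ℤ) : K) := by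
    rw [Matrix.det_apply']
    refine Finset.sum_congr rfl fun σ _ => ?_
    rw [monomial_cellExp]
    simp
  rw [hdet]
  have key := Led.sum_monomial (r := ExpDom (n := n) (m := m) (q := q)) (A := K) Finset.univ
    (fun σ : Equiv.Perm (Fin n) => (((Equiv.Perm.sign σ : ℤˣ) : ℤ) : K))
    (fun σ => cellExp A Fin.elim0 σ B) (x₀ := 1) (by simp) (by simp) ?_ ?_
  · simpa using key
  · intro σ _ h
    have hw := congrArg wMat h
    simp only [wMat_cellExp, Equiv.Perm.coe_one] at hw
    ext j
    exact congr(Fin.val $(eq_of_cellCount_eq (σ := id) hB.injective hw j))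
  · intro σ _
    constructor
    · simp only [uMat_cellExp]
      exact fun _ => ⟨rfl, fun _ => le_rfl⟩
    · simp only [wMat_cellExp, Equiv.Perm.coe_one]
      exact matDom_cellCount le_rfl hB σ.injective 1

theorem evalX_Ugen (U : Matrix (Fin m) (Fin n) K) (W : Matrix (Fin n) (Fin q) K) :
    (Ugen K n m q).map (evalX K n m q U W) = U := by
  ext; simp [Ugen, evalX]

theorem evalX_Wgen (U : Matrix (Fin m) (Fin n) K) (W : Matrix (Fin n) (Fin q) K) :
    (Wgen K n m q).map (evalX K n m q U W) = W := by
  ext; simp [Wgen, evalX]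

theorem SMB.isSLInvariant_det_mul (A : Fin s → Fin m) (B : Fin s → Fin q) :
    IsSLInvariant ((Ugen K n m q * Wgen K n m q).submatrix A B).det := by
  have h : ∀ U W, evalX K n m q U W ((Ugen K n m q * Wgen K n m q).submatrix A B).det =
      ((U * W).submatrix A B).det := by
    intro U W
    rw [RingHom.map_det, RingHom.mapMatrix_apply, ← Matrix.submatrix_map, Matrix.map_mul,
      evalX_Ugen,
      evalX_Wgen]
  intro M U W
  rw [h, h, Matrix.mul_assoc, ← Matrix.mul_assoc (M : Matrix (Fin n) (Fin n) K),
    ← Matrix.SpecialLinearGroup.coe_mul, mul_inv_cancel, Matrix.SpecialLinearGroup.coe_one,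
    Matrix.one_mul]

theorem SMB.isSLInvariant_det_left (A : Fin n → Fin m) :
    IsSLInvariant ((Ugen K n m q).submatrix A id).det := by
  have h : ∀ U W, evalX K n m q U W ((Ugen K n m q).submatrix A id).det =
      (U.submatrix A id).det := by
    intro U W
    rw [RingHom.map_det, RingHom.mapMatrix_apply, ← Matrix.submatrix_map, evalX_Ugen]
  intro M U W
  rw [h, h, ← Matrix.submatrix_mul_equiv U _ A (Equiv.refl _) id, Matrix.det_mul]
  simp

theorem SMB.isSLInvariant_det_right (B : Fin n → Fin q) :
    IsSLInvariant ((Wgen K n m q).submatrix id B).det := by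
  have h : ∀ U W, evalX K n m q U W ((Wgen K n m q).submatrix id B).det =
      (W.submatrix id B).det := by
    intro U W
    rw [RingHom.map_det, RingHom.mapMatrix_apply, ← Matrix.submatrix_map, evalX_Wgen]
  intro M U W
  rw [h, h, ← Matrix.submatrix_mul_equiv _ W id (Equiv.refl _) B, Matrix.det_mul]
  simp [-Matrix.SpecialLinearGroup.coe_inv]

theorem IsStandardExp.exists_led_of_le_one {e : (Fin m × Fin n) ⊕ (Fin n × Fin q) →₀ ℕ}
    (he : IsStandardExp e) (hu : ∀ i, rowSum (uMat e) i m ≤ 1)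
    (hw : ∀ i, rowSum (wMat e) i q ≤ 1) :
    ∃ g : KX K n m q, IsSLInvariant g ∧ Led ExpDom e g := by
  obtain ⟨s, hs, A, hA, heA, hsA⟩ := he.left.exists_cellCount hu
  obtain ⟨t, ht, B, hB, heB, htB⟩ := he.right.exists_cellCount hw
  have heq : e = cellExp A (Fin.castLE hs) (Fin.castLE ht) B :=
    exp_ext (by rw [uMat_cellExp, heA]) (by rw [wMat_cellExp, heB])
  have htor := he.torus
  simp only [hsA, htB] at htor
  rcases lt_trichotomy s t with h | rfl | h
  · have h1 := htor ⟨s, by omega⟩ ⟨0, by omega⟩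
    have h2 := htor ⟨s, by omega⟩ ⟨n - 1, by omega⟩
    have hs0 : s = 0 := by
      simp only [h, lt_irrefl, if_true, if_false] at h1
      split_ifs at h1 <;> omega
    have htn : t = n := by
      simp only [h, lt_irrefl, if_true, if_false] at h2
      split_ifs at h2 <;> omega
    subst hs0 htn
    refine ⟨_, isSLInvariant_det_right B, ?_⟩
    convert led_det_right A hB
    rw [heq]
    congr 1
    exact funext fun j => j.elim0
  · exact ⟨_, isSLInvariant_det_mul A B, heq ▸ led_det_mul hs hA hB⟩
  · have h1 := htor ⟨t, by omega⟩ ⟨0, by omega⟩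
    have h2 := htor ⟨t, by omega⟩ ⟨n - 1, by omega⟩
    have ht0 : t = 0 := by
      simp only [h, lt_irrefl, if_true, if_false] at h1
      split_ifs at h1 <;> omega
    have hsn : s = n := by
      simp only [h, lt_irrefl, if_true, if_false] at h2
      split_ifs at h2 <;> omega
    subst ht0 hsn
    refine ⟨_, isSLInvariant_det_left A, ?_⟩
    convert led_det_left hA B
    rw [heq]
    congr 1
    exact funext fun j => j.elim0

end Minors

section StandardBasis

open MvPolynomial SMB

variable {K : Type} [Field K] {n m q : ℕ}

theorem linearIndependent_of_led {ι : Type*} {p : ι → (Fin m × Fin n) ⊕ (Fin n × Fin q) →₀ ℕ}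
    (hp : Function.Injective p) {g : ι → KX K n m q} (hg : ∀ i, Led ExpDom (p i) (g i)) :
    LinearIndependent K g := by
  classical
  rw [linearIndependent_iff']
  intro s a hsum
  by_contra! hne
  obtain ⟨i₀, hi₀, ha₀⟩ := hne
  obtain ⟨i, hi, hmax⟩ := (s.filter fun i => a i ≠ 0).exists_max_image (fun i => expKey (p i))
    ⟨i₀, by simp [hi₀, ha₀]⟩
  rw [Finset.mem_filter] at hi
  have hc := congr(coeff (p i) $hsum)
  rw [coeff_sum, Finset.sum_eq_single i] at hc
  · rw [coeff_smul, (hg i).1, smul_eq_mul, mul_one] at hc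
    exact hi.2 (by simpa using hc)
  · intro j hj hji
    by_contra hc
    rw [coeff_smul, smul_eq_mul] at hc
    have h1 := expKey_le_of_expDom ((hg j).2 _ (right_ne_zero_of_mul hc))
    have h2 := hmax j (Finset.mem_filter.2 ⟨hj, left_ne_zero_of_mul hc⟩)
    exact hji (hp (expKey_injective (le_antisymm h2 h1)))
  · exact fun h => absurd hi.1 h

theorem mem_span_of_support [Infinite K]
    {b : ((Fin m × Fin n) ⊕ (Fin n × Fin q) →₀ ℕ) → slInvariants K n m q}
    (hb : ∀ e, IsStandardExp e → Led ExpDom e (b e : KX K n m q))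
    {Q : ((Fin m × Fin n) ⊕ (Fin n × Fin q) →₀ ℕ) → Prop}
    (hQ : ∀ e p, ExpDom e p → Q p → Q e) (r : slInvariants K n m q)
    (hr : ∀ e ∈ (r : KX K n m q).support, Q e) :
    r ∈ Submodule.span K (b '' {e | IsStandardExp e ∧ Q e}) := by
  classical
  suffices ∀ κ, ∀ r : slInvariants K n m q, (∀ e ∈ (r : KX K n m q).support, Q e) →
      (∀ e ∈ (r : KX K n m q).support, expKey e ≤ κ) →
      r ∈ Submodule.span K (b '' {e | IsStandardExp e ∧ Q e}) by
    by_cases h0 : r = 0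
    · rw [h0]; exact zero_mem _
    · obtain ⟨e, he, hmax⟩ := (r : KX K n m q).support.exists_max_image expKey
        (by simpa [Finset.nonempty_iff_ne_empty] using h0)
      exact this _ r hr hmax
  intro κ
  induction κ using WellFoundedLT.induction with
  | ind κ ih =>
    intro r hr hκ
    by_cases h0 : r = 0
    · rw [h0]; exact zero_mem _
    obtain ⟨e, he, hmax⟩ := (r : KX K n m q).support.exists_max_image expKey
      (by simpa [Finset.nonempty_iff_ne_empty] using h0)
    have hst : IsStandardExp e := IsSLInvariant.isStandardExp_of_max r.2 he hmax
    have hbe : b e ∈ Submodule.span K (b '' {e | IsStandardExp e ∧ Q e}) :=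
      Submodule.subset_span ⟨e, ⟨hst, hr e he⟩, rfl⟩
    set r' := r - coeff e (r : KX K n m q) • b e with hr'
    have hsupp : ∀ e' ∈ (r' : KX K n m q).support, Q e' ∧ expKey e' < expKey e := by
      intro e' he'
      have hc : coeff e' (r' : KX K n m q) = coeff e' (r : KX K n m q) -
          coeff e (r : KX K n m q) * coeff e' (b e : KX K n m q) := by
        simp [hr']
      have hne : e' ≠ e := by
        rintro rfl
        rw [mem_support_iff, hc, (hb e' hst).1] at he'
        simp at he'
      have hle : Q e' ∧ expKey e' ≤ expKey e := by
        by_cases h1 : coeff e' (r : KX K n m q) = 0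
        · have h2 : coeff e' (b e : KX K n m q) ≠ 0 := by
            intro h2
            rw [mem_support_iff, hc, h1, h2] at he'
            simp at he'
          have h3 := (hb e hst).2 e' h2
          exact ⟨hQ _ _ h3 (hr e he), expKey_le_of_expDom h3⟩
        · exact ⟨hr e' (mem_support_iff.2 h1), hmax e' (mem_support_iff.2 h1)⟩
      exact ⟨hle.1, lt_of_le_of_ne hle.2 fun h => hne (expKey_injective h)⟩
    have hmem : r' ∈ Submodule.span K (b '' {e | IsStandardExp e ∧ Q e}) := by
      by_cases h1 : r' = 0
      · rw [h1]; exact zero_mem _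
      obtain ⟨e', he', hmax'⟩ := (r' : KX K n m q).support.exists_max_image expKey
        (by simpa [Finset.nonempty_iff_ne_empty] using h1)
      exact ih (expKey e') ((hsupp e' he').2.trans_le (hκ e he)) r' (fun e h => (hsupp e h).1) hmax'
    have : r = r' + coeff e (r : KX K n m q) • b e := by rw [hr']; abel
    rw [this]
    exact add_mem hmem (Submodule.smul_mem _ _ hbe)

end StandardBasis

section Pattern

variable {n N m q : ℕ}

/-- Positions in a pair of Gelfand–Tsetlin triangles glued along a row, with two extra minima. -/
abbrev PatternIndex (n m q : ℕ) :=
  {x : Fin n × Fin (m + 1) // x.1.val < x.2.val} ⊕ {x : Fin n × Fin q // x.1.val < x.2.val} ⊕ Bool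

/-- The interlacing relations between positions. -/
def PatternRel : PatternIndex n m q → PatternIndex n m q → Prop
  | .inl x, .inl y => (x.1.1 = y.1.1 ∧ y.1.2.val = x.1.2.val + 1) ∨
      (x.1.1.val = y.1.1.val + 1 ∧ x.1.2.val = y.1.2.val + 1)
  | .inr (.inl x), .inr (.inl y) => (x.1.1 = y.1.1 ∧ y.1.2.val = x.1.2.val + 1) ∨
      (x.1.1.val = y.1.1.val + 1 ∧ x.1.2.val = y.1.2.val + 1)
  | .inr (.inl x), .inl y => x.1.1 = y.1.1 ∧ x.1.2.val + 1 = q ∧ y.1.2.val = m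
  | .inl x, .inr (.inl y) => x.1.1.val = y.1.1.val + 1 ∧ x.1.2.val = m ∧ y.1.2.val + 1 = q
  | .inr (.inr c), .inl _ => c = false
  | .inr (.inr c), .inr (.inl _) => c = true
  | _, .inr (.inr _) => False

/-- A strictly monotone integer function on positions. -/
def patternHeight : PatternIndex n m q → ℤ
  | .inl x => x.1.2.val - 2 * x.1.1.val - m
  | .inr (.inl x) => x.1.2.val - 2 * x.1.1.val - q
  | .inr (.inr _) => -(m + q + 2 * n + 5)

theorem patternHeight_lt {x y : PatternIndex n m q} (h : PatternRel x y) :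
    patternHeight x < patternHeight y := by
  rcases x with ⟨⟨i, k⟩, hx⟩ | ⟨⟨i, k⟩, hx⟩ | c <;>
  rcases y with ⟨⟨j, l⟩, hy⟩ | ⟨⟨j, l⟩, hy⟩ | d <;>
    simp only [PatternRel, patternHeight, Fin.ext_iff] at * <;> omega

/-- The value of a pattern in the left triangle, extended to all columns. -/
def uVal (f : PatternIndex n m q → ℤ) (i : Fin n) (k : ℕ) : ℤ :=
  if h : i.val < k ∧ k < m + 1 then f (.inl ⟨(i, ⟨k, h.2⟩), h.1⟩) else f (.inr (.inr false))

/-- The value of a pattern in the right triangle, extended to all columns. -/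
def wVal (f : PatternIndex n m q → ℤ) (i : Fin n) (k : ℕ) : ℤ :=
  if h : i.val < k ∧ k < q then f (.inr (.inl ⟨(i, ⟨k, h.2⟩), h.1⟩)) else
    if q ≤ k then uVal f i m else f (.inr (.inr true))

/-- The exponent attached to a pattern. -/
noncomputable def patExp (f : PatternIndex n m q → ℤ) : (Fin m × Fin n) ⊕ (Fin n × Fin q) →₀ ℕ :=
  Finsupp.equivFunOnFinite.symm (Sum.elim
    (fun x => (uVal f x.2 (x.1 + 1) - uVal f x.2 x.1).toNat)
    (fun x => (wVal f x.1 (x.2 + 1) - wVal f x.1 x.2).toNat))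

theorem uMat_patExp (f : PatternIndex n m q → ℤ) (i : Fin n) (a : Fin m) :
    uMat (patExp f) i a = (uVal f i (a + 1) - uVal f i a).toNat := rfl

theorem wMat_patExp (f : PatternIndex n m q → ℤ) (i : Fin n) (a : Fin q) :
    wMat (patExp f) i a = (wVal f i (a + 1) - wVal f i a).toNat := rfl

section Values

variable {f g : PatternIndex n m q → ℤ}

theorem uVal_of_le {i : Fin n} {k : ℕ} (h : k ≤ i.val) : uVal f i k = f (.inr (.inr false)) := by
  rw [uVal, dif_neg (by omega)]

theorem wVal_of_le (hq : n < q) {i : Fin n} {k : ℕ} (h : k ≤ i.val) :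
    wVal f i k = f (.inr (.inr true)) := by
  rw [wVal, dif_neg (by omega), if_neg (by omega)]

theorem wVal_last (f : PatternIndex n m q → ℤ) (i : Fin n) : wVal f i q = uVal f i m := by
  rw [wVal, dif_neg (by omega), if_pos le_rfl]

theorem uVal_coe (x : {x : Fin n × Fin (m + 1) // x.1.val < x.2.val}) :
    uVal f x.1.1 x.1.2 = f (.inl x) := by
  rw [uVal, dif_pos ⟨x.2, x.1.2.2⟩]

theorem wVal_coe (x : {x : Fin n × Fin q // x.1.val < x.2.val}) :
    wVal f x.1.1 x.1.2 = f (.inr (.inl x)) := by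
  rw [wVal, dif_pos ⟨x.2, x.1.2.2⟩]

theorem uVal_add (f g : PatternIndex n m q → ℤ) (i : Fin n) (k : ℕ) :
    uVal (f + g) i k = uVal f i k + uVal g i k := by
  simp only [uVal]; split_ifs <;> rfl

theorem wVal_add (f g : PatternIndex n m q → ℤ) (i : Fin n) (k : ℕ) :
    wVal (f + g) i k = wVal f i k + wVal g i k := by
  simp only [wVal, uVal_add]; split_ifs <;> rfl

theorem uVal_mem_range (f : PatternIndex n m q → ℤ) (i : Fin n) (k : ℕ) :
    ∃ p, uVal f i k = f p := by
  rw [uVal]; split_ifs <;> exact ⟨_, rfl⟩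

theorem wVal_mem_range (f : PatternIndex n m q → ℤ) (i : Fin n) (k : ℕ) :
    ∃ p, wVal f i k = f p := by
  rw [wVal]; split_ifs
  · exact ⟨_, rfl⟩
  · exact uVal_mem_range f i m
  · exact ⟨_, rfl⟩

variable (hf : MonoOn PatternRel f)
include hf

theorem MonoOn.uVal_le_succ {i : Fin n} {k : ℕ} (hk : k < m) :
    uVal f i k ≤ uVal f i (k + 1) := by
  by_cases h : i.val < k
  · rw [uVal, uVal, dif_pos (by omega), dif_pos (by omega)]
    exact hf _ _ (Or.inl ⟨rfl, rfl⟩)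
  · by_cases h' : i.val < k + 1
    · rw [uVal_of_le (by omega), uVal, dif_pos (by omega)]
      exact hf (.inr (.inr false)) (.inl _) rfl
    · rw [uVal_of_le (by omega), uVal_of_le (by omega)]

theorem MonoOn.uVal_diag {i i' : Fin n} (hi : i'.val = i.val + 1) {k : ℕ} (hk : k < m) :
    uVal f i' (k + 1) ≤ uVal f i k := by
  by_cases h : i.val < k
  · rw [uVal, uVal, dif_pos (by omega), dif_pos (by omega)]
    exact hf _ _ (Or.inr ⟨hi, rfl⟩)
  · rw [uVal_of_le (by omega), uVal_of_le (by omega)]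

theorem MonoOn.wVal_le_succ (hm : n < m) (hq : n < q) {i : Fin n} {k : ℕ} (hk : k < q) :
    wVal f i k ≤ wVal f i (k + 1) := by
  by_cases hkq : k + 1 = q
  · subst hkq
    rw [wVal_last, wVal, dif_pos (by omega), uVal, dif_pos (by omega)]
    exact hf (.inr (.inl _)) (.inl _) ⟨rfl, rfl, rfl⟩
  by_cases h : i.val < k
  · rw [wVal, wVal, dif_pos (by omega), dif_pos (by omega)]
    exact hf _ _ (Or.inl ⟨rfl, rfl⟩)
  · by_cases h' : i.val < k + 1
    · rw [wVal_of_le hq (by omega), wVal, dif_pos (by omega)]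
      exact hf (.inr (.inr true)) (.inr (.inl _)) rfl
    · rw [wVal_of_le hq (by omega), wVal_of_le hq (by omega)]

theorem MonoOn.wVal_diag (hm : n < m) (hq : n < q) {i i' : Fin n} (hi : i'.val = i.val + 1) {k : ℕ}
    (hk : k < q) : wVal f i' (k + 1) ≤ wVal f i k := by
  by_cases hkq : k + 1 = q
  · subst hkq
    rw [wVal_last, uVal, dif_pos (by omega), wVal, dif_pos (by omega)]
    exact hf (.inl _) (.inr (.inl _)) ⟨hi, rfl, rfl⟩
  by_cases h : i.val < k
  · rw [wVal, wVal, dif_pos (by omega), dif_pos (by omega)]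
    exact hf _ _ (Or.inr ⟨hi, rfl⟩)
  · rw [wVal_of_le hq (by omega), wVal_of_le hq (by omega)]

end Values

theorem rowSum_of_differences {x : Fin n → Fin N → ℕ} {i : Fin n} {F : ℕ → ℤ}
    (hF : ∀ k < N, F k ≤ F (k + 1)) (hx : ∀ a : Fin N, x i a = (F (a + 1) - F a).toNat)
    {k : ℕ} (hk : k ≤ N) : (rowSum x i k : ℤ) = F k - F 0 := by
  induction k with
  | zero => simp [rowSum_zero_right]
  | succ k ih =>
    have := rowSum_succ x i ⟨k, hk⟩
    rw [hx] at this
    have h1 := hF k hk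
    have h2 := ih (by omega)
    simp only at this
    omega

theorem IsSemistandard.rowSum_eq_zero {x : Fin n → Fin N → ℕ} (hx : IsSemistandard x) {k : ℕ}
    (hkN : k ≤ N) {i : Fin n} (hk : k ≤ i.val) : rowSum x i k = 0 := by
  induction k generalizing i with
  | zero => exact rowSum_zero_right x i
  | succ k ih =>
    have h1 := hx ⟨i.val - 1, by omega⟩ i (by simp only; omega) k (by omega)
    rw [ih (by omega) (by simp only; omega)] at h1
    omega

variable {f g : PatternIndex n m q → ℤ}

theorem MonoOn.rowSum_uMat (hf : MonoOn PatternRel f) (i : Fin n) {k : ℕ} (hk : k ≤ m) :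
    (rowSum (uMat (patExp f)) i k : ℤ) = uVal f i k - f (.inr (.inr false)) := by
  rw [rowSum_of_differences (F := uVal f i) (fun k hk => hf.uVal_le_succ (i := i) hk)
    (uMat_patExp f i) hk, uVal_of_le (k := 0) (by omega)]

theorem MonoOn.rowSum_wMat (hf : MonoOn PatternRel f) (hm : n < m) (hq : n < q) (i : Fin n) {k : ℕ}
    (hk : k ≤ q) :
    (rowSum (wMat (patExp f)) i k : ℤ) = wVal f i k - f (.inr (.inr true)) := by
  rw [rowSum_of_differences (F := wVal f i) (fun k hk => hf.wVal_le_succ hm hq (i := i) hk)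
    (wMat_patExp f i) hk,
    wVal_of_le hq (k := 0) (by omega)]

theorem MonoOn.isStandardExp_patExp (hf : MonoOn PatternRel f) (hm : n < m) (hq : n < q) :
    IsStandardExp (patExp f) where
  left i i' hi k hk := by
    have h1 := hf.rowSum_uMat i' (k := k + 1) hk
    have h2 := hf.rowSum_uMat i (k := k) hk.le
    have h3 := hf.uVal_diag hi hk
    omega
  right i i' hi k hk := by
    have h1 := hf.rowSum_wMat hm hq i' (k := k + 1) hk
    have h2 := hf.rowSum_wMat hm hq i (k := k) hk.le
    have h3 := hf.wVal_diag hm hq hi hk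
    omega
  torus i i' := by
    have h1 := hf.rowSum_uMat i le_rfl
    have h2 := hf.rowSum_uMat i' le_rfl
    have h3 := hf.rowSum_wMat hm hq i le_rfl
    have h4 := hf.rowSum_wMat hm hq i' le_rfl
    rw [wVal_last] at h3 h4
    omega

theorem patExp_add (hf : MonoOn PatternRel f) (hg : MonoOn PatternRel g) (hm : n < m) (hq : n < q) :
    patExp (f + g) = patExp f + patExp g := by
  refine exp_ext ?_ ?_
  · ext i a
    have h1 := hf.uVal_le_succ (i := i) a.2
    have h2 := hg.uVal_le_succ (i := i) a.2
    show uMat (patExp (f + g)) i a = uMat (patExp f) i a + uMat (patExp g) i a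
    simp only [uMat_patExp, uVal_add]
    omega
  · ext i a
    have h1 := hf.wVal_le_succ hm hq (i := i) a.2
    have h2 := hg.wVal_le_succ hm hq (i := i) a.2
    show wMat (patExp (f + g)) i a = wMat (patExp f) i a + wMat (patExp g) i a
    simp only [wMat_patExp, wVal_add]
    omega

theorem uVal_add_const (f : PatternIndex n m q → ℤ) (c : ℤ) (i : Fin n) (k : ℕ) :
    uVal (fun p => f p + c) i k = uVal f i k + c := by
  simp only [uVal]; split_ifs <;> rfl

theorem wVal_add_const (f : PatternIndex n m q → ℤ) (c : ℤ) (i : Fin n) (k : ℕ) :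
    wVal (fun p => f p + c) i k = wVal f i k + c := by
  simp only [wVal, uVal_add_const]; split_ifs <;> rfl

theorem patExp_add_const (f : PatternIndex n m q → ℤ) (c : ℤ) :
    patExp (fun p => f p + c) = patExp f := by
  refine exp_ext ?_ ?_ <;> ext i a <;>
    simp [uMat_patExp, wMat_patExp, uVal_add_const, wVal_add_const]

theorem patExp_const (c : ℤ) : patExp (fun _ : PatternIndex n m q => c) = 0 := by
  refine exp_ext ?_ ?_
  · ext i a
    simp only [uMat_patExp, uVal, dite_eq_ite, ite_self, sub_self]; rfl
  · ext i a
    simp only [wMat_patExp, wVal, uVal, dite_eq_ite, ite_self, sub_self]; rfl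

theorem eq_add_const_of_patExp_eq (hn : 0 < n) (hm : n < m) (hq : n < q)
    (hf : MonoOn PatternRel f) (hg : MonoOn PatternRel g) (h : patExp f = patExp g) :
    f = fun p => g p + (f (.inr (.inr false)) - g (.inr (.inr false))) := by
  have hu : ∀ i, ∀ k ≤ m, uVal f i k - f (.inr (.inr false)) =
      uVal g i k - g (.inr (.inr false)) := fun i k hk => by
    rw [← hf.rowSum_uMat i hk, ← hg.rowSum_uMat i hk, h]
  have hw : ∀ i, ∀ k ≤ q, wVal f i k - f (.inr (.inr true)) =
      wVal g i k - g (.inr (.inr true)) := fun i k hk => by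
    rw [← hf.rowSum_wMat hm hq i hk, ← hg.rowSum_wMat hm hq i hk, h]
  have h1 := hu ⟨0, hn⟩ m le_rfl
  have h2 := hw ⟨0, hn⟩ q le_rfl
  rw [wVal_last, wVal_last] at h2
  ext (x | x | _ | _)
  · have := hu x.1.1 x.1.2 (by omega)
    rw [uVal_coe, uVal_coe] at this
    omega
  · have := hw x.1.1 x.1.2 (by omega)
    rw [wVal_coe, wVal_coe] at this
    omega
  · omega
  · omega

theorem IsStandardExp.exists_patExp_eq (hn : 0 < n) (hq : n < q)
    {e : (Fin m × Fin n) ⊕ (Fin n × Fin q) →₀ ℕ} (he : IsStandardExp e) :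
    ∃ f : PatternIndex n m q → ℤ, MonoOn PatternRel f ∧ patExp f = e := by
  set δ : ℤ := rowSum (uMat e) ⟨0, hn⟩ m - rowSum (wMat e) ⟨0, hn⟩ q with hδ
  set f : PatternIndex n m q → ℤ := Sum.elim (fun x => rowSum (uMat e) x.1.1 x.1.2)
    (Sum.elim (fun x => rowSum (wMat e) x.1.1 x.1.2 + δ) (fun c => if c then δ else 0)) with hf
  have hu : ∀ i, ∀ k ≤ m, uVal f i k = rowSum (uMat e) i k := by
    intro i k hk
    rw [uVal]
    split_ifs with h
    · rfl
    · rw [he.left.rowSum_eq_zero hk (by omega)]; rfl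
  have hw : ∀ i, ∀ k ≤ q, wVal f i k = rowSum (wMat e) i k + δ := by
    intro i k hk
    rw [wVal]
    split_ifs with h h'
    · rfl
    · obtain rfl : k = q := by omega
      have := he.torus i ⟨0, hn⟩
      rw [hu i m le_rfl]
      omega
    · rw [he.right.rowSum_eq_zero hk (by omega)]; simp [hf]
  refine ⟨f, ?_, exp_ext ?_ ?_⟩
  · rintro (⟨⟨i, k⟩, hx⟩ | ⟨⟨i, k⟩, hx⟩ | c) (⟨⟨j, l⟩, hy⟩ | ⟨⟨j, l⟩, hy⟩ | d) h
    · show (rowSum (uMat e) i k : ℤ) ≤ rowSum (uMat e) j l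
      rcases h with ⟨h, h'⟩ | ⟨h, h'⟩ <;> simp only at h h'
      · subst h
        exact_mod_cast rowSum_mono _ _ (by omega)
      · rw [h']
        exact_mod_cast he.left _ _ h _ (by omega)
    · show (rowSum (uMat e) i k : ℤ) ≤ rowSum (wMat e) j l + δ
      obtain ⟨h1, h2, h3⟩ := h
      simp only at h1 h2 h3
      have := he.torus j ⟨0, hn⟩
      have h4 := he.right j i h1 l (by omega)
      have h5 := he.torus i ⟨0, hn⟩
      rw [h3] at h4
      rw [h2]
      omega
    · exact h.elim
    · show (rowSum (wMat e) i k : ℤ) + δ ≤ rowSum (uMat e) j l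
      obtain ⟨h1, h2, h3⟩ := h
      simp only at h1 h2 h3
      subst h1
      have h4 := rowSum_mono (wMat e) i (show k.val ≤ q by omega)
      have h5 := he.torus i ⟨0, hn⟩
      rw [h3]
      omega
    · show (rowSum (wMat e) i k : ℤ) + δ ≤ rowSum (wMat e) j l + δ
      rcases h with ⟨h, h'⟩ | ⟨h, h'⟩ <;> simp only at h h'
      · subst h
        have := rowSum_mono (wMat e) i (show k.val ≤ l.val by omega)
        omega
      · rw [h']
        have := he.right _ _ h l (by omega)
        omega
    · exact h.elim
    · obtain rfl : c = false := h
      exact Int.natCast_nonneg _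
    · obtain rfl : c = true := h
      show δ ≤ (rowSum (wMat e) j l : ℤ) + δ
      omega
    · exact h.elim
  · ext i a
    rw [uMat_patExp, hu i _ (by omega), hu i _ (by omega), rowSum_succ]
    simp
  · ext i a
    rw [wMat_patExp, hw i _ (by omega), hw i _ (by omega), rowSum_succ]
    simp

end Pattern

section PatternVariation

variable {n N m q : ℕ}

theorem antitone_of_val_succ {x : Fin n → ℤ}
    (h : ∀ i i' : Fin n, i'.val = i.val + 1 → x i' ≤ x i) : Antitone x := by
  have : ∀ d (i i' : Fin n), i'.val = i.val + d → x i' ≤ x i := by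
    intro d
    induction d with
    | zero => intro i i' hi; exact (congrArg x (Fin.ext hi)).le
    | succ d ih =>
      intro i i' hi
      exact (h ⟨i + d, by omega⟩ i' (by simp only; omega)).trans (ih i _ rfl)
  intro i i' hi
  rw [Fin.le_def] at hi
  exact this (i' - i) i i' (by omega)

theorem sum_abs_sub_sub_le {x y : Fin n → ℤ} (hsum : ∑ i, y i = ∑ i, x i) {c : ℤ} {l : ℕ}
    (h1 : ∀ i : Fin n, i.val < l → c ≤ y i) (h2 : ∀ i : Fin n, l ≤ i.val → y i ≤ c) :
    2 * ((∑ i, if i.val < l then x i else 0) - ∑ i, if i.val < l then y i else 0) ≤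
      ∑ i, |x i - c| - ∑ i, |y i - c| := by
  have hx : ∀ i : Fin n, 2 * (if i.val < l then x i else 0) - x i - (if i.val < l then c else -c) ≤
      |x i - c| := by
    intro i
    split_ifs
    · linarith [le_abs_self (x i - c)]
    · linarith [neg_abs_le (x i - c)]
  have hy : ∀ i : Fin n, |y i - c| =
      2 * (if i.val < l then y i else 0) - y i - (if i.val < l then c else -c) := by
    intro i
    split_ifs with h
    · rw [abs_of_nonneg (by linarith [h1 i h])]; ring
    · rw [abs_of_nonpos (by linarith [h2 i (by omega)])]; ring
  have hX := Finset.sum_le_sum fun i (_ : i ∈ Finset.univ) => hx i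
  have hY := Finset.sum_congr rfl fun i (_ : i ∈ Finset.univ) => hy i
  simp only [Finset.sum_sub_distrib, ← Finset.mul_sum] at hX hY
  linarith

theorem sum_abs_sub_le {x y : Fin n → ℤ} (hy : Antitone y) (hsum : ∑ i, y i = ∑ i, x i)
    (hle : ∀ l : ℕ, (∑ i, if i.val < l then y i else 0) ≤ ∑ i, if i.val < l then x i else 0)
    (c : ℤ) : ∑ i, |y i - c| ≤ ∑ i, |x i - c| := by
  classical
  have hex : ∃ l : ℕ, ∀ i : Fin n, l ≤ i.val → y i ≤ c := ⟨n, fun i hi => by omega⟩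
  have := sum_abs_sub_sub_le hsum (c := c) (l := Nat.find hex) (fun i hi => by
    have := Nat.find_min hex hi
    push Not at this
    obtain ⟨j, hj, hcj⟩ := this
    exact hcj.le.trans (hy (Fin.le_def.2 hj))) (Nat.find_spec hex)
  linarith [hle (Nat.find hex)]

theorem sum_abs_sub_lt {x y : Fin n → ℤ} (hy : Antitone y) (hsum : ∑ i, y i = ∑ i, x i) {j : Fin n}
    (hlt : (∑ i, if i.val < j.val then y i else 0) < ∑ i, if i.val < j.val then x i else 0) :
    ∑ i, |y i - y j| < ∑ i, |x i - y j| := by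
  have := sum_abs_sub_sub_le hsum (c := y j) (l := j) (fun i hi => hy (Fin.le_def.2 hi.le))
    (fun i hi => hy (Fin.le_def.2 hi))
  linarith

variable {f g : PatternIndex n m q → ℤ}

theorem MonoOn.antitone_uVal (hf : MonoOn PatternRel f) {k : ℕ} (hk : k ≤ m) :
    Antitone fun i => uVal f i k := by
  refine antitone_of_val_succ fun i i' hi => ?_
  rcases k with _ | k
  · rw [uVal_of_le (by omega), uVal_of_le (by omega)]
  · exact (hf.uVal_diag hi hk).trans (hf.uVal_le_succ hk)

theorem MonoOn.antitone_wVal (hf : MonoOn PatternRel f) (hm : n < m) (hq : n < q) {k : ℕ}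
    (hk : k ≤ q) : Antitone fun i => wVal f i k := by
  refine antitone_of_val_succ fun i i' hi => ?_
  rcases k with _ | k
  · rw [wVal_of_le hq (by omega), wVal_of_le hq (by omega)]
  · exact (hf.wVal_diag hm hq hi hk).trans (hf.wVal_le_succ hm hq hk)

theorem cornerSum_eq_of_rowSum {x : Fin n → Fin N → ℕ} {k : ℕ} {F : Fin n → ℤ} {c : ℤ}
    (h : ∀ i, (rowSum x i k : ℤ) = F i - c) (l : ℕ) :
    (cornerSum x k l : ℤ) = (∑ i, if i.val < l then F i else 0) -
      ∑ i : Fin n, if i.val < l then c else 0 := by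
  rw [cornerSum, Nat.cast_sum, ← Finset.sum_sub_distrib]
  refine Finset.sum_congr rfl fun i _ => ?_
  split_ifs
  · exact h i
  · simp

theorem MonoOn.cornerSum_uMat (hf : MonoOn PatternRel f) {k : ℕ} (hk : k ≤ m) (l : ℕ) :
    (cornerSum (uMat (patExp f)) k l : ℤ) = (∑ i, if i.val < l then uVal f i k else 0) -
      ∑ i : Fin n, if i.val < l then f (.inr (.inr false)) else 0 :=
  cornerSum_eq_of_rowSum (fun i => hf.rowSum_uMat i hk) l

theorem MonoOn.cornerSum_wMat (hf : MonoOn PatternRel f) (hm : n < m) (hq : n < q) {k : ℕ}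
    (hk : k ≤ q) (l : ℕ) :
    (cornerSum (wMat (patExp f)) k l : ℤ) = (∑ i, if i.val < l then wVal f i k else 0) -
      ∑ i : Fin n, if i.val < l then f (.inr (.inr true)) else 0 :=
  cornerSum_eq_of_rowSum (fun i => hf.rowSum_wMat hm hq i hk) l

theorem sum_ite_val_lt (x : Fin n → ℤ) : (∑ i, if i.val < n then x i else 0) = ∑ i, x i :=
  Finset.sum_congr rfl fun i _ => if_pos i.2

theorem eq_of_sum_ite_val_lt {x y : Fin n → ℤ} (hsum : ∑ i, y i = ∑ i, x i)
    (h : ∀ j : Fin n, (∑ i, if i.val < j.val then y i else 0) =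
      ∑ i, if i.val < j.val then x i else 0) (i : Fin n) : y i = x i := by
  have hsucc : ∀ (z : Fin n → ℤ) (j : Fin n), (∑ i, if i.val < j.val + 1 then z i else 0) =
      (∑ i, if i.val < j.val then z i else 0) + z j := by
    intro z j
    have : z j = ∑ i, if i = j then z i else 0 := by simp
    rw [this, ← Finset.sum_add_distrib]
    refine Finset.sum_congr rfl fun i _ => ?_
    simp only [Fin.ext_iff]
    split_ifs <;> omega
  have h1 := hsucc x i
  have h2 := hsucc y i
  rw [h] at h2
  have h3 : (∑ j, if j.val < i.val + 1 then y j else 0) =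
      ∑ j, if j.val < i.val + 1 then x j else 0 := by
    by_cases hi : i.val + 1 < n
    · exact h ⟨i + 1, hi⟩
    · obtain hi : i.val + 1 = n := by omega
      rw [hi, sum_ite_val_lt, sum_ite_val_lt, hsum]
  linarith

/-- The sum of distances to a level, in terms of the values in all columns. -/
theorem sum_abs_sub_add (hq : n < q) (f : PatternIndex n m q → ℤ) (c : ℤ) :
    ∑ p, |f p - c| +
      ((∑ _x : {x : Fin n × Fin (m + 1) // ¬ x.1.val < x.2.val}, |f (.inr (.inr false)) - c|) +
      ∑ _x : {x : Fin n × Fin q // ¬ x.1.val < x.2.val}, |f (.inr (.inr true)) - c|) =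
    ∑ k : Fin (m + 1), ∑ i, |uVal f i k - c| + ∑ k : Fin q, ∑ i, |wVal f i k - c| +
      (|f (.inr (.inr true)) - c| + |f (.inr (.inr false)) - c|) := by
  have hU : ∑ k : Fin (m + 1), ∑ i, |uVal f i k - c| =
      (∑ x : {x : Fin n × Fin (m + 1) // x.1.val < x.2.val}, |f (.inl x) - c|) +
      ∑ _x : {x : Fin n × Fin (m + 1) // ¬ x.1.val < x.2.val}, |f (.inr (.inr false)) - c| := by
    rw [← Fintype.sum_prod_type_right' (f := fun i (k : Fin (m + 1)) => |uVal f i k - c|),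
      ← Fintype.sum_subtype_add_sum_subtype (fun x : Fin n × Fin (m + 1) => x.1.val < x.2.val)]
    congr 1
    · exact Finset.sum_congr rfl fun x _ => by rw [uVal_coe]
    · exact Finset.sum_congr rfl fun x _ => by rw [uVal_of_le (not_lt.1 x.2)]
  have hW : ∑ k : Fin q, ∑ i, |wVal f i k - c| =
      (∑ x : {x : Fin n × Fin q // x.1.val < x.2.val}, |f (.inr (.inl x)) - c|) +
      ∑ _x : {x : Fin n × Fin q // ¬ x.1.val < x.2.val}, |f (.inr (.inr true)) - c| := by
    rw [← Fintype.sum_prod_type_right' (f := fun i (k : Fin q) => |wVal f i k - c|),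
      ← Fintype.sum_subtype_add_sum_subtype (fun x : Fin n × Fin q => x.1.val < x.2.val)]
    congr 1
    · exact Finset.sum_congr rfl fun x _ => by rw [wVal_coe]
    · exact Finset.sum_congr rfl fun x _ => by rw [wVal_of_le hq (not_lt.1 x.2)]
  rw [hU, hW, Fintype.sum_sum_type, Fintype.sum_sum_type, Fintype.sum_bool]
  ring

theorem pairVar_lt_of_sum_abs {P : Type*} [Fintype P] {f g : P → ℤ}
    (h : ∀ c, ∑ p, |g p - c| ≤ ∑ p, |f p - c|) {p₀ : P}
    (h₀ : ∑ p, |g p - g p₀| < ∑ p, |f p - g p₀|) : pairVar g < pairVar f := by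
  have h1 : pairVar g < ∑ p, ∑ p', |f p' - g p| := by
    rw [pairVar, Finset.sum_comm]
    exact Finset.sum_lt_sum (fun p _ => h (g p)) ⟨p₀, Finset.mem_univ _, h₀⟩
  have h2 : ∑ p, ∑ p', |f p' - g p| ≤ pairVar f := by
    rw [pairVar, Finset.sum_comm]
    refine Finset.sum_le_sum fun p _ => ?_
    simp only [abs_sub_comm (f p)]
    exact h (f p)
  exact h1.trans_le h2

theorem pairVar_lt_of_expDom_of_eq (hn : 0 < n) (hm : n < m) (hq : n < q)
    (hf : MonoOn PatternRel f) (hg : MonoOn PatternRel g) (h : ExpDom (patExp g) (patExp f))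
    (hne : patExp g ≠ patExp f) (ha : g (.inr (.inr false)) = f (.inr (.inr false))) :
    pairVar g < pairVar f := by
  have hsumU : ∀ k ≤ m, ∑ i, uVal g i k = ∑ i, uVal f i k := by
    intro k hk
    have h1 := (h.1 k).1
    zify at h1
    rw [hf.cornerSum_uMat hk, hg.cornerSum_uMat hk, ha] at h1
    simp only [sum_ite_val_lt] at h1
    linarith
  have hb : g (.inr (.inr true)) = f (.inr (.inr true)) := by
    have h1 := (h.2 q).1
    zify at h1
    rw [hf.cornerSum_wMat hm hq le_rfl, hg.cornerSum_wMat hm hq le_rfl] at h1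
    simp only [sum_ite_val_lt, wVal_last, hsumU m le_rfl] at h1
    simp only [Finset.sum_const, Finset.card_univ, Fintype.card_fin, nsmul_eq_mul] at h1
    have hn' : (n : ℤ) ≠ 0 := by exact_mod_cast hn.ne'
    exact mul_left_cancel₀ hn' (by linarith)
  have hsumW : ∀ k ≤ q, ∑ i, wVal g i k = ∑ i, wVal f i k := by
    intro k hk
    have h1 := (h.2 k).1
    zify at h1
    rw [hf.cornerSum_wMat hm hq hk, hg.cornerSum_wMat hm hq hk, hb] at h1
    simp only [sum_ite_val_lt] at h1
    linarith
  have hleU : ∀ k ≤ m, ∀ l : ℕ, (∑ i, if i.val < l then uVal g i k else 0) ≤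
      ∑ i, if i.val < l then uVal f i k else 0 := by
    intro k hk l
    have h1 := (h.1 k).2 l
    zify at h1
    rw [hf.cornerSum_uMat hk, hg.cornerSum_uMat hk, ha] at h1
    linarith
  have hleW : ∀ k ≤ q, ∀ l : ℕ, (∑ i, if i.val < l then wVal g i k else 0) ≤
      ∑ i, if i.val < l then wVal f i k else 0 := by
    intro k hk l
    have h1 := (h.2 k).2 l
    zify at h1
    rw [hf.cornerSum_wMat hm hq hk, hg.cornerSum_wMat hm hq hk, hb] at h1
    linarith
  have hcolU : ∀ k ≤ m, ∀ c, ∑ i, |uVal g i k - c| ≤ ∑ i, |uVal f i k - c| := fun k hk =>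
    sum_abs_sub_le (hg.antitone_uVal hk) (hsumU k hk) (hleU k hk)
  have hcolW : ∀ k ≤ q, ∀ c, ∑ i, |wVal g i k - c| ≤ ∑ i, |wVal f i k - c| := fun k hk =>
    sum_abs_sub_le (hg.antitone_wVal hm hq hk) (hsumW k hk) (hleW k hk)
  have hdiff : ∀ c, ∑ p, |f p - c| - ∑ p, |g p - c| =
      (∑ k : Fin (m + 1), ∑ i, |uVal f i k - c| - ∑ k : Fin (m + 1), ∑ i, |uVal g i k - c|) +
      (∑ k : Fin q, ∑ i, |wVal f i k - c| - ∑ k : Fin q, ∑ i, |wVal g i k - c|) := by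
    intro c
    have h1 := sum_abs_sub_add hq f c
    have h2 := sum_abs_sub_add hq g c
    rw [ha, hb] at h2
    linarith
  have hU : ∀ c, ∑ k : Fin (m + 1), ∑ i, |uVal g i k - c| ≤
      ∑ k : Fin (m + 1), ∑ i, |uVal f i k - c| := fun c =>
    Finset.sum_le_sum fun k _ => hcolU k (by omega) c
  have hW : ∀ c, ∑ k : Fin q, ∑ i, |wVal g i k - c| ≤
      ∑ k : Fin q, ∑ i, |wVal f i k - c| := fun c =>
    Finset.sum_le_sum fun k _ => hcolW k k.2.le c
  have hall : ∀ c, ∑ p, |g p - c| ≤ ∑ p, |f p - c| := fun c => by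
    linarith [hdiff c, hU c, hW c]
  have hstrict : (∃ (k : Fin (m + 1)) (j : Fin n), (∑ i, if i.val < j.val then uVal g i k else 0) <
        ∑ i, if i.val < j.val then uVal f i k else 0) ∨
      (∃ (k : Fin q) (j : Fin n), (∑ i, if i.val < j.val then wVal g i k else 0) <
        ∑ i, if i.val < j.val then wVal f i k else 0) := by
    by_contra! hcon
    refine hne ?_
    have e1 : ∀ k ≤ m, ∀ i, uVal g i k = uVal f i k := fun k hk =>
      eq_of_sum_ite_val_lt (hsumU k hk) fun j =>
        le_antisymm (hleU k hk _) (hcon.1 ⟨k, by omega⟩ j)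
    have e2 : ∀ k ≤ q, ∀ i, wVal g i k = wVal f i k := fun k hk => by
      rcases hk.lt_or_eq with hk | rfl
      · exact eq_of_sum_ite_val_lt (hsumW k hk.le) fun j =>
          le_antisymm (hleW k hk.le _) (hcon.2 ⟨k, hk⟩ j)
      · simpa only [wVal_last] using e1 m le_rfl
    refine exp_ext ?_ ?_
    · ext i a
      simp only [uMat_patExp]
      rw [e1 _ (by omega), e1 _ (by omega)]
    · ext i a
      simp only [wMat_patExp]
      rw [e2 _ (by omega), e2 _ (by omega)]
  rcases hstrict with ⟨k, j, hkj⟩ | ⟨k, j, hkj⟩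
  · obtain ⟨p₀, hp₀⟩ := uVal_mem_range g j k
    refine pairVar_lt_of_sum_abs hall (p₀ := p₀) ?_
    have h1 : ∑ k : Fin (m + 1), ∑ i, |uVal g i k - g p₀| <
        ∑ k : Fin (m + 1), ∑ i, |uVal f i k - g p₀| :=
      Finset.sum_lt_sum (fun k _ => hcolU k (by omega) _) ⟨k, Finset.mem_univ _, by
        rw [← hp₀]
        exact sum_abs_sub_lt (hg.antitone_uVal (k := k) (by omega)) (hsumU k (by omega)) hkj⟩
    linarith [hdiff (g p₀), hW (g p₀)]
  · obtain ⟨p₀, hp₀⟩ := wVal_mem_range g j k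
    refine pairVar_lt_of_sum_abs hall (p₀ := p₀) ?_
    have h1 : ∑ k : Fin q, ∑ i, |wVal g i k - g p₀| < ∑ k : Fin q, ∑ i, |wVal f i k - g p₀| :=
      Finset.sum_lt_sum (fun k _ => hcolW k k.2.le _) ⟨k, Finset.mem_univ _, by
        rw [← hp₀]
        exact sum_abs_sub_lt (hg.antitone_wVal hm hq (k := k) k.2.le) (hsumW k k.2.le) hkj⟩
    linarith [hdiff (g p₀), hU (g p₀)]

theorem pairVar_add_const {P : Type*} [Fintype P] (f : P → ℤ) (c : ℤ) :
    pairVar (fun p => f p + c) = pairVar f := by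
  simp [pairVar]

theorem pairVar_lt_of_expDom (hn : 0 < n) (hm : n < m) (hq : n < q)
    (hf : MonoOn PatternRel f) (hg : MonoOn PatternRel g) (h : ExpDom (patExp g) (patExp f))
    (hne : patExp g ≠ patExp f) : pairVar g < pairVar f := by
  set c := f (.inr (.inr false)) - g (.inr (.inr false)) with hc
  rw [← pairVar_add_const g c]
  rw [← patExp_add_const g c] at h hne
  exact pairVar_lt_of_expDom_of_eq hn hm hq hf (fun p p' hp => add_le_add_left (hg p p' hp) c) h hne
    (by simp only [hc]; ring)

end PatternVariation

section CohenMacaulay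

open MvPolynomial SMB

variable {K : Type} [Field K] {n m q : ℕ}

theorem MonoOn.indic_ge {P : Type*} [Fintype P] [DecidableEq P] {E : P → P → Prop} {f : P → ℤ}
    (hf : MonoOn E f) (c : ℤ) : MonoOn E (indic {p | c ≤ f p}) := by
  intro p p' h
  have := hf p p' h
  simp only [indic, Finset.mem_filter, Finset.mem_univ, true_and]
  split_ifs <;> omega

theorem MonoOn.sub_indic {P : Type*} [Fintype P] [DecidableEq P] {E : P → P → Prop} {f : P → ℤ}
    (hf : MonoOn E f) {c : ℤ} (hc : ∀ p, f p ≤ c) : MonoOn E (f - indic {p | c ≤ f p}) := by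
  intro p p' h
  have h1 := hf p p' h
  have h2 := hc p'
  simp only [Pi.sub_apply, indic, Finset.mem_filter, Finset.mem_univ, true_and]
  split_ifs <;> omega

theorem MonoOn.exists_led_indic {H : Finset (PatternIndex n m q)}
    (hH : MonoOn PatternRel (indic H)) (hm : n < m) (hq : n < q) :
    ∃ g : KX K n m q, IsSLInvariant g ∧ Led ExpDom (patExp (indic H)) g := by
  have hb : ∀ p, 0 ≤ indic H p ∧ indic H p ≤ 1 := fun p => by
    unfold indic; split_ifs <;> simp
  refine (hH.isStandardExp_patExp hm hq).exists_led_of_le_one (fun i => ?_) fun i => ?_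
  · have h1 := hH.rowSum_uMat i le_rfl
    obtain ⟨p, hp⟩ := uVal_mem_range (indic H) i m
    have h2 := hb p
    have h3 := hb (.inr (.inr false))
    omega
  · have h1 := hH.rowSum_wMat hm hq i le_rfl
    obtain ⟨p, hp⟩ := wVal_mem_range (indic H) i q
    have h2 := hb p
    have h3 := hb (.inr (.inr true))
    omega

theorem MonoOn.exists_led {f : PatternIndex n m q → ℤ} (hf : MonoOn PatternRel f) (hm : n < m)
    (hq : n < q) : ∃ g : KX K n m q, IsSLInvariant g ∧ Led ExpDom (patExp f) g := by
  suffices ∀ N : ℕ, ∀ f : PatternIndex n m q → ℤ, MonoOn PatternRel f →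
      (∀ p p', f p - f p' ≤ N) →
      ∃ g : KX K n m q, IsSLInvariant g ∧ Led ExpDom (patExp f) g by
    refine this (∑ p, ∑ p', (f p - f p').natAbs) f hf fun p p' => ?_
    have h1 := Finset.single_le_sum (f := fun p => ∑ p', (f p - f p').natAbs)
      (fun _ _ => Nat.zero_le _) (Finset.mem_univ p)
    have h2 := Finset.single_le_sum (f := fun p' => (f p - f p').natAbs)
      (fun _ _ => Nat.zero_le _) (Finset.mem_univ p')
    omega
  intro N
  induction N with
  | zero =>
    intro f hf hN
    have : f = fun _ => f (.inr (.inr true)) := funext fun p => by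
      have h1 := hN p (.inr (.inr true))
      have h2 := hN (.inr (.inr true)) p
      omega
    rw [this, patExp_const]
    exact ⟨1, (slInvariants K n m q).one_mem, Led.one expDom_isDominance⟩
  | succ N ih =>
    intro f hf hN
    obtain ⟨p₀, -, hp₀⟩ := Finset.univ.exists_max_image f ⟨.inr (.inr true), Finset.mem_univ _⟩
    replace hp₀ := fun p => hp₀ p (Finset.mem_univ p)
    obtain ⟨g, hg, hgl⟩ := ih _ (hf.sub_indic hp₀) (by
      intro p p'
      have h1 := hN p p'
      have h2 := hN p₀ p'
      have h3 := hp₀ p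
      have h4 := hp₀ p'
      simp only [Pi.sub_apply, indic, Finset.mem_filter, Finset.mem_univ, true_and]
      push_cast at *
      split_ifs <;> omega)
    obtain ⟨g', hg', hgl'⟩ := (hf.indic_ge (f p₀)).exists_led_indic (K := K) hm hq
    refine ⟨g * g', (slInvariants K n m q).mul_mem hg hg', ?_⟩
    rw [← sub_add_cancel f (indic _), patExp_add (hf.sub_indic hp₀) (hf.indic_ge _) hm hq]
    exact hgl.mul expDom_isDominance hgl'

theorem ExpDom.antisymm {e p : (Fin m × Fin n) ⊕ (Fin n × Fin q) →₀ ℕ} (h : ExpDom e p)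
    (h' : ExpDom p e) : e = p :=
  expKey_injective (le_antisymm (expKey_le_of_expDom h) (expKey_le_of_expDom h'))

theorem exists_free_finite_slInvariants (K : Type) [Field K] [Infinite K] (hn : 0 < n) (hm : n < m)
    (hq : n < q) : ∃ (d : ℕ) (θ : MvPolynomial (Fin d) K →ₐ[K] slInvariants K n m q),
      letI := θ.toRingHom.toAlgebra
      Module.Free (MvPolynomial (Fin d) K) (slInvariants K n m q) ∧
        Module.Finite (MvPolynomial (Fin d) K) (slInvariants K n m q) := by
  have hled : ∀ e : (Fin m × Fin n) ⊕ (Fin n × Fin q) →₀ ℕ, ∃ g : slInvariants K n m q,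
      IsStandardExp e → Led ExpDom e (g : KX K n m q) := fun e => by
    by_cases he : IsStandardExp e
    · obtain ⟨f, hf, rfl⟩ := he.exists_patExp_eq hn hq
      obtain ⟨g, hg, hgl⟩ := hf.exists_led (K := K) hm hq
      exact ⟨⟨g, hg⟩, fun _ => hgl⟩
    · exact ⟨0, fun h => absurd h he⟩
  choose c hc using hled
  have hcf : ∀ {f : PatternIndex n m q → ℤ}, MonoOn PatternRel f →
      Led ExpDom (patExp f) (c (patExp f) : KX K n m q) := fun hf =>
    hc _ (hf.isStandardExp_patExp hm hq)
  have : Nonempty (PatternIndex n m q) := ⟨.inr (.inr true)⟩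
  refine exists_free_finite_of_height (E := PatternRel) patternHeight (fun _ _ => patternHeight_lt)
    (b := fun f => c (patExp f)) (fun f a => by rw [patExp_add_const]) ?_ ?_ ?_
  · refine eq_top_iff.2 fun r _ => Submodule.span_mono ?_
      (mem_span_of_support hc (Q := fun _ => True) (fun _ _ _ _ => trivial) r fun _ _ => trivial)
    rintro _ ⟨e, ⟨he, -⟩, rfl⟩
    obtain ⟨f, hf, rfl⟩ := he.exists_patExp_eq hn hq
    exact ⟨f, hf, rfl⟩
  · intro ι s hs hinj
    refine LinearIndependent.of_comp (slInvariants K n m q).val.toLinearMap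
      (linearIndependent_of_led (p := fun i => patExp (s i)) (fun i j hij => ?_)
        fun i => hcf (hs i))
    exact hinj i j _ (eq_add_const_of_patExp_eq hn hm hq (hs i) (hs j) hij)
  · intro H f hH hf
    have hfH := hf.add hH
    set p := patExp (f + indic H) with hp
    have hlm : Led ExpDom p ((c (patExp (indic H)) * c (patExp f) : slInvariants K n m q) :
        KX K n m q) := by
      rw [hp, patExp_add hf hH hm hq, mul_comm]
      exact (hcf hf).mul expDom_isDominance (hcf hH)
    refine Submodule.span_mono ?_ (mem_span_of_support hc (Q := fun e => ExpDom e p ∧ e ≠ p)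
      (fun e p' h h' => ⟨h.trans h'.1, fun he => h'.2 (h'.1.antisymm (he ▸ h))⟩) _ fun e he => ?_)
    · rintro _ ⟨e, ⟨he, hd, hne⟩, rfl⟩
      obtain ⟨f', hf', rfl⟩ := he.exists_patExp_eq hn hq
      exact ⟨f', ⟨hf', pairVar_lt_of_expDom hn hm hq hfH hf' hd hne⟩, rfl⟩
    · rw [mem_support_iff, AddSubgroupClass.coe_sub, coeff_sub] at he
      refine ⟨?_, ?_⟩
      · by_cases h1 : coeff e (c p : KX K n m q) = 0
        · exact hlm.2 e fun h2 => he (by rw [h1, h2, sub_zero])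
        · exact (hcf hfH).2 e h1
      · rintro rfl
        exact he (by rw [hlm.1, (hcf hfH).1, sub_self])

theorem locallyMaxDepth_slInvariants (K : Type) [Field K] [Infinite K] (hn : 0 < n) (hm : n < m)
    (hq : n < q) :
    IsNoetherianRing (slInvariants K n m q) ∧ LocallyMaxDepth (slInvariants K n m q) := by
  obtain ⟨d, θ, h⟩ := exists_free_finite_slInvariants K hn hm hq
  let := θ.toRingHom.toAlgebra
  obtain ⟨h1, h2⟩ := h
  have : Algebra.IsIntegral (MvPolynomial (Fin d) K) (slInvariants K n m q) :=
    Algebra.IsIntegral.of_finite _ _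
  exact ⟨IsNoetherianRing.of_finite (MvPolynomial (Fin d) K) _,
    .of_flat_of_isIntegral (locallyMaxDepth_mvPolynomial K d)⟩

end CohenMacaulay

open SMB in
/-- **`K[X]^{SL_n(K)}` is Cohen–Macaulay.**
For every prime ideal `𝔭` of the ring of invariants `K[X]^{SL_n(K)}`, the localization at
`𝔭` is a Cohen–Macaulay local ring: its depth equals its Krull dimension. -/
theorem sl_invariants_cohenMacaulay (K : Type) [Field K] [IsAlgClosed K]
    (n m q : ℕ) (hn : 0 < n) (hm : n < m) (hq : n < q) :
    ∀ (P : Ideal (slInvariants K n m q)) (hP : P.IsPrime),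
      letI : P.IsPrime := hP
      localDepth (Localization.AtPrime P) = ringKrullDim (Localization.AtPrime P) := by
  intro P hP
  obtain ⟨hN, hD⟩ := locallyMaxDepth_slInvariants K hn hm hq
  have : IsNoetherianRing (Localization.AtPrime P) :=
    IsLocalization.isNoetherianRing P.primeCompl _ hN
  exact (hD P).isLUB_length_isRegular.sSup_eq
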